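/- Regularity at the blowup time: there exist an initial datum ρ₀ ∈ C_c^∞(ℝ²), a source F : ℝ² × [0,1) → ℝ such that each F(·,t) is C^∞ and supported in the closed unit ball and sup_{t∈[0,1)} ‖F(·,t)‖_{C^k} < ∞ for every k ∈ ℕ, and a smooth solution (ρ,u,P) of the IPM system on ℝ² × [0,1) with ρ(·,0) = ρ₀, each ρ(·,t) compactly supported and each u(·,t) square integrable, such that ‖ρ(·,t)‖_{C¹} → ∞ as t → 1⁻, while ρ(·,t) converges uniformly on ℝ² as t → 1⁻ to a compactly supported function ρ₁ : ℝ² → ℝ which is C^∞ on ℝ² ∖ {0} and α-Hölder continuous for every α ∈ (0,1). -/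

import Mathlib

open MeasureTheory Real Filter

/-- First spatial partial derivative `∂/∂x₁`. -/
noncomputable def pd1 (f : ℝ × ℝ → ℝ) : ℝ × ℝ → ℝ := fun x => fderiv ℝ f x (1, 0)

/-- Second spatial partial derivative `∂/∂x₂`. -/
noncomputable def pd2 (f : ℝ × ℝ → ℝ) : ℝ × ℝ → ℝ := fun x => fderiv ℝ f x (0, 1)

/-- Mixed partial derivative `∂₁^i ∂₂^j f`. -/
noncomputable def pdMix (i j : ℕ) (f : ℝ × ℝ → ℝ) : ℝ × ℝ → ℝ := pd1^[i] (pd2^[j] f)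

/-- The `C^k` norm: supremum of the absolute values of all partial derivatives
of order at most `k`. -/
noncomputable def CkNorm (k : ℕ) (f : ℝ × ℝ → ℝ) : ℝ :=
  sSup {y : ℝ | ∃ i j : ℕ, ∃ x : ℝ × ℝ, i + j ≤ k ∧ y = |pdMix i j f x|}

/-- The space-time domain `ℝ² × [0,1)`. -/
def spaceTime : Set ((ℝ × ℝ) × ℝ) := Set.univ ×ˢ Set.Ico (0 : ℝ) 1

open Set Topology

/-! ### Directional derivatives on space-time -/

/-- Directional derivative on space-time. -/
noncomputable def dd (v : (ℝ × ℝ) × ℝ) (φ : (ℝ × ℝ) × ℝ → ℝ) : (ℝ × ℝ) × ℝ → ℝ :=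
  fun p => fderiv ℝ φ p v

/-- First spatial unit vector of space-time. -/
abbrev e1 : (ℝ × ℝ) × ℝ := ((1, 0), 0)
/-- Second spatial unit vector of space-time. -/
abbrev e2 : (ℝ × ℝ) × ℝ := ((0, 1), 0)
/-- Time unit vector of space-time. -/
abbrev et : (ℝ × ℝ) × ℝ := ((0, 0), 1)

/-- Spatial Laplacian. -/
noncomputable def lap (φ : (ℝ × ℝ) × ℝ → ℝ) : (ℝ × ℝ) × ℝ → ℝ :=
  fun p => dd e1 (dd e1 φ) p + dd e2 (dd e2 φ) p

/-- Minus the source generated by the potential `φ`, i.e. by the density `-Δφ`. -/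
noncomputable def NN (φ : (ℝ × ℝ) × ℝ → ℝ) : (ℝ × ℝ) × ℝ → ℝ := fun p =>
  dd et (lap φ) p + dd e1 (dd e1 φ) p * dd e2 (lap φ) p - dd e1 (dd e2 φ) p * dd e1 (lap φ) p

section
variable {φ ψ : (ℝ × ℝ) × ℝ → ℝ} {v w p : (ℝ × ℝ) × ℝ}

theorem contDiff_dd (v : (ℝ × ℝ) × ℝ) (h : ContDiff ℝ (⊤ : ℕ∞) φ) :
    ContDiff ℝ (⊤ : ℕ∞) (dd v φ) :=
  (h.fderiv_right (m := (⊤ : ℕ∞)) (by simp)).clm_apply contDiff_const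

theorem contDiff_lap (h : ContDiff ℝ (⊤ : ℕ∞) φ) : ContDiff ℝ (⊤ : ℕ∞) (lap φ) :=
  (contDiff_dd _ (contDiff_dd _ h)).add (contDiff_dd _ (contDiff_dd _ h))

theorem contDiff_NN (h : ContDiff ℝ (⊤ : ℕ∞) φ) : ContDiff ℝ (⊤ : ℕ∞) (NN φ) :=
  ((contDiff_dd _ (contDiff_lap h)).add
    ((contDiff_dd _ (contDiff_dd _ h)).mul (contDiff_dd _ (contDiff_lap h)))).sub
    ((contDiff_dd _ (contDiff_dd _ h)).mul (contDiff_dd _ (contDiff_lap h)))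

theorem ContDiff.dat (h : ContDiff ℝ (⊤ : ℕ∞) φ) : DifferentiableAt ℝ φ p :=
  (h.differentiable (by simp)).differentiableAt

theorem dd_congr (h : φ =ᶠ[𝓝 p] ψ) : dd v φ =ᶠ[𝓝 p] dd v ψ := by
  filter_upwards [h.fderiv (𝕜 := ℝ)] with q hq
  simp [dd, hq]

theorem lap_congr (h : φ =ᶠ[𝓝 p] ψ) : lap φ =ᶠ[𝓝 p] lap ψ := by
  filter_upwards [dd_congr (v := e1) (dd_congr (v := e1) h),
    dd_congr (v := e2) (dd_congr (v := e2) h)] with q h1 h2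
  simp [lap, h1, h2]

theorem NN_congr (h : φ =ᶠ[𝓝 p] ψ) : NN φ =ᶠ[𝓝 p] NN ψ := by
  filter_upwards [dd_congr (v := e1) (dd_congr (v := e1) h),
    dd_congr (v := e1) (dd_congr (v := e2) h), dd_congr (v := et) (lap_congr h),
    dd_congr (v := e1) (lap_congr h), dd_congr (v := e2) (lap_congr h)] with q h1 h2 h3 h4 h5
  simp [NN, h1, h2, h3, h4, h5]

theorem dd_add (hφ : ContDiff ℝ (⊤ : ℕ∞) φ) (hψ : ContDiff ℝ (⊤ : ℕ∞) ψ) :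
    dd v (fun p => φ p + ψ p) = fun p => dd v φ p + dd v ψ p := by
  funext p; simp [dd, fderiv_fun_add hφ.dat hψ.dat]

@[simp] theorem dd_zero : dd v (fun _ => 0) = fun _ => 0 := by
  funext p; simp [dd]

@[simp] theorem lap_zero : lap (fun _ => 0) = fun _ => 0 := by
  funext p; simp [lap]

@[simp] theorem NN_zero : NN (fun _ => 0) = fun _ => 0 := by
  funext p; simp [NN]

theorem dd_neg : dd v (fun p => -φ p) = fun p => -dd v φ p := by
  funext p; simp [dd, fderiv_fun_neg]

theorem lap_add (hφ : ContDiff ℝ (⊤ : ℕ∞) φ) (hψ : ContDiff ℝ (⊤ : ℕ∞) ψ) :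
    lap (fun p => φ p + ψ p) = fun p => lap φ p + lap ψ p := by
  funext p
  simp only [lap, dd_add hφ hψ, dd_add (contDiff_dd _ hφ) (contDiff_dd _ hψ)]
  ring

theorem dd_comm (h : ContDiff ℝ (⊤ : ℕ∞) φ) : dd v (dd w φ) = dd w (dd v φ) := by
  funext p
  have hs : IsSymmSndFDerivAt ℝ φ p :=
    h.contDiffAt.isSymmSndFDerivAt (by simp; exact WithTop.coe_le_coe.2 le_top)
  have hd : DifferentiableAt ℝ (fderiv ℝ φ) p :=
    ((h.fderiv_right (m := (⊤ : ℕ∞)) (by simp)).differentiable (by simp)).differentiableAt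
  have key : ∀ a b, dd a (dd b φ) p = fderiv ℝ (fderiv ℝ φ) p a b := by
    intro a b
    unfold dd
    rw [fderiv_clm_apply hd (differentiableAt_const b)]
    simp
  rw [key, key, hs.eq]

/-- Spatial mixed derivative on space-time. -/
noncomputable def ddMix (i j : ℕ) (φ : (ℝ × ℝ) × ℝ → ℝ) : (ℝ × ℝ) × ℝ → ℝ :=
  (dd e1)^[i] ((dd e2)^[j] φ)

theorem contDiff_dd_iterate (h : ContDiff ℝ (⊤ : ℕ∞) φ) (v) (j : ℕ) :
    ContDiff ℝ (⊤ : ℕ∞) ((dd v)^[j] φ) := by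
  induction j with
  | zero => simpa
  | succ j ih => rw [Function.iterate_succ_apply']; exact contDiff_dd _ ih

theorem contDiff_ddMix (h : ContDiff ℝ (⊤ : ℕ∞) φ) (i j : ℕ) :
    ContDiff ℝ (⊤ : ℕ∞) (ddMix i j φ) :=
  contDiff_dd_iterate (contDiff_dd_iterate h _ _) _ _

theorem dd_iterate_add (hφ : ContDiff ℝ (⊤ : ℕ∞) φ) (hψ : ContDiff ℝ (⊤ : ℕ∞) ψ) (j : ℕ) :
    (dd v)^[j] (fun p => φ p + ψ p) = fun p => (dd v)^[j] φ p + (dd v)^[j] ψ p := by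
  induction j with
  | zero => simp
  | succ j ih =>
    simp only [Function.iterate_succ_apply', ih]
    exact dd_add (contDiff_dd_iterate hφ _ _) (contDiff_dd_iterate hψ _ _)

theorem ddMix_add (hφ : ContDiff ℝ (⊤ : ℕ∞) φ) (hψ : ContDiff ℝ (⊤ : ℕ∞) ψ) (i j : ℕ) :
    ddMix i j (fun p => φ p + ψ p) = fun p => ddMix i j φ p + ddMix i j ψ p := by
  unfold ddMix
  rw [dd_iterate_add hφ hψ, dd_iterate_add (contDiff_dd_iterate hφ _ _) (contDiff_dd_iterate hψ _ _)]

theorem dd_iterate_congr (h : φ =ᶠ[𝓝 p] ψ) (j : ℕ) :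
    (dd v)^[j] φ =ᶠ[𝓝 p] (dd v)^[j] ψ := by
  induction j with
  | zero => simpa
  | succ j ih => simp only [Function.iterate_succ_apply']; exact dd_congr ih

theorem ddMix_congr (h : φ =ᶠ[𝓝 p] ψ) (i j : ℕ) : ddMix i j φ =ᶠ[𝓝 p] ddMix i j ψ :=
  dd_iterate_congr (dd_iterate_congr h _) _

theorem pd1_slice (h : ∀ x : ℝ × ℝ, DifferentiableAt ℝ φ (x, t)) :
    pd1 (fun x => φ (x, t)) = fun x => dd e1 φ (x, t) := by
  funext x
  have h1 : HasFDerivAt (fun x : ℝ × ℝ => (x, t)) (ContinuousLinearMap.inl ℝ (ℝ × ℝ) ℝ) x :=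
    hasFDerivAt_prodMk_left x t
  have := ((h x).hasFDerivAt.comp x h1).fderiv
  simp only [pd1, dd]
  change fderiv ℝ (φ ∘ fun x => (x, t)) x (1, 0) = _
  rw [this]; simp

theorem pd2_slice (h : ∀ x : ℝ × ℝ, DifferentiableAt ℝ φ (x, t)) :
    pd2 (fun x => φ (x, t)) = fun x => dd e2 φ (x, t) := by
  funext x
  have h1 : HasFDerivAt (fun x : ℝ × ℝ => (x, t)) (ContinuousLinearMap.inl ℝ (ℝ × ℝ) ℝ) x :=
    hasFDerivAt_prodMk_left x t
  have := ((h x).hasFDerivAt.comp x h1).fderiv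
  simp only [pd2, dd]
  change fderiv ℝ (φ ∘ fun x => (x, t)) x (0, 1) = _
  rw [this]; simp

theorem pdMix_slice (h : ContDiff ℝ (⊤ : ℕ∞) φ) (t : ℝ) (i j : ℕ) :
    pdMix i j (fun x => φ (x, t)) = fun x => ddMix i j φ (x, t) := by
  have h2 : pd2^[j] (fun x => φ (x, t)) = fun x => (dd e2)^[j] φ (x, t) := by
    induction j with
    | zero => simp
    | succ j ih =>
      simp only [Function.iterate_succ_apply', ih]
      exact pd2_slice fun x => (contDiff_dd_iterate h _ _).dat
  unfold pdMix ddMix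
  rw [h2]
  have h3 := contDiff_dd_iterate h e2 j
  generalize (dd e2)^[j] φ = ψ at *
  induction i with
  | zero => simp
  | succ j ih =>
    simp only [Function.iterate_succ_apply', ih]
    exact pd1_slice fun x => (contDiff_dd_iterate h3 _ _).dat

end

/-! ### Coefficients depending polynomially on a large parameter -/

/-- Data of an oscillating layer: the frame `η, ζ`, the amplitude `a` and the background density
gradient `α η + γ ζ`; `D` controls everything on `[t0, 1]`, `ℓ` is the wavelength and `R` the
radius. -/
structure Dat where
  (D ℓ R t0 : ℝ)
  (η1 η2 ζ1 ζ2 a : ℝ → ℝ)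
  (α γ : ℝ)
  two_le : 2 ≤ D
  ℓ_pos : 0 < ℓ
  ℓ_le : ℓ ≤ R
  R_le : R ≤ 1
  R_inv : R⁻¹ ≤ D
  t0_lt : t0 < 1
  t0_ge : 0 ≤ t0
  smη1 : ContDiff ℝ (⊤ : ℕ∞) η1
  smη2 : ContDiff ℝ (⊤ : ℕ∞) η2
  smζ1 : ContDiff ℝ (⊤ : ℕ∞) ζ1
  smζ2 : ContDiff ℝ (⊤ : ℕ∞) ζ2
  sma : ContDiff ℝ (⊤ : ℕ∞) a
  bη1 : ∀ t ∈ Icc t0 1, |η1 t| ≤ D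
  bη2 : ∀ t ∈ Icc t0 1, |η2 t| ≤ D
  bζ1 : ∀ t ∈ Icc t0 1, |ζ1 t| ≤ D
  bζ2 : ∀ t ∈ Icc t0 1, |ζ2 t| ≤ D
  bη1' : ∀ t ∈ Icc t0 1, |deriv η1 t| ≤ D
  bη2' : ∀ t ∈ Icc t0 1, |deriv η2 t| ≤ D
  bζ1' : ∀ t ∈ Icc t0 1, |deriv ζ1 t| ≤ D
  bζ2' : ∀ t ∈ Icc t0 1, |deriv ζ2 t| ≤ D
  ba : ∀ t ∈ Icc t0 1, |a t| ≤ D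
  bα : |α| ≤ D
  bγ : |γ| ≤ D
  bN : ∀ t ∈ Icc t0 1, (η1 t ^ 2 + η2 t ^ 2)⁻¹ ≤ D
  cross : ∀ t, η1 t * ζ2 t - η2 t * ζ1 t = 1
  a_deriv : ∀ t, deriv a t = γ * η1 t / (η1 t ^ 2 + η2 t ^ 2) * a t

namespace Dat

variable (d : Dat)

theorem D_pos : 0 < d.D := by linarith [d.two_le]

theorem one_le : 1 ≤ d.D := by linarith [d.two_le]

theorem R_pos : 0 < d.R := d.ℓ_pos.trans_le d.ℓ_le

theorem N_pos (t : ℝ) : 0 < d.η1 t ^ 2 + d.η2 t ^ 2 := by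
  have := d.cross t
  by_contra h
  have h1 : d.η1 t = 0 := by nlinarith [sq_nonneg (d.η1 t), sq_nonneg (d.η2 t)]
  have h2 : d.η2 t = 0 := by nlinarith [sq_nonneg (d.η1 t), sq_nonneg (d.η2 t)]
  simp [h1, h2] at this

/-- Ratio of wavelength to radius. -/
noncomputable def δ : ℝ := d.ℓ / d.R

theorem δ_pos : 0 < d.δ := div_pos d.ℓ_pos d.R_pos

theorem δ_le : d.δ ≤ 1 := (div_le_one d.R_pos).2 d.ℓ_le

/-- Squared length of `η`. -/
def N2 (t : ℝ) : ℝ := d.η1 t ^ 2 + d.η2 t ^ 2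

/-- Logarithmic derivative of the amplitude. -/
noncomputable def r (t : ℝ) : ℝ := d.γ * d.η1 t / (d.η1 t ^ 2 + d.η2 t ^ 2)

end Dat

/-- Smooth coefficients with polynomial growth in `D`. -/
def TB0 (c : Dat → ℝ → ℝ) : Prop :=
  (∃ N : ℕ, ∀ d : Dat, ∀ t ∈ Icc d.t0 1, |c d t| ≤ d.D ^ N) ∧ ∀ d, ContDiff ℝ (⊤ : ℕ∞) (c d)

/-- Coefficients which together with their time derivative have polynomial growth. -/
def TB1 (c : Dat → ℝ → ℝ) : Prop := TB0 c ∧ TB0 fun d => deriv (c d)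

theorem TB0.of_le {c : Dat → ℝ → ℝ} (N : ℕ)
    (h : ∀ d : Dat, ∀ t ∈ Icc d.t0 1, |c d t| ≤ d.D ^ N)
    (hs : ∀ d, ContDiff ℝ (⊤ : ℕ∞) (c d)) : TB0 c := ⟨⟨N, h⟩, hs⟩

theorem TB0.mul {b c : Dat → ℝ → ℝ} (hb : TB0 b) (hc : TB0 c) : TB0 fun d t => b d t * c d t := by
  obtain ⟨⟨N, hN⟩, hb⟩ := hb
  obtain ⟨⟨M, hM⟩, hc⟩ := hc
  refine ⟨⟨N + M, fun d t ht => ?_⟩, fun d => (hb d).mul (hc d)⟩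
  rw [abs_mul, pow_add]
  exact mul_le_mul (hN d t ht) (hM d t ht) (abs_nonneg _) (pow_nonneg d.D_pos.le _)

theorem two_pow_add_le {D : ℝ} (h : 2 ≤ D) (N M : ℕ) : D ^ N + D ^ M ≤ D ^ (N + M + 1) := by
  have h1 : 1 ≤ D := by linarith
  have a : D ^ N ≤ D ^ (N + M) := pow_le_pow_right₀ h1 (by omega)
  have b : D ^ M ≤ D ^ (N + M) := pow_le_pow_right₀ h1 (by omega)
  have c : 0 < D ^ (N + M) := by positivity
  rw [pow_succ]; nlinarith

theorem TB0.add {b c : Dat → ℝ → ℝ} (hb : TB0 b) (hc : TB0 c) : TB0 fun d t => b d t + c d t := by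
  obtain ⟨⟨N, hN⟩, hb⟩ := hb
  obtain ⟨⟨M, hM⟩, hc⟩ := hc
  refine ⟨⟨N + M + 1, fun d t ht => ?_⟩, fun d => (hb d).add (hc d)⟩
  exact (abs_add_le _ _).trans ((add_le_add (hN d t ht) (hM d t ht)).trans
    (two_pow_add_le d.two_le N M))

theorem TB0.neg {b : Dat → ℝ → ℝ} (hb : TB0 b) : TB0 fun d t => -b d t := by
  obtain ⟨⟨N, hN⟩, hb⟩ := hb
  exact ⟨⟨N, fun d t ht => by rw [abs_neg]; exact hN d t ht⟩, fun d => (hb d).neg⟩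

theorem exists_le_two_pow (x : ℝ) : ∃ N : ℕ, x ≤ 2 ^ N := by
  obtain ⟨N, hN⟩ := pow_unbounded_of_one_lt x (by norm_num : (1 : ℝ) < 2)
  exact ⟨N, hN.le⟩

theorem TB0.const (x : ℝ) : TB0 fun _ _ => x := by
  obtain ⟨N, hN⟩ := exists_le_two_pow |x|
  exact ⟨⟨N, fun d _ _ => hN.trans (pow_le_pow_left₀ (by norm_num) d.two_le N)⟩,
    fun _ => contDiff_const⟩

theorem TB1.mul {b c : Dat → ℝ → ℝ} (hb : TB1 b) (hc : TB1 c) : TB1 fun d t => b d t * c d t := by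
  refine ⟨hb.1.mul hc.1, ?_⟩
  have : (fun d => deriv fun t => b d t * c d t) = fun d t =>
      deriv (b d) t * c d t + b d t * deriv (c d) t := by
    funext d t
    exact deriv_fun_mul ((hb.1.2 d).differentiable (by simp)).differentiableAt
      ((hc.1.2 d).differentiable (by simp)).differentiableAt
  rw [this]
  exact (hb.2.mul hc.1).add (hb.1.mul hc.2)

theorem TB1.add {b c : Dat → ℝ → ℝ} (hb : TB1 b) (hc : TB1 c) : TB1 fun d t => b d t + c d t := by
  refine ⟨hb.1.add hc.1, ?_⟩
  have : (fun d => deriv fun t => b d t + c d t) = fun d t => deriv (b d) t + deriv (c d) t := by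
    funext d t
    exact deriv_fun_add ((hb.1.2 d).differentiable (by simp)).differentiableAt
      ((hc.1.2 d).differentiable (by simp)).differentiableAt
  rw [this]
  exact hb.2.add hc.2

theorem TB1.const (x : ℝ) : TB1 fun _ _ => x := by
  refine ⟨TB0.const x, ?_⟩
  simpa using TB0.const 0

theorem TB1.δpow (J : ℕ) : TB1 fun d _ => d.δ ^ J := by
  constructor
  · refine TB0.of_le 0 (fun d t _ => ?_) fun d => contDiff_const
    rw [pow_zero, abs_of_pos (pow_pos d.δ_pos _)]
    exact pow_le_one₀ d.δ_pos.le d.δ_le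
  · simpa using TB0.const 0

theorem ContDiff.deriv_top {f : ℝ → ℝ} (h : ContDiff ℝ (⊤ : ℕ∞) f) :
    ContDiff ℝ (⊤ : ℕ∞) (deriv f) := (contDiff_infty_iff_deriv.1 h).2

theorem TB1.η1 : TB1 fun d t => d.η1 t :=
  ⟨TB0.of_le 1 (fun d t ht => by simpa using d.bη1 t ht) fun d => d.smη1,
    TB0.of_le 1 (fun d t ht => by simpa using d.bη1' t ht) fun d => d.smη1.deriv_top⟩

theorem TB1.η2 : TB1 fun d t => d.η2 t :=
  ⟨TB0.of_le 1 (fun d t ht => by simpa using d.bη2 t ht) fun d => d.smη2,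
    TB0.of_le 1 (fun d t ht => by simpa using d.bη2' t ht) fun d => d.smη2.deriv_top⟩

theorem TB1.ζ1 : TB1 fun d t => d.ζ1 t :=
  ⟨TB0.of_le 1 (fun d t ht => by simpa using d.bζ1 t ht) fun d => d.smζ1,
    TB0.of_le 1 (fun d t ht => by simpa using d.bζ1' t ht) fun d => d.smζ1.deriv_top⟩

theorem TB1.ζ2 : TB1 fun d t => d.ζ2 t :=
  ⟨TB0.of_le 1 (fun d t ht => by simpa using d.bζ2 t ht) fun d => d.smζ2,
    TB0.of_le 1 (fun d t ht => by simpa using d.bζ2' t ht) fun d => d.smζ2.deriv_top⟩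

theorem TB0.a : TB0 fun d t => d.a t :=
  TB0.of_le 1 (fun d t ht => by simpa using d.ba t ht) fun d => d.sma

theorem TB0.α : TB0 fun d _ => d.α :=
  TB0.of_le 1 (fun d t _ => by simpa using d.bα) fun d => contDiff_const

theorem TB0.γ : TB0 fun d _ => d.γ :=
  TB0.of_le 1 (fun d t _ => by simpa using d.bγ) fun d => contDiff_const

theorem TB1.N2 : TB1 fun d t => d.N2 t := by
  have := (TB1.η1.mul TB1.η1).add (TB1.η2.mul TB1.η2)
  simpa [Dat.N2, pow_two] using this

theorem Dat.N2_pos (d : Dat) (t : ℝ) : 0 < d.N2 t := d.N_pos t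

theorem TB1.N2inv : TB1 fun d t => (d.N2 t)⁻¹ := by
  have h0 : TB0 fun d t => (d.N2 t)⁻¹ := by
    refine TB0.of_le 1 (fun d t ht => ?_) fun d => (TB1.N2.1.2 d).inv fun t => (d.N2_pos t).ne'
    rw [abs_of_pos (inv_pos.2 (d.N2_pos t)), pow_one]
    exact d.bN t ht
  refine ⟨h0, ?_⟩
  have : (fun d : Dat => deriv fun t => (d.N2 t)⁻¹) = fun d t =>
      -(deriv d.N2 t * ((d.N2 t)⁻¹ * (d.N2 t)⁻¹)) := by
    funext d t
    rw [deriv_fun_inv'' ((TB1.N2.1.2 d).differentiable (by simp)).differentiableAt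
      (d.N2_pos t).ne']
    field_simp
  rw [this]
  exact (TB1.N2.2.mul (h0.mul h0)).neg

theorem TB0.r : TB0 fun d t => d.r t := by
  have := (TB0.γ.mul TB1.η1.1).mul TB1.N2inv.1
  simpa [Dat.r, div_eq_mul_inv, Dat.N2] using this

theorem hasDerivAt_tint {f : ℝ → ℝ} (hf : Continuous f) (t : ℝ) :
    HasDerivAt (fun t => ∫ u in t..1, f u) (-f t) t :=
  intervalIntegral.integral_hasDerivAt_left (hf.intervalIntegrable _ _)
    hf.stronglyMeasurable.stronglyMeasurableAtFilter hf.continuousAt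

theorem TB1.tint {b : Dat → ℝ → ℝ} (hb : TB0 b) : TB1 fun d t => ∫ u in t..1, b d u := by
  have hd : (fun d => deriv fun t => ∫ u in t..1, b d u) = fun d t => -b d t := by
    funext d t
    exact (hasDerivAt_tint (hb.2 d).continuous t).deriv
  have h1 : TB0 fun d => deriv fun t => ∫ u in t..1, b d u := by rw [hd]; exact hb.neg
  refine ⟨⟨?_, fun d => ?_⟩, h1⟩
  · obtain ⟨N, hN⟩ := hb.1
    refine ⟨N, fun d t ht => ?_⟩
    have := intervalIntegral.norm_integral_le_of_norm_le_const (a := t) (b := 1) (f := b d)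
      (C := d.D ^ N) fun u hu => by
        rw [uIoc_of_le ht.2] at hu
        exact hN d u ⟨ht.1.trans hu.1.le, hu.2⟩
    refine this.trans (mul_le_of_le_one_right (pow_nonneg d.D_pos.le _) ?_)
    rw [abs_of_nonneg (by linarith [ht.2])]
    linarith [ht.1, d.t0_ge]
  · rw [contDiff_infty_iff_deriv]
    exact ⟨fun t => (hasDerivAt_tint (hb.2 d).continuous t).differentiableAt, h1.2 d⟩

/-! ### Symbols -/

/-- Smooth functions of the fast phase. -/
def Per (q : ℝ → ℝ) : Prop := ContDiff ℝ (⊤ : ℕ∞) q ∧ Function.Periodic q (2 * π)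

/-- Smooth cutoffs, constant near the origin and supported in `[-1, 1]`. -/
def Cut (X : ℝ → ℝ) : Prop := ContDiff ℝ (⊤ : ℕ∞) X ∧ (∀ x, 1 < |x| → X x = 0) ∧
  ∃ y, ∀ x, |x| < 1 / 2 → X x = y

theorem Per.deriv {q : ℝ → ℝ} (h : Per q) : Per (deriv q) := by
  refine ⟨h.1.deriv_top, fun x => ?_⟩
  have h2 : (fun y => q (y + 2 * π)) = q := funext h.2
  rw [← deriv_comp_add_const, h2]

theorem Per.mul {q r : ℝ → ℝ} (h : Per q) (h' : Per r) : Per fun s => q s * r s :=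
  ⟨h.1.mul h'.1, h.2.mul h'.2⟩

theorem Per.bdd {q : ℝ → ℝ} (h : Per q) : ∃ N : ℕ, ∀ s, |q s| ≤ 2 ^ N := by
  obtain ⟨B, hB⟩ := (h.2.isBounded_of_continuous two_pi_pos.ne' h.1.continuous).exists_norm_le
  obtain ⟨N, hN⟩ := exists_le_two_pow B
  exact ⟨N, fun s => (hB _ (mem_range_self s)).trans hN⟩

theorem Cut.deriv_eq {X : ℝ → ℝ} {U : Set ℝ} (hU : IsOpen U) {y : ℝ} (h : ∀ x ∈ U, X x = y) :
    ∀ x ∈ U, deriv X x = 0 := by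
  intro x hx
  have : X =ᶠ[𝓝 x] fun _ => y := by
    filter_upwards [hU.mem_nhds hx] with z hz using h z hz
  rw [this.deriv_eq]; simp

theorem isOpen_abs_lt (r : ℝ) : IsOpen {x : ℝ | |x| < r} :=
  isOpen_lt continuous_abs continuous_const

theorem isOpen_lt_abs (r : ℝ) : IsOpen {x : ℝ | r < |x|} :=
  isOpen_lt continuous_const continuous_abs

theorem Cut.deriv {X : ℝ → ℝ} (h : Cut X) : Cut (deriv X) := by
  obtain ⟨h1, h2, y, h3⟩ := h
  exact ⟨h1.deriv_top, Cut.deriv_eq (isOpen_lt_abs 1) h2, 0, Cut.deriv_eq (isOpen_abs_lt _) h3⟩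

theorem Cut.deriv_core {X : ℝ → ℝ} (h : Cut X) : ∀ x, |x| < 1 / 2 → _root_.deriv X x = 0 := by
  obtain ⟨h1, h2, y, h3⟩ := h
  exact Cut.deriv_eq (isOpen_abs_lt _) h3

theorem Cut.mul {X Y : ℝ → ℝ} (h : Cut X) (h' : Cut Y) : Cut fun x => X x * Y x := by
  obtain ⟨h1, h2, y, h3⟩ := h
  obtain ⟨h1', -, y', h3'⟩ := h'
  exact ⟨h1.mul h1', fun x hx => by simp [h2 x hx], y * y', fun x hx => by simp [h3 x hx, h3' x hx]⟩

theorem Cut.bdd {X : ℝ → ℝ} (h : Cut X) : ∃ N : ℕ, ∀ s, |X s| ≤ 2 ^ N := by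
  have hc : HasCompactSupport X := HasCompactSupport.intro (isCompact_closedBall (0 : ℝ) 1)
    fun x hx => h.2.1 x (by simpa using hx)
  obtain ⟨B, hB⟩ := hc.exists_bound_of_continuous h.1.continuous
  obtain ⟨N, hN⟩ := exists_le_two_pow B
  exact ⟨N, fun s => (hB s).trans hN⟩

/-- Mean over a period. -/
noncomputable def mean (q : ℝ → ℝ) : ℝ := (2 * π)⁻¹ * ∫ s in (0)..(2 * π), q s

/-- Primitive of the mean-free part. -/
noncomputable def ai (q : ℝ → ℝ) : ℝ → ℝ := fun s => ∫ u in (0)..s, (q u - mean q)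

theorem hasDerivAt_ai {q : ℝ → ℝ} (h : Continuous q) (s : ℝ) :
    HasDerivAt (ai q) (q s - mean q) s := by
  have hc : Continuous fun u => q u - mean q := h.sub continuous_const
  exact intervalIntegral.integral_hasDerivAt_right (hc.intervalIntegrable _ _)
    hc.stronglyMeasurable.stronglyMeasurableAtFilter hc.continuousAt

theorem Per.primitive {q : ℝ → ℝ} (h : Per q) : Per (ai q) := by
  have hd : _root_.deriv (ai q) = fun s => q s - mean q :=
    funext fun s => (hasDerivAt_ai h.1.continuous s).deriv
  constructor
  · rw [contDiff_infty_iff_deriv]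
    refine ⟨fun s => (hasDerivAt_ai h.1.continuous s).differentiableAt, ?_⟩
    rw [hd]; exact h.1.sub contDiff_const
  · intro s
    have hp : Function.Periodic (fun u => q u - mean q) (2 * π) := fun u => by
      simp only [h.2 u]
    have hc : Continuous fun u => q u - mean q := h.1.continuous.sub continuous_const
    have h1 : ∫ u in s..(s + 2 * π), (q u - mean q) = 0 := by
      rw [hp.intervalIntegral_add_eq s 0, zero_add,
        intervalIntegral.integral_sub (h.1.continuous.intervalIntegrable _ _) (by simp)]
      simp only [mean, intervalIntegral.integral_const, smul_eq_mul]
      field_simp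
      ring
    simp only [ai]
    rw [← intervalIntegral.integral_add_adjacent_intervals (hc.intervalIntegrable 0 s)
      (hc.intervalIntegrable s (s + 2 * π)), h1, add_zero]

theorem deriv_deriv_ai_ai {q : ℝ → ℝ} (h : Per q) :
    deriv (deriv (ai (ai q))) = fun s => q s - mean q := by
  have h1 : deriv (ai (ai q)) = fun s => ai q s - mean (ai q) :=
    funext fun s => (hasDerivAt_ai h.primitive.1.continuous s).deriv
  rw [h1]
  funext s
  rw [deriv_sub_const]
  exact (hasDerivAt_ai h.1.continuous s).deriv

/-- A product symbol. -/
structure Gen where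
  /-- time coefficient -/
  b : Dat → ℝ → ℝ
  /-- phase profile -/
  q : ℝ → ℝ
  /-- first cutoff -/
  X : ℝ → ℝ
  /-- second cutoff -/
  Y : ℝ → ℝ

/-- A symbol is a finite sum of product symbols. -/
abbrev Symb := Multiset Gen

/-- Value of a product symbol. -/
def Gen.val (g : Gen) (d : Dat) (t s z w : ℝ) : ℝ := g.b d t * g.q s * g.X z * g.Y w

/-- Value of a symbol. -/
def val (d : Dat) (t s z w : ℝ) (L : Symb) : ℝ := (L.map fun g => g.val d t s z w).sum

/-- Symbols with coefficients in a given class. -/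
def Good (C : (Dat → ℝ → ℝ) → Prop) (L : Symb) : Prop :=
  ∀ g ∈ L, C g.b ∧ Per g.q ∧ Cut g.X ∧ Cut g.Y

/-- Symbols which vanish on the core. -/
def Van (L : Symb) : Prop :=
  ∀ g ∈ L, (∀ x, |x| < 1 / 2 → g.X x = 0) ∨ ∀ x, |x| < 1 / 2 → g.Y x = 0

/-- Symbols which do not depend on the phase. -/
def Slow (L : Symb) : Prop := ∀ g ∈ L, ∀ s, g.q s = g.q 0

section ops
/-- Phase derivative. -/
noncomputable def ds (L : Symb) : Symb := L.map fun g => { g with q := deriv g.q }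
/-- First slow derivative. -/
noncomputable def d1 (L : Symb) : Symb := L.map fun g => { g with X := deriv g.X }
/-- Second slow derivative. -/
noncomputable def d2 (L : Symb) : Symb := L.map fun g => { g with Y := deriv g.Y }
/-- Time derivative. -/
noncomputable def dt (L : Symb) : Symb := L.map fun g => { g with b := fun d => deriv (g.b d) }
/-- Multiplication by a coefficient. -/
def sm (c : Dat → ℝ → ℝ) (L : Symb) : Symb := L.map fun g => { g with b := fun d t => c d t * g.b d t }
/-- Multiplication by a power of `δ`. -/
noncomputable def sc (J : ℕ) (L : Symb) : Symb := sm (fun d _ => d.δ ^ J) L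
/-- Product of product symbols. -/
def Gen.mul (g h : Gen) : Gen := ⟨fun d t => g.b d t * h.b d t, fun s => g.q s * h.q s,
  fun z => g.X z * h.X z, fun w => g.Y w * h.Y w⟩
/-- Product of symbols. -/
def pr (A B : Symb) : Symb := A.bind fun g => B.map fun h => g.mul h
/-- Phase average. -/
noncomputable def mn (L : Symb) : Symb := L.map fun g => { g with q := fun _ => mean g.q }
/-- Inverse of `-dt ∘ (|η|² ds ds)` on mean-free symbols. -/
noncomputable def corr (L : Symb) : Symb := L.map fun g =>
  { g with b := fun d t => (d.N2 t)⁻¹ * ∫ u in t..1, g.b d u, q := ai (ai g.q) }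
end ops

variable {A B L M : Symb} {c : Dat → ℝ → ℝ}

@[simp] theorem ds_add : ds (A + B) = ds A + ds B := Multiset.map_add _ _ _
@[simp] theorem d1_add : d1 (A + B) = d1 A + d1 B := Multiset.map_add _ _ _
@[simp] theorem d2_add : d2 (A + B) = d2 A + d2 B := Multiset.map_add _ _ _
@[simp] theorem dt_add : dt (A + B) = dt A + dt B := Multiset.map_add _ _ _
@[simp] theorem sm_add : sm c (A + B) = sm c A + sm c B := Multiset.map_add _ _ _
@[simp] theorem sc_add {J : ℕ} : sc J (A + B) = sc J A + sc J B := Multiset.map_add _ _ _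

@[simp] theorem pr_add : pr L (A + B) = pr L A + pr L B := by simp [pr]
@[simp] theorem add_pr : pr (A + B) L = pr A L + pr B L := by simp [pr]

theorem ds_sm : ds (sm c L) = sm c (ds L) := by simp [ds, sm]
theorem d1_sm : d1 (sm c L) = sm c (d1 L) := by simp [d1, sm]
theorem d2_sm : d2 (sm c L) = sm c (d2 L) := by simp [d2, sm]
@[simp] theorem ds_sc {J : ℕ} : ds (sc J L) = sc J (ds L) := ds_sm
@[simp] theorem d1_sc {J : ℕ} : d1 (sc J L) = sc J (d1 L) := d1_sm
@[simp] theorem d2_sc {J : ℕ} : d2 (sc J L) = sc J (d2 L) := d2_sm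
@[simp] theorem sm_sc {J : ℕ} : sm c (sc J L) = sc J (sm c L) := by
  simp [sm, sc, mul_left_comm]
@[simp] theorem dt_sc {J : ℕ} : dt (sc J L) = sc J (dt L) := by
  simp [dt, sm, sc]
theorem sc_sc {J K : ℕ} : sc J (sc K L) = sc (J + K) L := by
  simp [sc, sm, pow_add, mul_assoc]
@[simp] theorem sc_pr {J : ℕ} : pr (sc J A) B = sc J (pr A B) := by
  simp [pr, sm, sc, Multiset.bind_map, Multiset.map_bind, Gen.mul, mul_assoc]
@[simp] theorem pr_sc {J : ℕ} : pr A (sc J B) = sc J (pr A B) := by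
  simp [pr, sm, sc, Multiset.map_bind, Gen.mul, mul_left_comm]

variable {d : Dat} {t s z w : ℝ}

@[simp] theorem val_zero : val d t s z w 0 = 0 := by simp [val]

@[simp] theorem val_cons {g : Gen} : val d t s z w (g ::ₘ L) = g.val d t s z w + val d t s z w L := by
  simp [val]

@[simp] theorem val_add : val d t s z w (A + B) = val d t s z w A + val d t s z w B := by
  simp [val]

@[simp] theorem val_sm : val d t s z w (sm c L) = c d t * val d t s z w L := by
  simp only [val, sm, Multiset.map_map, ← Multiset.sum_map_mul_left]
  congr 1
  refine Multiset.map_congr rfl fun g _ => ?_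
  simp [Gen.val]; ring

@[simp] theorem val_sc {J : ℕ} : val d t s z w (sc J L) = d.δ ^ J * val d t s z w L := val_sm

theorem Gen.val_mul {g h : Gen} : (g.mul h).val d t s z w = g.val d t s z w * h.val d t s z w := by
  simp only [Gen.val, Gen.mul]; ring

@[simp] theorem val_pr : val d t s z w (pr A B) = val d t s z w A * val d t s z w B := by
  induction A using Multiset.induction_on with
  | empty => simp [pr]
  | cons g A ih =>
    have : pr (g ::ₘ A) B = (B.map fun h => g.mul h) + pr A B := by simp [pr]
    rw [this, val_add, ih, val_cons, add_mul]
    congr 1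
    simp [val, Gen.val_mul, Multiset.sum_map_mul_left]

/-! Closure properties -/

theorem Good.add {C} (hA : Good C A) (hB : Good C B) : Good C (A + B) := fun g hg =>
  (Multiset.mem_add.1 hg).elim (hA g) (hB g)

theorem Good.mono (h : Good TB1 L) : Good TB0 L := fun g hg => ⟨(h g hg).1.1, (h g hg).2⟩

theorem Good.ds {C} (h : Good C L) : Good C (ds L) := by
  intro g hg
  obtain ⟨g, hm, rfl⟩ := Multiset.mem_map.1 hg
  obtain ⟨h1, h2, h3, h4⟩ := h g hm
  exact ⟨h1, h2.deriv, h3, h4⟩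

theorem Good.d1 {C} (h : Good C L) : Good C (d1 L) := by
  intro g hg
  obtain ⟨g, hm, rfl⟩ := Multiset.mem_map.1 hg
  obtain ⟨h1, h2, h3, h4⟩ := h g hm
  exact ⟨h1, h2, h3.deriv, h4⟩

theorem Good.d2 {C} (h : Good C L) : Good C (d2 L) := by
  intro g hg
  obtain ⟨g, hm, rfl⟩ := Multiset.mem_map.1 hg
  obtain ⟨h1, h2, h3, h4⟩ := h g hm
  exact ⟨h1, h2, h3, h4.deriv⟩

theorem Good.dt (h : Good TB1 L) : Good TB0 (dt L) := by
  intro g hg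
  obtain ⟨g, hm, rfl⟩ := Multiset.mem_map.1 hg
  obtain ⟨h1, h2, h3, h4⟩ := h g hm
  exact ⟨h1.2, h2, h3, h4⟩

theorem Good.sm0 (hc : TB0 c) (h : Good TB0 L) : Good TB0 (sm c L) := by
  intro g hg
  obtain ⟨g, hm, rfl⟩ := Multiset.mem_map.1 hg
  obtain ⟨h1, h2, h3, h4⟩ := h g hm
  exact ⟨hc.mul h1, h2, h3, h4⟩

theorem Good.sm1 (hc : TB1 c) (h : Good TB1 L) : Good TB1 (sm c L) := by
  intro g hg
  obtain ⟨g, hm, rfl⟩ := Multiset.mem_map.1 hg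
  obtain ⟨h1, h2, h3, h4⟩ := h g hm
  exact ⟨hc.mul h1, h2, h3, h4⟩

theorem Good.sc0 {J : ℕ} (h : Good TB0 L) : Good TB0 (sc J L) := h.sm0 (TB1.δpow J).1

theorem Good.sc1 {J : ℕ} (h : Good TB1 L) : Good TB1 (sc J L) := h.sm1 (TB1.δpow J)

theorem Good.pr (hA : Good TB0 A) (hB : Good TB0 B) : Good TB0 (pr A B) := by
  intro g hg
  obtain ⟨a, ha, hg⟩ := Multiset.mem_bind.1 hg
  obtain ⟨b, hb, rfl⟩ := Multiset.mem_map.1 hg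
  obtain ⟨h1, h2, h3, h4⟩ := hA a ha
  obtain ⟨h1', h2', h3', h4'⟩ := hB b hb
  exact ⟨h1.mul h1', h2.mul h2', h3.mul h3', h4.mul h4'⟩

theorem Good.mn {C} (h : Good C L) : Good C (mn L) := by
  intro g hg
  obtain ⟨g, hm, rfl⟩ := Multiset.mem_map.1 hg
  obtain ⟨h1, h2, h3, h4⟩ := h g hm
  exact ⟨h1, ⟨contDiff_const, fun _ => rfl⟩, h3, h4⟩

theorem Good.corr (h : Good TB0 L) : Good TB1 (corr L) := by
  intro g hg
  obtain ⟨g, hm, rfl⟩ := Multiset.mem_map.1 hg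
  obtain ⟨h1, h2, h3, h4⟩ := h g hm
  exact ⟨TB1.N2inv.mul (TB1.tint h1), h2.primitive.primitive, h3, h4⟩

theorem Van.add (hA : Van A) (hB : Van B) : Van (A + B) := fun g hg =>
  (Multiset.mem_add.1 hg).elim (hA g) (hB g)

theorem van_d1 {C} (h : Good C L) : Van (d1 L) := by
  intro g hg
  obtain ⟨g, hm, rfl⟩ := Multiset.mem_map.1 hg
  exact Or.inl (h g hm).2.2.1.deriv_core

theorem van_d2 {C} (h : Good C L) : Van (d2 L) := by
  intro g hg
  obtain ⟨g, hm, rfl⟩ := Multiset.mem_map.1 hg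
  exact Or.inr (h g hm).2.2.2.deriv_core

theorem Van.map {f : Gen → Gen} (hX : ∀ g, (f g).X = g.X) (hY : ∀ g, (f g).Y = g.Y)
    (h : Van L) : Van (L.map f) := by
  intro g hg
  obtain ⟨g, hm, rfl⟩ := Multiset.mem_map.1 hg
  rw [hX, hY]; exact h g hm

theorem Van.ds (h : Van L) : Van (ds L) := h.map (fun _ => rfl) fun _ => rfl
theorem Van.dt (h : Van L) : Van (dt L) := h.map (fun _ => rfl) fun _ => rfl
theorem Van.sm (h : Van L) : Van (sm c L) := h.map (fun _ => rfl) fun _ => rfl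
theorem Van.sc {J : ℕ} (h : Van L) : Van (sc J L) := h.map (fun _ => rfl) fun _ => rfl
theorem Van.corr (h : Van L) : Van (corr L) := h.map (fun _ => rfl) fun _ => rfl

theorem Van.pr_left (h : Van A) : Van (pr A B) := by
  intro g hg
  obtain ⟨a, ha, hg⟩ := Multiset.mem_bind.1 hg
  obtain ⟨b, hb, rfl⟩ := Multiset.mem_map.1 hg
  rcases h a ha with h | h
  · exact Or.inl fun x hx => by simp [Gen.mul, h x hx]
  · exact Or.inr fun x hx => by simp [Gen.mul, h x hx]

theorem Van.pr_right (h : Van B) : Van (pr A B) := by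
  intro g hg
  obtain ⟨a, ha, hg⟩ := Multiset.mem_bind.1 hg
  obtain ⟨b, hb, rfl⟩ := Multiset.mem_map.1 hg
  rcases h b hb with h | h
  · exact Or.inl fun x hx => by simp [Gen.mul, h x hx]
  · exact Or.inr fun x hx => by simp [Gen.mul, h x hx]

theorem Slow.add (hA : Slow A) (hB : Slow B) : Slow (A + B) := fun g hg =>
  (Multiset.mem_add.1 hg).elim (hA g) (hB g)

theorem slow_mn : Slow (mn L) := by
  intro g hg
  obtain ⟨g, hm, rfl⟩ := Multiset.mem_map.1 hg
  simp

theorem Slow.map {f : Gen → Gen} (hq : ∀ g, (f g).q = g.q) (h : Slow L) : Slow (L.map f) := by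
  intro g hg
  obtain ⟨g, hm, rfl⟩ := Multiset.mem_map.1 hg
  rw [hq]; exact h g hm

theorem val_ds_slow (h : Slow L) : val d t s z w (ds L) = 0 := by
  induction L using Multiset.induction_on with
  | empty => simp [ds]
  | cons g L ih =>
    have e : ds (g ::ₘ L) = { g with q := deriv g.q } ::ₘ ds L := by simp [ds]
    rw [e, val_cons, ih fun g hg => h g (Multiset.mem_cons_of_mem hg)]
    have : g.q = fun _ => g.q 0 := funext (h g (Multiset.mem_cons_self _ _))
    simp only [Gen.val]
    rw [this]; simp

theorem val_core (h : Van L) (hz : |z| < 1 / 2) (hw : |w| < 1 / 2) : val d t s z w L = 0 := by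
  induction L using Multiset.induction_on with
  | empty => simp
  | cons g L ih =>
    rw [val_cons, ih fun g hg => h g (Multiset.mem_cons_of_mem hg)]
    rcases h g (Multiset.mem_cons_self _ _) with h | h
    · simp [Gen.val, h z hz]
    · simp [Gen.val, h w hw]

theorem val_outside {C} (h : Good C L) (hz : 1 < |z| ∨ 1 < |w|) : val d t s z w L = 0 := by
  induction L using Multiset.induction_on with
  | empty => simp
  | cons g L ih =>
    rw [val_cons, ih fun g hg => h g (Multiset.mem_cons_of_mem hg)]
    obtain ⟨-, -, hX, hY⟩ := h g (Multiset.mem_cons_self _ _)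
    rcases hz with hz | hz
    · simp [Gen.val, hX.2.1 z hz]
    · simp [Gen.val, hY.2.1 w hz]

theorem Good.bound (h : Good TB0 L) : ∃ N : ℕ, ∀ d : Dat, ∀ t ∈ Icc d.t0 1, ∀ s z w,
    |val d t s z w L| ≤ d.D ^ N := by
  induction L using Multiset.induction_on with
  | empty => exact ⟨0, by simp⟩
  | cons g L ih =>
    obtain ⟨N, hN⟩ := ih fun g hg => h g (Multiset.mem_cons_of_mem hg)
    obtain ⟨⟨⟨N1, h1⟩, -⟩, hq, hX, hY⟩ := h g (Multiset.mem_cons_self _ _)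
    obtain ⟨N2, h2⟩ := hq.bdd
    obtain ⟨N3, h3⟩ := hX.bdd
    obtain ⟨N4, h4⟩ := hY.bdd
    refine ⟨(N1 + N2 + N3 + N4) + N + 1, fun d t ht s z w => ?_⟩
    rw [val_cons]
    refine (abs_add_le _ _).trans (le_trans (add_le_add ?_ (hN d t ht s z w))
      (two_pow_add_le d.two_le _ _))
    have hp : ∀ n : ℕ, (2 : ℝ) ^ n ≤ d.D ^ n := fun n => pow_le_pow_left₀ (by norm_num) d.two_le n
    have hD := d.D_pos
    simp only [Gen.val, abs_mul, pow_add]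
    gcongr
    · exact h1 d t ht
    · exact (h2 s).trans (hp _)
    · exact (h3 z).trans (hp _)
    · exact (h4 w).trans (hp _)

/-! ### The approximate solution scheme -/

namespace Dat
/-- Inner product of the frame vectors. -/
def HZ (d : Dat) (t : ℝ) : ℝ := d.η1 t * d.ζ1 t + d.η2 t * d.ζ2 t
/-- Squared length of `ζ`. -/
def Z2 (d : Dat) (t : ℝ) : ℝ := d.ζ1 t * d.ζ1 t + d.ζ2 t * d.ζ2 t
end Dat

theorem TB1.HZ : TB1 fun d t => d.HZ t := (TB1.η1.mul TB1.ζ1).add (TB1.η2.mul TB1.ζ2)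
theorem TB1.Z2 : TB1 fun d t => d.Z2 t := (TB1.ζ1.mul TB1.ζ1).add (TB1.ζ2.mul TB1.ζ2)

theorem sc_comm {J K : ℕ} {L : Symb} : sc J (sc K L) = sc K (sc J L) := by
  rw [sc_sc, sc_sc, add_comm]

section ops
/-- Lower order part of the Laplacian. -/
noncomputable def Lam (v : Symb) : Symb :=
  sm (fun d t => 2 * d.N2 t) (ds (d1 v)) + sm (fun d t => 2 * d.HZ t) (ds (d2 v)) +
    sc 1 (sm (fun d t => d.N2 t) (d1 (d1 v)) + sm (fun d t => 2 * d.HZ t) (d1 (d2 v)) +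
      sm (fun d t => d.Z2 t) (d2 (d2 v)))
/-- Laplacian. -/
noncomputable def Lap (v : Symb) : Symb := sm (fun d t => d.N2 t) (ds (ds v)) + sc 1 (Lam v)
/-- Slow part of the first partial derivative. -/
noncomputable def chi (v : Symb) : Symb :=
  sm (fun d t => d.η1 t) (d1 v) + sm (fun d t => d.ζ1 t) (d2 v)
/-- First partial derivative. -/
noncomputable def px (v : Symb) : Symb := sm (fun d t => d.η1 t) (ds v) + sc 1 (chi v)
/-- Slow part of the second partial derivative. -/
noncomputable def chi' (v : Symb) : Symb :=
  sm (fun d t => d.η2 t) (d1 v) + sm (fun d t => d.ζ2 t) (d2 v)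
/-- Second partial derivative. -/
noncomputable def py (v : Symb) : Symb := sm (fun d t => d.η2 t) (ds v) + sc 1 (chi' v)
/-- Bracket. -/
noncomputable def bet (f g : Symb) : Symb :=
  pr (ds f + sc 1 (d1 f)) (d2 g) + sm (fun _ _ => -1) (pr (d2 f) (ds g + sc 1 (d1 g)))
/-- Lower order part of the stratification term. -/
noncomputable def Xi (v : Symb) : Symb :=
  sm (fun d _ => d.γ) (ds (chi v)) + sm (fun d t => d.γ * d.η1 t) (d1 (ds v)) +
    sm (fun d t => -d.α * d.η1 t) (d2 (ds v)) +
    sc 1 (sm (fun d _ => d.γ) (d1 (chi v)) + sm (fun d _ => -d.α) (d2 (chi v)))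
/-- Leading part of the residual. -/
noncomputable def Lead (v : Symb) : Symb := dt (sm (fun d t => d.N2 t) (ds (ds v)))
/-- Linear lower order part of the residual. -/
noncomputable def Tlin (v : Symb) : Symb :=
  dt (Lam v) + sm (fun d t => d.r t) (Lam v) + sm (fun _ _ => -1) (Xi v)
/-- Lower order part of the residual. -/
noncomputable def Tres (v : Symb) : Symb := Tlin v + sm (fun d t => d.a t) (bet (px v) (Lap v))
/-- Lower order residual created by a correction. -/
noncomputable def Tcor (J : ℕ) (v c : Symb) : Symb :=
  Tlin c + sm (fun d t => d.a t)
    (bet (px v) (Lap c) + bet (px c) (Lap v) + sc J (bet (px c) (Lap c)))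
end ops

section additivity
variable {A B : Symb} {J : ℕ}

theorem Lam_add : Lam (A + B) = Lam A + Lam B := by simp [Lam]; abel
theorem Lam_sc : Lam (sc J A) = sc J (Lam A) := by simp [Lam, sc_comm (J := 1)]
theorem Lap_add : Lap (A + B) = Lap A + Lap B := by simp [Lap, Lam_add]; abel
theorem Lap_sc : Lap (sc J A) = sc J (Lap A) := by simp [Lap, Lam_sc, sc_comm (J := 1)]
theorem chi_add : chi (A + B) = chi A + chi B := by simp [chi]; abel
theorem chi_sc : chi (sc J A) = sc J (chi A) := by simp [chi]
theorem px_add : px (A + B) = px A + px B := by simp [px, chi_add]; abel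
theorem px_sc : px (sc J A) = sc J (px A) := by simp [px, chi_sc, sc_comm (J := 1)]
theorem Xi_add : Xi (A + B) = Xi A + Xi B := by simp [Xi, chi_add]; abel
theorem Xi_sc : Xi (sc J A) = sc J (Xi A) := by simp [Xi, chi_sc, sc_comm (J := 1)]
theorem Tlin_add : Tlin (A + B) = Tlin A + Tlin B := by simp [Tlin, Lam_add, Xi_add]; abel
theorem Tlin_sc : Tlin (sc J A) = sc J (Tlin A) := by simp [Tlin, Lam_sc, Xi_sc]
theorem Lead_add : Lead (A + B) = Lead A + Lead B := by simp [Lead]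
theorem Lead_sc : Lead (sc J A) = sc J (Lead A) := by simp [Lead]
theorem bet_add {f : Symb} : bet f (A + B) = bet f A + bet f B := by simp [bet]; abel
theorem add_bet {g : Symb} : bet (A + B) g = bet A g + bet B g := by simp [bet]; abel
theorem bet_sc {f : Symb} : bet f (sc J A) = sc J (bet f A) := by
  simp [bet, sc_comm (J := 1)]
theorem sc_bet {f : Symb} : bet (sc J A) f = sc J (bet A f) := by
  simp [bet, sc_comm (J := 1)]

theorem Tres_add {v c : Symb} : Tres (v + sc J c) = Tres v + sc J (Tcor J v c) := by
  simp only [Tres, Tcor, Tlin_add, Tlin_sc, px_add, px_sc, Lap_add, Lap_sc, bet_add, add_bet,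
    bet_sc, sc_bet, sm_add, sc_add, sm_sc]
  abel

end additivity

section closure
variable {v c f g : Symb} {J : ℕ}

theorem TB1.const_mul {b : Dat → ℝ → ℝ} (x : ℝ) (h : TB1 b) : TB1 fun d t => x * b d t :=
  (TB1.const x).mul h

theorem Good.lam (h : Good TB1 v) : Good TB1 (Lam v) :=
  ((h.d1.ds.sm1 (TB1.N2.const_mul 2)).add (h.d2.ds.sm1 (TB1.HZ.const_mul 2))).add
    (((h.d1.d1.sm1 TB1.N2).add (h.d2.d1.sm1 (TB1.HZ.const_mul 2))).add (h.d2.d2.sm1 TB1.Z2)).sc1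

theorem Good.lap (h : Good TB1 v) : Good TB1 (Lap v) := (h.ds.ds.sm1 TB1.N2).add h.lam.sc1

theorem Good.chi0 (h : Good TB0 v) : Good TB0 (chi v) :=
  (h.d1.sm0 TB1.η1.1).add (h.d2.sm0 TB1.ζ1.1)

theorem Good.px0 (h : Good TB0 v) : Good TB0 (px v) := (h.ds.sm0 TB1.η1.1).add h.chi0.sc0

theorem Good.py0 (h : Good TB0 v) : Good TB0 (py v) :=
  (h.ds.sm0 TB1.η2.1).add ((h.d1.sm0 TB1.η2.1).add (h.d2.sm0 TB1.ζ2.1)).sc0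

theorem Good.bet (hf : Good TB0 f) (hg : Good TB0 g) : Good TB0 (bet f g) :=
  ((hf.ds.add hf.d1.sc0).pr hg.d2).add ((hf.d2.pr (hg.ds.add hg.d1.sc0)).sm0 (TB0.const (-1)))

theorem Good.xi (h : Good TB0 v) : Good TB0 (Xi v) :=
  (((h.chi0.ds.sm0 TB0.γ).add (h.ds.d1.sm0 (TB0.γ.mul TB1.η1.1))).add
    (h.ds.d2.sm0 (TB0.α.neg.mul TB1.η1.1))).add
    ((h.chi0.d1.sm0 TB0.γ).add (h.chi0.d2.sm0 TB0.α.neg)).sc0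

theorem Good.tlin (h : Good TB1 v) : Good TB0 (Tlin v) :=
  (h.lam.dt.add (h.lam.mono.sm0 TB0.r)).add (h.mono.xi.sm0 (TB0.const (-1)))

theorem Good.tres (h : Good TB1 v) : Good TB0 (Tres v) :=
  h.tlin.add ((h.mono.px0.bet h.lap.mono).sm0 TB0.a)

theorem Good.tcor (h : Good TB1 v) (h' : Good TB1 c) : Good TB0 (Tcor J v c) :=
  h'.tlin.add ((((h.mono.px0.bet h'.lap.mono).add (h'.mono.px0.bet h.lap.mono)).add
    (h'.mono.px0.bet h'.lap.mono).sc0).sm0 TB0.a)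

theorem van_bet (hf : Good TB0 f) (hg : Good TB0 g) : Van (bet f g) :=
  (van_d2 hg).pr_right.add ((van_d2 hf).pr_left).sm

theorem van_lam (h : Good TB1 v) : Van (Lam v) :=
  ((van_d1 h).ds.sm.add (van_d2 h).ds.sm).add
    (((van_d1 h.d1).sm.add (van_d1 h.d2).sm).add (van_d2 h.d2).sm).sc

theorem van_chi (h : Good TB0 v) : Van (chi v) := (van_d1 h).sm.add (van_d2 h).sm

theorem van_xi (h : Good TB0 v) : Van (Xi v) :=
  (((van_chi h).ds.sm.add (van_d1 h.ds).sm).add (van_d2 h.ds).sm).add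
    ((van_d1 h.chi0).sm.add (van_d2 h.chi0).sm).sc

theorem van_tlin (h : Good TB1 v) : Van (Tlin v) :=
  ((van_lam h).dt.add (van_lam h).sm).add (van_xi h.mono).sm

theorem van_tres (h : Good TB1 v) : Van (Tres v) :=
  (van_tlin h).add (van_bet h.mono.px0 h.lap.mono).sm

theorem van_tcor (h : Good TB1 v) (h' : Good TB1 c) : Van (Tcor J v c) :=
  (van_tlin h').add (((van_bet h.mono.px0 h'.lap.mono).add (van_bet h'.mono.px0 h.lap.mono)).add
    (van_bet h'.mono.px0 h'.lap.mono).sc).sm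

end closure

/-- Value of the residual. -/
noncomputable def resid (d : Dat) (t s z w : ℝ) (v : Symb) : ℝ :=
  val d t s z w (Lead v) + d.δ * val d t s z w (Tres v)

theorem val_lead_corr {S : Symb} (hS : Good TB0 S) (d : Dat) (t s z w : ℝ) :
    val d t s z w (Lead (corr S)) = -val d t s z w S + val d t s z w (mn S) := by
  induction S using Multiset.induction_on with
  | empty => simp [Lead, corr, mn, dt, sm, ds]
  | cons g S ih =>
    have ih := ih fun g hg => hS g (Multiset.mem_cons_of_mem hg)
    obtain ⟨hb, hq, -, -⟩ := hS g (Multiset.mem_cons_self _ _)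
    have e : Lead (corr (g ::ₘ S)) =
        { b := fun d => deriv fun t => d.N2 t * ((d.N2 t)⁻¹ * ∫ u in t..1, g.b d u)
          q := deriv (deriv (ai (ai g.q))), X := g.X, Y := g.Y } ::ₘ Lead (corr S) := by
      simp [Lead, corr, dt, sm, ds]
    have e2 : mn (g ::ₘ S) = { g with q := fun _ => mean g.q } ::ₘ mn S := by simp [mn]
    rw [e, e2, val_cons, val_cons, val_cons, ih]
    have hd : (deriv fun t => d.N2 t * ((d.N2 t)⁻¹ * ∫ u in t..1, g.b d u)) t = -g.b d t := by
      rw [← (hasDerivAt_tint (hb.2 d).continuous t).deriv]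
      congr 1
      funext t
      rw [mul_inv_cancel_left₀ (d.N2_pos t).ne']
    simp only [Gen.val, hd, deriv_deriv_ai_ai hq]
    ring

/-- The leading profile. -/
noncomputable def lead0 (h X Y : ℝ → ℝ) : Symb :=
  {{ b := fun d t => -1 * (d.N2 t)⁻¹, q := h, X := X, Y := Y }}

theorem good_lead0 {h X Y : ℝ → ℝ} (hh : Per h) (hX : Cut X) (hY : Cut Y) :
    Good TB1 (lead0 h X Y) := by
  intro g hg
  rw [lead0, Multiset.mem_singleton] at hg
  subst hg
  exact ⟨TB1.N2inv.const_mul (-1), hh, hX, hY⟩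

/-- Approximate solutions to arbitrary order, up to a phase independent error. -/
theorem exists_approx_symb {h X Y : ℝ → ℝ} (hh : Per h) (hX : Cut X) (hY : Cut Y) (J : ℕ) :
    ∃ V m S : Symb, Good TB1 V ∧ Van V ∧ Good TB0 m ∧ Slow m ∧ Good TB0 S ∧ Van S ∧
      ∀ d t s z w, resid d t s z w (lead0 h X Y + V) =
        val d t s z w m + d.δ ^ (J + 1) * val d t s z w S := by
  have h0 := good_lead0 hh hX hY
  induction J with
  | zero =>
    refine ⟨0, 0, Tres (lead0 h X Y), fun _ h => by simp at h, fun _ h => by simp at h,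
      fun _ h => by simp at h, fun _ h => by simp at h, h0.tres, van_tres h0, ?_⟩
    intro d t s z w
    have e : val d t s z w (Lead (lead0 h X Y)) = 0 := by
      have : ∀ d : Dat, (fun t => d.N2 t * (-1 * (d.N2 t)⁻¹)) = fun _ => -1 := fun d => by
        funext t
        field_simp [(d.N2_pos t).ne']
      simp only [Lead, lead0, sm, ds, dt, val, Multiset.map_singleton, Multiset.sum_singleton,
        Gen.val, this]
      simp
    simp [resid, e]
  | succ J ih =>
    obtain ⟨V, m, S, hV, hV', hm, hm', hS, hS', H⟩ := ih
    have hc := hS.corr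
    refine ⟨V + sc (J + 1) (corr S), m + sc (J + 1) (mn S),
      Tcor (J + 1) (lead0 h X Y + V) (corr S), hV.add hc.sc1, hV'.add hS'.corr.sc,
      hm.add hS.mn.sc0, hm'.add ?_, (h0.add hV).tcor hc, van_tcor (h0.add hV) hc, ?_⟩
    · exact slow_mn.map fun _ => rfl
    · intro d t s z w
      have := H d t s z w
      simp only [resid] at this ⊢
      rw [← add_assoc, Tres_add, Lead_add, Lead_sc]
      simp only [val_add, val_sc, val_lead_corr hS] at this ⊢
      linear_combination this

/-! ### Evaluation of symbols on space-time -/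

theorem dd_eq_of_hasDerivAt {φ : (ℝ × ℝ) × ℝ → ℝ} {v p : (ℝ × ℝ) × ℝ} {c : ℝ}
    (hφ : DifferentiableAt ℝ φ p) (h : HasDerivAt (fun ε : ℝ => φ (p + ε • v)) c 0) :
    dd v φ p = c := by
  have h1 : HasDerivAt (fun ε : ℝ => p + ε • v) v 0 := by
    simpa using ((hasDerivAt_id (0 : ℝ)).smul_const v).const_add p
  have h2 : HasFDerivAt φ (fderiv ℝ φ p) (p + (0 : ℝ) • v) := by simpa using hφ.hasFDerivAt
  exact (h2.comp_hasDerivAt 0 h1).unique h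

/-- Coefficient functions are smooth in time. -/
theorem hasDerivAt_val {L : Symb} (hL : Good TB0 L) (d : Dat) {T s z w : ℝ → ℝ}
    {T' s' z' w' ε : ℝ} (hT : HasDerivAt T T' ε) (hs : HasDerivAt s s' ε)
    (hz : HasDerivAt z z' ε) (hw : HasDerivAt w w' ε) :
    HasDerivAt (fun ε => val d (T ε) (s ε) (z ε) (w ε) L)
      (T' * val d (T ε) (s ε) (z ε) (w ε) (dt L) + s' * val d (T ε) (s ε) (z ε) (w ε) (ds L) +
        z' * val d (T ε) (s ε) (z ε) (w ε) (d1 L) + w' * val d (T ε) (s ε) (z ε) (w ε) (d2 L)) ε := by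
  induction L using Multiset.induction_on with
  | empty => simpa [ds, d1, d2, dt] using hasDerivAt_const ε (0 : ℝ)
  | cons g L ih =>
    have ih := ih fun g hg => hL g (Multiset.mem_cons_of_mem hg)
    obtain ⟨⟨-, hb⟩, hq, hX, hY⟩ := hL g (Multiset.mem_cons_self _ _)
    have cd : ∀ {f : ℝ → ℝ} (_ : ContDiff ℝ (⊤ : ℕ∞) f) x, HasDerivAt f (deriv f x) x :=
      fun hf x => (hf.differentiable (by simp)).differentiableAt.hasDerivAt
    have h1 := ((cd (hb d) (T ε)).comp ε hT)
    have h2 := ((cd hq.1 (s ε)).comp ε hs)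
    have h3 := ((cd hX.1 (z ε)).comp ε hz)
    have h4 := ((cd hY.1 (w ε)).comp ε hw)
    have h5 := (((h1.mul h2).mul h3).mul h4).add ih
    have e : (fun ε => val d (T ε) (s ε) (z ε) (w ε) (g ::ₘ L)) =
        g.b d ∘ T * g.q ∘ s * g.X ∘ z * g.Y ∘ w +
        fun ε => val d (T ε) (s ε) (z ε) (w ε) L := by
      funext ε; simp [Gen.val]
    rw [e]
    refine h5.congr_deriv ?_
    have eds : ds (g ::ₘ L) = { g with q := deriv g.q } ::ₘ ds L := by simp [ds]
    have ed1 : d1 (g ::ₘ L) = { g with X := deriv g.X } ::ₘ d1 L := by simp [d1]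
    have ed2 : d2 (g ::ₘ L) = { g with Y := deriv g.Y } ::ₘ d2 L := by simp [d2]
    have edt : dt (g ::ₘ L) = { g with b := fun d => deriv (g.b d) } ::ₘ dt L := by simp [dt]
    rw [eds, ed1, ed2, edt]
    simp only [val_cons, Gen.val, Function.comp, Pi.mul_apply]
    ring

/-- First linear phase. -/
def ph (d : Dat) (p : (ℝ × ℝ) × ℝ) : ℝ := d.η1 p.2 * p.1.1 + d.η2 p.2 * p.1.2
/-- Second linear phase. -/
def ps (d : Dat) (p : (ℝ × ℝ) × ℝ) : ℝ := d.ζ1 p.2 * p.1.1 + d.ζ2 p.2 * p.1.2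
/-- Function on space-time represented by a symbol. -/
noncomputable def Ev (d : Dat) (L : Symb) (p : (ℝ × ℝ) × ℝ) : ℝ :=
  val d p.2 (ph d p / d.ℓ) (ph d p / d.R) (ps d p / d.R) L

theorem contDiff_ph (d : Dat) : ContDiff ℝ (⊤ : ℕ∞) (ph d) := by
  have h1 := d.smη1
  have h2 := d.smη2
  unfold ph
  fun_prop

theorem contDiff_ps (d : Dat) : ContDiff ℝ (⊤ : ℕ∞) (ps d) := by
  have h1 := d.smζ1
  have h2 := d.smζ2
  unfold ps
  fun_prop

theorem contDiff_Ev (d : Dat) {L : Symb} (hL : Good TB0 L) : ContDiff ℝ (⊤ : ℕ∞) (Ev d L) := by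
  induction L using Multiset.induction_on with
  | empty => unfold Ev; simpa using contDiff_const
  | cons g L ih =>
    have ih := ih fun g hg => hL g (Multiset.mem_cons_of_mem hg)
    obtain ⟨⟨-, hb⟩, hq, hX, hY⟩ := hL g (Multiset.mem_cons_self _ _)
    have e : Ev d (g ::ₘ L) = fun p => g.b d p.2 * g.q (ph d p / d.ℓ) * g.X (ph d p / d.R) *
        g.Y (ps d p / d.R) + Ev d L p := by
      funext p; simp [Ev, Gen.val]
    rw [e]
    have h1 := hb d
    have h2 := hq.1
    have h3 := hX.1
    have h4 := hY.1
    have h5 := contDiff_ph d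
    have h6 := contDiff_ps d
    have h7 : ContDiff ℝ (⊤ : ℕ∞) fun p => ph d p / d.ℓ := h5.div_const _
    have h8 : ContDiff ℝ (⊤ : ℕ∞) fun p => ph d p / d.R := h5.div_const _
    have h9 : ContDiff ℝ (⊤ : ℕ∞) fun p => ps d p / d.R := h6.div_const _
    exact ((((h1.comp contDiff_snd).mul (h2.comp h7)).mul (h3.comp h8)).mul (h4.comp h9)).add ih

section
variable {d : Dat} {L A B : Symb} {p : (ℝ × ℝ) × ℝ}

@[simp] theorem Ev_add : Ev d (A + B) p = Ev d A p + Ev d B p := val_add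
@[simp] theorem Ev_sm {c : Dat → ℝ → ℝ} : Ev d (sm c L) p = c d p.2 * Ev d L p := val_sm
@[simp] theorem Ev_sc {J : ℕ} : Ev d (sc J L) p = d.δ ^ J * Ev d L p := val_sc
@[simp] theorem Ev_pr : Ev d (pr A B) p = Ev d A p * Ev d B p := val_pr

theorem dd_Ev_aux (hL : Good TB0 L) (v : (ℝ × ℝ) × ℝ) {a b : ℝ}
    (ha : HasDerivAt (fun ε : ℝ => ph d (p + ε • v)) a 0)
    (hb : HasDerivAt (fun ε : ℝ => ps d (p + ε • v)) b 0) :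
    dd v (Ev d L) p = v.2 * Ev d (dt L) p + d.ℓ⁻¹ * (a * (Ev d (ds L) p + d.δ * Ev d (d1 L) p)
      + b * (d.δ * Ev d (d2 L) p)) := by
  have hT : HasDerivAt (fun ε : ℝ => (p + ε • v).2) v.2 0 := by
    simpa using ((hasDerivAt_id (0 : ℝ)).mul_const v.2).const_add p.2
  have := hasDerivAt_val hL d hT (ha.div_const d.ℓ) (ha.div_const d.R) (hb.div_const d.R)
  have := dd_eq_of_hasDerivAt (φ := Ev d L) (contDiff_Ev d hL).dat this
  rw [this]
  have hl := d.ℓ_pos.ne'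
  have hR := d.R_pos.ne'
  simp only [zero_smul, add_zero, Ev, Dat.δ]
  field_simp
  ring

theorem dd_e1_Ev (hL : Good TB0 L) : dd e1 (Ev d L) = fun p => d.ℓ⁻¹ * Ev d (px L) p := by
  funext p
  rw [dd_Ev_aux hL e1 (a := d.η1 p.2) (b := d.ζ1 p.2)]
  · simp only [px, chi, Ev_add, Ev_sm, Ev_sc]; ring
  · simp only [ph]
    have := ((hasDerivAt_id (0 : ℝ)).const_add p.1.1).const_mul (d.η1 p.2)
    simpa using this.add_const (d.η2 p.2 * p.1.2)
  · simp only [ps]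
    have := ((hasDerivAt_id (0 : ℝ)).const_add p.1.1).const_mul (d.ζ1 p.2)
    simpa using this.add_const (d.ζ2 p.2 * p.1.2)

theorem dd_e2_Ev (hL : Good TB0 L) : dd e2 (Ev d L) = fun p => d.ℓ⁻¹ * Ev d (py L) p := by
  funext p
  rw [dd_Ev_aux hL e2 (a := d.η2 p.2) (b := d.ζ2 p.2)]
  · simp only [py, chi', Ev_add, Ev_sm, Ev_sc]; ring
  · simp only [ph]
    have := ((hasDerivAt_id (0 : ℝ)).const_add p.1.2).const_mul (d.η2 p.2)
    simpa using this.const_add (d.η1 p.2 * p.1.1)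
  · simp only [ps]
    have := ((hasDerivAt_id (0 : ℝ)).const_add p.1.2).const_mul (d.ζ2 p.2)
    simpa using this.const_add (d.ζ1 p.2 * p.1.1)

theorem dd_et_Ev (hL : Good TB0 L) : dd et (Ev d L) p = Ev d (dt L) p +
    d.ℓ⁻¹ * ((deriv d.η1 p.2 * p.1.1 + deriv d.η2 p.2 * p.1.2) *
      (Ev d (ds L) p + d.δ * Ev d (d1 L) p)
      + (deriv d.ζ1 p.2 * p.1.1 + deriv d.ζ2 p.2 * p.1.2) * (d.δ * Ev d (d2 L) p)) := by
  have cd : ∀ {f : ℝ → ℝ} (_ : ContDiff ℝ (⊤ : ℕ∞) f),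
      HasDerivAt (fun ε : ℝ => f (p.2 + ε)) (deriv f p.2) 0 := by
    intro f hf
    have h : HasDerivAt f (deriv f p.2) (p.2 + 0) := by
      simpa using (hf.differentiable (by simp)).differentiableAt.hasDerivAt
    exact h.comp_const_add p.2 0
  rw [dd_Ev_aux hL et (a := deriv d.η1 p.2 * p.1.1 + deriv d.η2 p.2 * p.1.2)
    (b := deriv d.ζ1 p.2 * p.1.1 + deriv d.ζ2 p.2 * p.1.2)]
  · simp
  · simp only [ph]
    simpa using ((cd d.smη1).mul_const p.1.1).fun_add ((cd d.smη2).mul_const p.1.2)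
  · simp only [ps]
    simpa using ((cd d.smζ1).mul_const p.1.1).fun_add ((cd d.smζ2).mul_const p.1.2)

theorem d1_ds : d1 (ds L) = ds (d1 L) := by simp [d1, ds]
theorem d2_ds : d2 (ds L) = ds (d2 L) := by simp [d2, ds]
theorem d2_d1 : d2 (d1 L) = d1 (d2 L) := by simp [d1, d2]

theorem Ev_px_px_add_py_py : Ev d (px (px L)) p + Ev d (py (py L)) p = Ev d (Lap L) p := by
  simp only [px, py, chi, chi', Lap, Lam, ds_add, d1_add, d2_add, ds_sm, d1_sm, d2_sm, ds_sc,
    d1_sc, d2_sc, d1_ds, d2_ds, d2_d1, Ev_add, Ev_sm, Ev_sc, Dat.N2, Dat.HZ, Dat.Z2, sm_add,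
    sc_add]
  ring

theorem dd_tmul {c : ℝ → ℝ} (hc : ContDiff ℝ (⊤ : ℕ∞) c) {φ : (ℝ × ℝ) × ℝ → ℝ}
    (hφ : ContDiff ℝ (⊤ : ℕ∞) φ) (v : (ℝ × ℝ) × ℝ) :
    dd v (fun p => c p.2 * φ p) = fun p => v.2 * deriv c p.2 * φ p + c p.2 * dd v φ p := by
  funext p
  refine dd_eq_of_hasDerivAt ((hc.comp contDiff_snd).mul hφ).dat ?_
  have h1 : HasDerivAt (fun ε : ℝ => p + ε • v) v 0 := by
    simpa using ((hasDerivAt_id (0 : ℝ)).smul_const v).const_add p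
  have hT : HasDerivAt (fun ε : ℝ => (p + ε • v).2) v.2 0 := by
    simpa using ((hasDerivAt_id (0 : ℝ)).mul_const v.2).const_add p.2
  have h2 : HasFDerivAt φ (fderiv ℝ φ p) (p + (0 : ℝ) • v) := by simpa using hφ.dat.hasFDerivAt
  have h3 : HasDerivAt c (deriv c p.2) (p + (0 : ℝ) • v).2 := by
    simpa using (hc.differentiable (by simp)).differentiableAt.hasDerivAt
  have := (h3.comp 0 hT).mul (h2.comp_hasDerivAt 0 h1)
  refine this.congr_deriv ?_
  simp [dd, mul_comm v.2]

theorem dd_tmul' {c : ℝ → ℝ} (hc : ContDiff ℝ (⊤ : ℕ∞) c) {φ : (ℝ × ℝ) × ℝ → ℝ}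
    (hφ : ContDiff ℝ (⊤ : ℕ∞) φ) {v : (ℝ × ℝ) × ℝ} (hv : v.2 = 0) :
    dd v (fun p => c p.2 * φ p) = fun p => c p.2 * dd v φ p := by
  rw [dd_tmul hc hφ, hv]; simp

end

/-! ### The source produced by an oscillating layer -/

/-- Potential of an oscillating layer. -/
noncomputable def layer (d : Dat) (θ : ℝ → ℝ) (v : Symb) (p : (ℝ × ℝ) × ℝ) : ℝ :=
  d.ℓ ^ 3 * (θ p.2 * d.a p.2) * Ev d v p

/-- Source error of an oscillating layer. -/
noncomputable def layerErr (d : Dat) (θ : ℝ → ℝ) (v : Symb) (p : (ℝ × ℝ) × ℝ) : ℝ :=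
  d.ℓ * (θ p.2 * d.a p.2) * (Ev d (Lead v) p + d.δ * Ev d (Tres v) p) +
    (d.ℓ * (deriv θ p.2 * d.a p.2) * Ev d (Lap v) p +
    d.ℓ * ((θ p.2 ^ 2 - θ p.2) * d.a p.2 ^ 2 * d.δ) * Ev d (bet (px v) (Lap v)) p)

section
variable {d : Dat} {θ : ℝ → ℝ} {v : Symb} {p : (ℝ × ℝ) × ℝ}

theorem contDiff_amp (d : Dat) (hθ : ContDiff ℝ (⊤ : ℕ∞) θ) (k : ℝ) :
    ContDiff ℝ (⊤ : ℕ∞) fun t => k * (θ t * d.a t) := contDiff_const.mul (hθ.mul d.sma)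

theorem contDiff_layer (hθ : ContDiff ℝ (⊤ : ℕ∞) θ) (hv : Good TB0 v) :
    ContDiff ℝ (⊤ : ℕ∞) (layer d θ v) :=
  ((contDiff_amp d hθ _).comp contDiff_snd).mul (contDiff_Ev d hv)

theorem dd_e1_tEv {c : ℝ → ℝ} (hc : ContDiff ℝ (⊤ : ℕ∞) c) (hv : Good TB0 v) :
    dd e1 (fun p => c p.2 * Ev d v p) = fun p => c p.2 * (d.ℓ⁻¹ * Ev d (px v) p) := by
  rw [dd_tmul' hc (contDiff_Ev d hv) rfl, dd_e1_Ev hv]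

theorem dd_e2_tEv {c : ℝ → ℝ} (hc : ContDiff ℝ (⊤ : ℕ∞) c) (hv : Good TB0 v) :
    dd e2 (fun p => c p.2 * Ev d v p) = fun p => c p.2 * (d.ℓ⁻¹ * Ev d (py v) p) := by
  rw [dd_tmul' hc (contDiff_Ev d hv) rfl, dd_e2_Ev hv]

theorem dd_e1_amp (hθ : ContDiff ℝ (⊤ : ℕ∞) θ) (hv : Good TB0 v) (k : ℝ) :
    dd e1 (fun p => k * (θ p.2 * d.a p.2) * Ev d v p) =
      fun p => (k * d.ℓ⁻¹) * (θ p.2 * d.a p.2) * Ev d (px v) p := by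
  rw [dd_e1_tEv (contDiff_amp d hθ k) hv]
  funext p; ring

theorem dd_e2_amp (hθ : ContDiff ℝ (⊤ : ℕ∞) θ) (hv : Good TB0 v) (k : ℝ) :
    dd e2 (fun p => k * (θ p.2 * d.a p.2) * Ev d v p) =
      fun p => (k * d.ℓ⁻¹) * (θ p.2 * d.a p.2) * Ev d (py v) p := by
  rw [dd_e2_tEv (contDiff_amp d hθ k) hv]
  funext p; ring

theorem lap_layer (hθ : ContDiff ℝ (⊤ : ℕ∞) θ) (hv : Good TB0 v) :
    lap (layer d θ v) = fun p => d.ℓ * (θ p.2 * d.a p.2) * Ev d (Lap v) p := by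
  have hl := d.ℓ_pos.ne'
  funext p
  unfold lap layer
  rw [dd_e1_amp hθ hv, dd_e1_amp hθ hv.px0, dd_e2_amp hθ hv, dd_e2_amp hθ hv.py0,
    ← Ev_px_px_add_py_py]
  field_simp

theorem NN_layer {Φ : (ℝ × ℝ) × ℝ → ℝ} {m11 m12 m21 : ℝ} (hΦ : ContDiff ℝ (⊤ : ℕ∞) Φ)
    (hθ : ContDiff ℝ (⊤ : ℕ∞) θ) (hv : Good TB1 v)
    (hη1 : deriv d.η1 p.2 = -(m11 * d.η1 p.2 + m21 * d.η2 p.2))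
    (hη2 : deriv d.η2 p.2 = -(m12 * d.η1 p.2 - m11 * d.η2 p.2))
    (hζ1 : deriv d.ζ1 p.2 = -(m11 * d.ζ1 p.2 + m21 * d.ζ2 p.2))
    (hζ2 : deriv d.ζ2 p.2 = -(m12 * d.ζ1 p.2 - m11 * d.ζ2 p.2))
    (h11 : dd e1 (dd e1 Φ) p = m21 * p.1.1 - m11 * p.1.2)
    (h12 : dd e1 (dd e2 Φ) p = -(m11 * p.1.1 + m12 * p.1.2))
    (hp1 : dd e1 (lap Φ) p = -(d.α * d.η1 p.2 + d.γ * d.ζ1 p.2))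
    (hp2 : dd e2 (lap Φ) p = -(d.α * d.η2 p.2 + d.γ * d.ζ2 p.2)) :
    NN (fun p => Φ p + layer d θ v p) p = NN Φ p + layerErr d θ v p := by
  have hv0 := hv.mono
  have hω := contDiff_layer (d := d) hθ hv0
  have hl := d.ℓ_pos.ne'
  have hlap := hv.lap.mono
  have hN := (d.N_pos p.2).ne'
  have e11 : dd e1 (dd e1 (layer d θ v)) p =
      d.ℓ * (θ p.2 * d.a p.2) * Ev d (px (px v)) p := by
    unfold layer
    rw [dd_e1_amp hθ hv0, dd_e1_amp hθ hv0.px0]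
    field_simp
  have e12 : dd e1 (dd e2 (layer d θ v)) p =
      d.ℓ * (θ p.2 * d.a p.2) * Ev d (py (px v)) p := by
    rw [dd_comm hω]
    unfold layer
    rw [dd_e1_amp hθ hv0, dd_e2_amp hθ hv0.px0]
    field_simp
  have el1 : dd e1 (lap (layer d θ v)) p = θ p.2 * d.a p.2 * Ev d (px (Lap v)) p := by
    rw [lap_layer hθ hv0, dd_e1_amp hθ hlap]
    field_simp
  have el2 : dd e2 (lap (layer d θ v)) p = θ p.2 * d.a p.2 * Ev d (py (Lap v)) p := by
    rw [lap_layer hθ hv0, dd_e2_amp hθ hlap]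
    field_simp
  have elt : dd et (lap (layer d θ v)) p = d.ℓ * (deriv θ p.2 * d.a p.2 +
      θ p.2 * (d.γ * d.η1 p.2 / (d.η1 p.2 ^ 2 + d.η2 p.2 ^ 2) * d.a p.2)) * Ev d (Lap v) p +
      d.ℓ * (θ p.2 * d.a p.2) * dd et (Ev d (Lap v)) p := by
    rw [lap_layer hθ hv0, dd_tmul (contDiff_amp d hθ _) (contDiff_Ev d hlap)]
    have : deriv (fun t => d.ℓ * (θ t * d.a t)) p.2 = d.ℓ * (deriv θ p.2 * d.a p.2 +
      θ p.2 * (d.γ * d.η1 p.2 / (d.η1 p.2 ^ 2 + d.η2 p.2 ^ 2) * d.a p.2)) := by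
      have h1 : HasDerivAt θ _ p.2 := (hθ.differentiable (by simp)).differentiableAt.hasDerivAt
      have h2 : HasDerivAt d.a _ p.2 := (d.sma.differentiable (by simp)).differentiableAt.hasDerivAt
      rw [((h1.fun_mul h2).const_mul d.ℓ).deriv, d.a_deriv]
    beta_reduce; rw [this]; ring
  have hcr := d.cross p.2
  have eLt : Ev d (dt (Lap v)) p = Ev d (Lead v) p + d.δ * Ev d (dt (Lam v)) p := by
    simp [Lap, Lead]
  have eL : Ev d (Lap v) p = (d.η1 p.2 ^ 2 + d.η2 p.2 ^ 2) * Ev d (ds (ds v)) p +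
      d.δ * Ev d (Lam v) p := by
    simp [Lap, Dat.N2]
  -- expansion of the stratification term
  have eF : d.γ * (Ev d (ds (px v)) p + d.δ * Ev d (d1 (px v)) p) - d.α * d.δ * Ev d (d2 (px v)) p
      = d.γ * d.η1 p.2 * Ev d (ds (ds v)) p + d.δ * Ev d (Xi v) p := by
    simp only [px, Xi, ds_add, d1_add, d2_add, ds_sm, d1_sm, d2_sm, ds_sc, d1_sc, d2_sc, Ev_add,
      Ev_sm, Ev_sc]
    ring
  have ebet : d.δ * Ev d (bet (px v) (Lap v)) p =
      Ev d (px (px v)) p * Ev d (py (Lap v)) p - Ev d (py (px v)) p * Ev d (px (Lap v)) p := by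
    rw [← one_mul (d.δ * _), ← hcr, bet, px.eq_def (px v), py.eq_def (px v), px.eq_def (Lap v),
      py.eq_def (Lap v)]
    simp only [chi, chi', Ev_add, Ev_sm, Ev_sc, Ev_pr]
    ring
  have etr : d.ℓ * dd et (Ev d (Lap v)) p = d.ℓ * Ev d (dt (Lap v)) p
      - (m11 * p.1.1 + m12 * p.1.2) * Ev d (px (Lap v)) p
      - (m21 * p.1.1 - m11 * p.1.2) * Ev d (py (Lap v)) p := by
    rw [dd_et_Ev hlap, hη1, hη2, hζ1, hζ2, px.eq_def (Lap v), py.eq_def (Lap v)]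
    simp only [chi, chi', Ev_add, Ev_sm, Ev_sc]
    field_simp
    ring
  have epx : Ev d (px (px v)) p = d.η1 p.2 * (Ev d (ds (px v)) p + d.δ * Ev d (d1 (px v)) p) +
      d.ζ1 p.2 * (d.δ * Ev d (d2 (px v)) p) := by
    rw [px.eq_def (px v)]
    simp only [chi, Ev_add, Ev_sm, Ev_sc]; ring
  have epy : Ev d (py (px v)) p = d.η2 p.2 * (Ev d (ds (px v)) p + d.δ * Ev d (d1 (px v)) p) +
      d.ζ2 p.2 * (d.δ * Ev d (d2 (px v)) p) := by
    rw [py.eq_def (px v)]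
    simp only [chi', Ev_add, Ev_sm, Ev_sc]; ring
  have estr : (d.α * d.η1 p.2 + d.γ * d.ζ1 p.2) * Ev d (py (px v)) p -
      (d.α * d.η2 p.2 + d.γ * d.ζ2 p.2) * Ev d (px (px v)) p =
      -(d.γ * d.η1 p.2 * Ev d (ds (ds v)) p + d.δ * Ev d (Xi v) p) := by
    rw [← eF, epx, epy]
    linear_combination (-d.γ * (Ev d (ds (px v)) p + d.δ * Ev d (d1 (px v)) p) +
      d.α * d.δ * Ev d (d2 (px v)) p) * hcr
  have eT : Ev d (Tres v) p = Ev d (dt (Lam v)) p + d.γ * d.η1 p.2 /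
      (d.η1 p.2 ^ 2 + d.η2 p.2 ^ 2) * Ev d (Lam v) p - Ev d (Xi v) p +
      d.a p.2 * Ev d (bet (px v) (Lap v)) p := by
    simp only [Tres, Tlin, Ev_add, Ev_sm, Dat.r]; ring
  have eR : d.γ * d.η1 p.2 / (d.η1 p.2 ^ 2 + d.η2 p.2 ^ 2) * Ev d (Lap v) p =
      d.γ * d.η1 p.2 * Ev d (ds (ds v)) p + d.δ * (d.γ * d.η1 p.2 /
      (d.η1 p.2 ^ 2 + d.η2 p.2 ^ 2) * Ev d (Lam v) p) := by
    rw [eL]; field_simp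
  unfold NN
  rw [lap_add hΦ hω]
  simp only [dd_add hΦ hω, dd_add (contDiff_dd _ hΦ) (contDiff_dd _ hω),
    dd_add (contDiff_lap hΦ) (contDiff_lap hω)]
  rw [e11, e12, el1, el2, elt, h11, h12, hp1, hp2]
  unfold layerErr
  rw [eT]
  linear_combination (θ p.2 * d.a p.2) * etr + d.ℓ * (θ p.2 * d.a p.2) * (estr + eR + eLt)
    - d.ℓ * (θ p.2 * d.a p.2) ^ 2 * ebet

end

/-! ### Bounds for a layer -/

section
variable {d : Dat} {θ : ℝ → ℝ} {v L : Symb} {p : (ℝ × ℝ) × ℝ}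

theorem Good.chi'0 (h : Good TB0 v) : Good TB0 (chi' v) :=
  (h.d1.sm0 TB1.η2.1).add (h.d2.sm0 TB1.ζ2.1)

theorem good_iterate {f : Symb → Symb} (hf : ∀ L, Good TB0 L → Good TB0 (f L)) (h : Good TB0 L)
    (i : ℕ) : Good TB0 (f^[i] L) := by
  induction i with
  | zero => exact h
  | succ i ih => rw [Function.iterate_succ_apply']; exact hf _ ih

theorem ddMix_tmul {c : ℝ → ℝ} (hc : ContDiff ℝ (⊤ : ℕ∞) c) {φ : (ℝ × ℝ) × ℝ → ℝ}
    (hφ : ContDiff ℝ (⊤ : ℕ∞) φ) (i j : ℕ) :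
    ddMix i j (fun p => c p.2 * φ p) = fun p => c p.2 * ddMix i j φ p := by
  have key : ∀ {v : (ℝ × ℝ) × ℝ} (_ : v.2 = 0) {φ : (ℝ × ℝ) × ℝ → ℝ}
      (_ : ContDiff ℝ (⊤ : ℕ∞) φ) (i : ℕ),
      (dd v)^[i] (fun p => c p.2 * φ p) = fun p => c p.2 * (dd v)^[i] φ p := by
    intro v hv φ hφ i
    induction i with
    | zero => rfl
    | succ i ih =>
      simp only [Function.iterate_succ_apply', ih]
      exact dd_tmul' hc (contDiff_dd_iterate hφ _ _) hv
  unfold ddMix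
  rw [key rfl hφ, key rfl (contDiff_dd_iterate hφ _ _)]

theorem ddMix_Ev (h : Good TB0 L) (i j : ℕ) :
    ddMix i j (Ev d L) = fun p => d.ℓ⁻¹ ^ (i + j) * Ev d (px^[i] (py^[j] L)) p := by
  have h2 : ∀ j, (dd e2)^[j] (Ev d L) = fun p => d.ℓ⁻¹ ^ j * Ev d (py^[j] L) p := by
    intro j
    induction j with
    | zero => simp
    | succ j ih =>
      rw [Function.iterate_succ_apply', ih,
        dd_e2_tEv contDiff_const (good_iterate (fun _ h => h.py0) h j)]
      funext p
      rw [Function.iterate_succ_apply']; ring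
  have hj := good_iterate (fun _ h => Good.py0 h) h j
  unfold ddMix
  rw [h2]
  induction i with
  | zero => simp
  | succ i ih =>
    rw [Function.iterate_succ_apply', ih,
      dd_e1_tEv contDiff_const (good_iterate (fun _ h => h.px0) hj i)]
    funext p
    rw [Function.iterate_succ_apply']; ring

theorem Slow.sm {c : Dat → ℝ → ℝ} (h : Slow L) : Slow (sm c L) :=
  Slow.map (f := fun g => { g with b := fun d t => c d t * g.b d t }) (fun _ => rfl) h

theorem Slow.d1 (h : Slow L) : Slow (d1 L) :=
  Slow.map (f := fun g => { g with X := deriv g.X }) (fun _ => rfl) h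

theorem Slow.d2 (h : Slow L) : Slow (d2 L) :=
  Slow.map (f := fun g => { g with Y := deriv g.Y }) (fun _ => rfl) h

theorem Slow.chi (h : Slow L) : Slow (chi L) := h.d1.sm.add h.d2.sm

theorem Slow.chi' (h : Slow L) : Slow (chi' L) := h.d1.sm.add h.d2.sm

theorem Ev_px_slow (h : Slow L) : Ev d (px L) p = d.δ * Ev d (chi L) p := by
  have : Ev d (ds L) p = 0 := val_ds_slow h
  simp [px, this]

theorem Ev_py_slow (h : Slow L) : Ev d (py L) p = d.δ * Ev d (chi' L) p := by
  have : Ev d (ds L) p = 0 := val_ds_slow h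
  simp [py, this]

theorem slow_iterate {f : Symb → Symb}
    (hs : ∀ L, Slow L → Slow (f L)) (h : Slow L) (i : ℕ) :
    Slow (f^[i] L) := by
  induction i with
  | zero => exact h
  | succ i ih => rw [Function.iterate_succ_apply']; exact hs _ ih

theorem ddMix_Ev_slow (h : Good TB0 L) (hs : Slow L) (i j : ℕ) :
    ddMix i j (Ev d L) = fun p => (d.ℓ⁻¹ * d.δ) ^ (i + j) * Ev d (chi^[i] (chi'^[j] L)) p := by
  have h2 : ∀ j, (dd e2)^[j] (Ev d L) = fun p => (d.ℓ⁻¹ * d.δ) ^ j * Ev d (chi'^[j] L) p := by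
    intro j
    induction j with
    | zero => simp
    | succ j ih =>
      rw [Function.iterate_succ_apply', ih,
        dd_e2_tEv contDiff_const (good_iterate (fun _ h => h.chi'0) h j)]
      funext p
      rw [Function.iterate_succ_apply', Ev_py_slow (slow_iterate (fun _ h => h.chi') hs j)]
      ring
  have hj := good_iterate (fun _ h => Good.chi'0 h) h j
  have hj' := slow_iterate (fun _ h => h.chi') hs j
  unfold ddMix
  rw [h2]
  induction i with
  | zero => simp
  | succ i ih =>
    rw [Function.iterate_succ_apply', ih,
      dd_e1_tEv contDiff_const (good_iterate (fun _ h => h.chi0) hj i)]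
    funext p
    rw [Function.iterate_succ_apply', Ev_px_slow (slow_iterate (fun _ h => h.chi) hj' i)]
    ring

theorem Good.bound_Ev (h : Good TB0 L) : ∃ N : ℕ, ∀ d : Dat, ∀ p : (ℝ × ℝ) × ℝ,
    p.2 ∈ Icc d.t0 1 → |Ev d L p| ≤ d.D ^ N := by
  obtain ⟨N, hN⟩ := h.bound
  exact ⟨N, fun d p hp => hN d p.2 hp _ _ _⟩

theorem Dat.pow_mono (d : Dat) {N M : ℕ} (h : N ≤ M) : d.D ^ N ≤ d.D ^ M :=
  pow_le_pow_right₀ d.one_le h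

theorem Good.bound_ddMix (h : Good TB0 L) (i j J : ℕ) (hJ : i + j ≤ J) :
    ∃ N : ℕ, ∀ d : Dat, ∀ p : (ℝ × ℝ) × ℝ, p.2 ∈ Icc d.t0 1 →
      |ddMix i j (Ev d L) p| ≤ d.ℓ⁻¹ ^ J * d.D ^ N ∧
      |d.δ ^ (J + 1) * ddMix i j (Ev d L) p| ≤ d.D ^ N := by
  obtain ⟨N, hN⟩ := (good_iterate (fun _ h => Good.px0 h)
    (good_iterate (fun _ h => Good.py0 h) h j) i).bound_Ev
  refine ⟨N + J, fun d p hp => ?_⟩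
  have h1 := hN d p hp
  have hl := d.ℓ_pos
  have hl1 : 1 ≤ d.ℓ⁻¹ := (one_le_inv₀ hl).2 (d.ℓ_le.trans d.R_le)
  have hD := d.D_pos
  rw [ddMix_Ev h]
  dsimp only
  constructor
  · rw [abs_mul, abs_of_nonneg (by positivity)]
    have h3 : d.ℓ⁻¹ ^ (i + j) ≤ d.ℓ⁻¹ ^ J := pow_le_pow_right₀ hl1 hJ
    have h4 := d.pow_mono (Nat.le_add_right N J)
    gcongr
    exact h1.trans h4
  · have hδ := d.δ_pos
    have hR : d.ℓ⁻¹ * d.δ ≤ d.D := by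
      refine le_trans (le_of_eq ?_) d.R_inv
      have := d.R_pos
      unfold Dat.δ; field_simp
    have h5 : d.δ ^ (J + 1) * d.ℓ⁻¹ ^ (i + j) ≤ d.D ^ J := by
      have e : J + 1 = (J + 1 - (i + j)) + (i + j) := by omega
      rw [e, pow_add, mul_assoc, ← mul_pow, mul_comm d.δ]
      have h6 : d.δ ^ (J + 1 - (i + j)) ≤ 1 := pow_le_one₀ hδ.le d.δ_le
      have h7 : (d.ℓ⁻¹ * d.δ) ^ (i + j) ≤ d.D ^ (i + j) := by gcongr
      calc _ ≤ 1 * d.D ^ (i + j) := by gcongr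
        _ ≤ d.D ^ J := by rw [one_mul]; exact d.pow_mono hJ
    rw [← mul_assoc, abs_mul, abs_of_nonneg (by positivity), Nat.add_comm N, pow_add d.D]
    exact mul_le_mul h5 h1 (abs_nonneg _) (by positivity)

theorem Good.bound_ddMix_slow (h : Good TB0 L) (hs : Slow L) (i j J : ℕ) (hJ : i + j ≤ J) :
    ∃ N : ℕ, ∀ d : Dat, ∀ p : (ℝ × ℝ) × ℝ, p.2 ∈ Icc d.t0 1 →
      |ddMix i j (Ev d L) p| ≤ d.D ^ N := by
  obtain ⟨N, hN⟩ := (good_iterate (fun _ h => Good.chi0 h)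
    (good_iterate (fun _ h => Good.chi'0 h) h j) i).bound_Ev
  refine ⟨J + N, fun d p hp => ?_⟩
  have h1 := hN d p hp
  have hl := d.ℓ_pos
  have hD := d.D_pos
  have hδ := d.δ_pos
  rw [ddMix_Ev_slow h hs]
  dsimp only
  have hR : d.ℓ⁻¹ * d.δ ≤ d.D := by
    refine le_trans (le_of_eq ?_) d.R_inv
    have := d.R_pos
    unfold Dat.δ; field_simp
  have h7 : (d.ℓ⁻¹ * d.δ) ^ (i + j) ≤ d.D ^ J :=
    (pow_le_pow_left₀ (by positivity) hR _).trans (d.pow_mono hJ)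
  rw [abs_mul, abs_of_nonneg (by positivity), pow_add d.D]
  exact mul_le_mul h7 h1 (abs_nonneg _) (by positivity)

theorem exists_uniform {P : ℕ → ℕ → ℕ → Prop} (hP : ∀ i j N M, N ≤ M → P i j N → P i j M)
    (J : ℕ) (h : ∀ i j, i + j ≤ J → ∃ N, P i j N) : ∃ N, ∀ i j, i + j ≤ J → P i j N := by
  have h' : ∀ i j, ∃ N, i + j ≤ J → P i j N := fun i j => by
    by_cases hij : i + j ≤ J
    · obtain ⟨N, hN⟩ := h i j hij
      exact ⟨N, fun _ => hN⟩
    · exact ⟨0, fun h => absurd h hij⟩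
  choose f hf using h'
  refine ⟨∑ i ∈ Finset.range (J + 1), ∑ j ∈ Finset.range (J + 1), f i j, fun i j hij => ?_⟩
  refine hP i j _ _ ?_ (hf i j hij)
  have h1 : f i j ≤ ∑ j ∈ Finset.range (J + 1), f i j :=
    Finset.single_le_sum (f := fun j => f i j) (fun _ _ => Nat.zero_le _)
      (Finset.mem_range.2 (by omega))
  exact h1.trans (Finset.single_le_sum (f := fun i => ∑ j ∈ Finset.range (J + 1), f i j)
      (fun _ _ => Nat.zero_le _) (Finset.mem_range.2 (by omega)))

/-- Bounds for a layer built from the symbol `v`, to order `J`, with exponent `N`. -/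
def LayerBound (v : Symb) (J N : ℕ) : Prop :=
  ∀ (d : Dat) (θ : ℝ → ℝ), ContDiff ℝ (⊤ : ℕ∞) θ → ∀ p : (ℝ × ℝ) × ℝ, p.2 ∈ Icc d.t0 1 →
    |θ p.2| ≤ 1 →
    |lap (layer d θ v) p| ≤ d.ℓ * d.D ^ N ∧
    |dd e1 (lap (layer d θ v)) p| ≤ d.D ^ N ∧ |dd e2 (lap (layer d θ v)) p| ≤ d.D ^ N ∧
    ∀ i j, i + j ≤ J → |ddMix i j (layerErr d θ v) p| ≤
      d.D ^ N * (d.ℓ + d.ℓ⁻¹ ^ J * (|d.a p.2| * (|deriv θ p.2| + |θ p.2 ^ 2 - θ p.2|)))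

theorem exists_layer {h X Y : ℝ → ℝ} (hh : Per h) (hX : Cut X) (hY : Cut Y) (J : ℕ) :
    ∃ V, Good TB1 V ∧ Van V ∧ ∃ N, LayerBound (lead0 h X Y + V) J N := by
  obtain ⟨V, m, S, hV, hV', hm, hm', hS, -, H⟩ := exists_approx_symb hh hX hY J
  refine ⟨V, hV, hV', ?_⟩
  have hv : Good TB1 (lead0 h X Y + V) := (good_lead0 hh hX hY).add hV
  generalize lead0 h X Y + V = v at *
  obtain ⟨N1, h1⟩ := exists_uniform (P := fun i j N => ∀ d : Dat, ∀ p : (ℝ × ℝ) × ℝ,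
    p.2 ∈ Icc d.t0 1 → |ddMix i j (Ev d m) p| ≤ d.D ^ N)
    (fun i j N M hNM h d p hp => (h d p hp).trans (d.pow_mono hNM)) J
    fun i j hij => hm.bound_ddMix_slow hm' i j J hij
  have mono2 : ∀ {L : Symb} (i j N M : ℕ), N ≤ M → (∀ d : Dat, ∀ p : (ℝ × ℝ) × ℝ,
    p.2 ∈ Icc d.t0 1 → |ddMix i j (Ev d L) p| ≤ d.ℓ⁻¹ ^ J * d.D ^ N ∧
      |d.δ ^ (J + 1) * ddMix i j (Ev d L) p| ≤ d.D ^ N) → (∀ d : Dat, ∀ p : (ℝ × ℝ) × ℝ,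
    p.2 ∈ Icc d.t0 1 → |ddMix i j (Ev d L) p| ≤ d.ℓ⁻¹ ^ J * d.D ^ M ∧
      |d.δ ^ (J + 1) * ddMix i j (Ev d L) p| ≤ d.D ^ M) := by
    intro L i j N M hNM h d p hp
    obtain ⟨ha, hb⟩ := h d p hp
    have hm := d.pow_mono hNM
    have hl := d.ℓ_pos
    exact ⟨ha.trans (by gcongr), hb.trans hm⟩
  have hbet := hv.mono.px0.bet hv.lap.mono
  obtain ⟨N2, h2⟩ := exists_uniform mono2 J fun i j hij => hS.bound_ddMix i j J hij
  obtain ⟨N3, h3⟩ := exists_uniform mono2 J fun i j hij => hv.lap.mono.bound_ddMix i j J hij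
  obtain ⟨N4, h4⟩ := exists_uniform mono2 J fun i j hij => hbet.bound_ddMix i j J hij
  obtain ⟨N5, h5⟩ := hv.lap.mono.bound_Ev
  obtain ⟨N6, h6⟩ := hv.lap.mono.px0.bound_Ev
  obtain ⟨N7, h7⟩ := hv.lap.mono.py0.bound_Ev
  refine ⟨N1 + N2 + N3 + N4 + N5 + N6 + N7 + 2, fun d θ hθ p hp hθ1 => ?_⟩
  have hl := d.ℓ_pos
  have hl1 : d.ℓ ≤ 1 := d.ℓ_le.trans d.R_le
  have hD := d.D_pos
  have ha := d.ba p.2 hp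
  have hδ := d.δ_pos
  have key : ∀ {n : ℕ} {k x : ℝ}, n ≤ N1 + N2 + N3 + N4 + N5 + N6 + N7 + 1 → 0 ≤ k →
      |x| ≤ d.D ^ n → |k * (θ p.2 * d.a p.2) * x| ≤
        k * d.D ^ (N1 + N2 + N3 + N4 + N5 + N6 + N7 + 2) := by
    intro n k x hn hk hx
    rw [abs_mul, abs_mul, abs_mul, abs_of_nonneg hk, mul_assoc]
    have : |θ p.2| * |d.a p.2| * |x| ≤ 1 * d.D * d.D ^ n := by gcongr
    refine mul_le_mul_of_nonneg_left (this.trans ?_) hk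
    rw [one_mul, ← pow_succ']
    exact d.pow_mono (by omega)
  refine ⟨?_, ?_, ?_, fun i j hij => ?_⟩
  · rw [lap_layer hθ hv.mono]
    exact key (by omega) hl.le (h5 d p hp)
  · rw [lap_layer hθ hv.mono, dd_e1_amp hθ hv.lap.mono, mul_inv_cancel₀ hl.ne']
    simpa using key (by omega) zero_le_one (h6 d p hp)
  · rw [lap_layer hθ hv.mono, dd_e2_amp hθ hv.lap.mono, mul_inv_cancel₀ hl.ne']
    simpa using key (by omega) zero_le_one (h7 d p hp)
  · have e : layerErr d θ v = fun p => (d.ℓ * (θ p.2 * d.a p.2) *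
        (Ev d m p + d.δ ^ (J + 1) * Ev d S p)) + (d.ℓ * (deriv θ p.2 * d.a p.2) * Ev d (Lap v) p +
        d.ℓ * ((θ p.2 ^ 2 - θ p.2) * d.a p.2 ^ 2 * d.δ) * Ev d (bet (px v) (Lap v)) p) := by
      funext p
      have := H d p.2 (ph d p / d.ℓ) (ph d p / d.R) (ps d p / d.R)
      unfold resid at this
      unfold layerErr
      rw [show Ev d (Lead v) p + d.δ * Ev d (Tres v) p = Ev d m p + d.δ ^ (J + 1) * Ev d S p
        from this]
    have ha' := d.sma
    have sm1 := contDiff_Ev d hm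
    have sm2 := contDiff_Ev d hS
    have sm3 := contDiff_Ev d hv.lap.mono
    have sm4 := contDiff_Ev d hbet
    have c1 : ContDiff ℝ (⊤ : ℕ∞) fun t => d.ℓ * (θ t * d.a t) := contDiff_amp d hθ _
    have c2 : ContDiff ℝ (⊤ : ℕ∞) fun t => d.ℓ * (deriv θ t * d.a t) :=
      contDiff_amp d hθ.deriv_top _
    have c3 : ContDiff ℝ (⊤ : ℕ∞) fun t => d.ℓ * ((θ t ^ 2 - θ t) * d.a t ^ 2 * d.δ) := by
      fun_prop
    have c0 : ContDiff ℝ (⊤ : ℕ∞) fun _ : ℝ => d.δ ^ (J + 1) := contDiff_const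
    have sm2' : ContDiff ℝ (⊤ : ℕ∞) fun p => d.δ ^ (J + 1) * Ev d S p := contDiff_const.mul sm2
    have sm12 : ContDiff ℝ (⊤ : ℕ∞) fun p => Ev d m p + d.δ ^ (J + 1) * Ev d S p := sm1.add sm2'
    have t1 : ContDiff ℝ (⊤ : ℕ∞) fun p : (ℝ × ℝ) × ℝ => d.ℓ * (θ p.2 * d.a p.2) *
      (Ev d m p + d.δ ^ (J + 1) * Ev d S p) := (c1.comp contDiff_snd).mul sm12
    have t2 : ContDiff ℝ (⊤ : ℕ∞) fun p : (ℝ × ℝ) × ℝ => d.ℓ * (deriv θ p.2 * d.a p.2) *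
      Ev d (Lap v) p := (c2.comp contDiff_snd).mul sm3
    have t3 : ContDiff ℝ (⊤ : ℕ∞) fun p : (ℝ × ℝ) × ℝ =>
      d.ℓ * ((θ p.2 ^ 2 - θ p.2) * d.a p.2 ^ 2 * d.δ) * Ev d (bet (px v) (Lap v)) p := (c3.comp contDiff_snd).mul sm4
    rw [e, ddMix_add t1 (t2.add t3), ddMix_add t2 t3, ddMix_tmul c1 sm12, ddMix_tmul c2 sm3,
      ddMix_tmul c3 sm4, ddMix_add sm1 sm2', ddMix_tmul c0 sm2]
    have b1 := h1 i j hij d p hp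
    have b2 := (h2 i j hij d p hp).2
    have b3 := (h3 i j hij d p hp).1
    have b4 := (h4 i j hij d p hp).1
    have b12 : |ddMix i j (Ev d m) p + d.δ ^ (J + 1) * ddMix i j (Ev d S) p| ≤
        d.D ^ (N1 + N2 + 1) :=
      (abs_add_le _ _).trans ((add_le_add b1 b2).trans (two_pow_add_le d.two_le _ _))
    have B1 := key (by omega) hl.le b12
    set N := N1 + N2 + N3 + N4 + N5 + N6 + N7 + 2 with hN
    have B2 : |d.ℓ * (deriv θ p.2 * d.a p.2) * ddMix i j (Ev d (Lap v)) p| ≤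
        d.D ^ N * (d.ℓ⁻¹ ^ J * (|d.a p.2| * |deriv θ p.2|)) := by
      rw [abs_mul, abs_mul, abs_mul, abs_of_pos hl]
      calc _ ≤ 1 * (|deriv θ p.2| * |d.a p.2|) * (d.ℓ⁻¹ ^ J * d.D ^ N) := by
            have := d.pow_mono (show N3 ≤ N by omega)
            have := b3.trans (mul_le_mul_of_nonneg_left this (by positivity))
            gcongr
        _ = _ := by ring
    have B3 : |d.ℓ * ((θ p.2 ^ 2 - θ p.2) * d.a p.2 ^ 2 * d.δ) *
        ddMix i j (Ev d (bet (px v) (Lap v))) p| ≤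
        d.D ^ N * (d.ℓ⁻¹ ^ J * (|d.a p.2| * |θ p.2 ^ 2 - θ p.2|)) := by
      rw [abs_mul, abs_mul, abs_mul, abs_mul, abs_of_pos hl, abs_of_pos hδ, abs_pow, pow_two |_|]
      calc _ ≤ 1 * (|θ p.2 ^ 2 - θ p.2| * (|d.a p.2| * d.D) * 1) * (d.ℓ⁻¹ ^ J * d.D ^ N4) := by
            have := d.δ_le
            gcongr
        _ = d.D ^ (N4 + 1) * (d.ℓ⁻¹ ^ J * (|d.a p.2| * |θ p.2 ^ 2 - θ p.2|)) := by ring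
        _ ≤ _ := by
            have := d.pow_mono (show N4 + 1 ≤ N by omega)
            gcongr
    refine (abs_add_le _ _).trans ((add_le_add B1 ((abs_add_le _ _).trans
      (add_le_add B2 B3))).trans (le_of_eq ?_))
    ring

end

/-! ### The linearised dynamics at the origin -/

theorem contDiff_tint {f : ℝ → ℝ} (hf : ContDiff ℝ (⊤ : ℕ∞) f) :
    ContDiff ℝ (⊤ : ℕ∞) fun t => ∫ u in t..1, f u := by
  rw [contDiff_infty_iff_deriv]
  refine ⟨fun t => (hasDerivAt_tint hf.continuous t).differentiableAt, ?_⟩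
  have : (deriv fun t => ∫ u in t..1, f u) = fun t => -f t :=
    funext fun t => (hasDerivAt_tint hf.continuous t).deriv
  rw [this]
  exact hf.neg

/-- State of the system at the origin: transported covectors `X1, X2`, velocity gradient
`(m11, m12; m21, -m11)` and density gradient `P1 X1 + P2 X2`. -/
structure St where
  (X11 X12 X21 X22 m11 m12 m21 : ℝ → ℝ)
  (P1 P2 : ℝ)
  s11 : ContDiff ℝ (⊤ : ℕ∞) X11
  s12 : ContDiff ℝ (⊤ : ℕ∞) X12
  s21 : ContDiff ℝ (⊤ : ℕ∞) X21
  s22 : ContDiff ℝ (⊤ : ℕ∞) X22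
  i11 : X11 1 = 1
  i12 : X12 1 = 0
  i21 : X21 1 = 0
  i22 : X22 1 = 1
  cross : ∀ t, X11 t * X22 t - X12 t * X21 t = 1
  d11 : ∀ t, deriv X11 t = -(m11 t * X11 t + m21 t * X12 t)
  d12 : ∀ t, deriv X12 t = -(m12 t * X11 t - m11 t * X12 t)
  d21 : ∀ t, deriv X21 t = -(m11 t * X21 t + m21 t * X22 t)
  d22 : ∀ t, deriv X22 t = -(m12 t * X21 t - m11 t * X22 t)

/-- The state of rest. -/
noncomputable def St.rest : St where
  X11 := fun _ => 1
  X12 := fun _ => 0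
  X21 := fun _ => 0
  X22 := fun _ => 1
  m11 := fun _ => 0
  m12 := fun _ => 0
  m21 := fun _ => 0
  P1 := 0
  P2 := 0
  s11 := contDiff_const
  s12 := contDiff_const
  s21 := contDiff_const
  s22 := contDiff_const
  i11 := rfl
  i12 := rfl
  i21 := rfl
  i22 := rfl
  cross := by simp
  d11 := by simp
  d12 := by simp
  d21 := by simp
  d22 := by simp

namespace St

variable (σ : St) (k G : ℝ)

/-- First component of the transported covector `(k, 1)`. -/
def f1 (t : ℝ) : ℝ := k * σ.X11 t + σ.X21 t
/-- Second component of the transported covector `(k, 1)`. -/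
def f2 (t : ℝ) : ℝ := k * σ.X12 t + σ.X22 t
/-- Squared length of the transported covector. -/
def Q (t : ℝ) : ℝ := σ.f1 k t ^ 2 + σ.f2 k t ^ 2
/-- Component of the density gradient. -/
def W : ℝ := k * σ.P2 - σ.P1
/-- Growth rate. -/
noncomputable def rate (t : ℝ) : ℝ := σ.W k * σ.f1 k t / σ.Q k t
/-- Amplitude. -/
noncomputable def amp (t : ℝ) : ℝ := G * exp (-∫ u in t..1, σ.rate k u)
/-- Strength of the induced shear. -/
noncomputable def shear (t : ℝ) : ℝ := -(σ.amp k G t * σ.f1 k t / σ.Q k t)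
/-- Accumulated shear. -/
noncomputable def mu (t : ℝ) : ℝ := -∫ u in t..1, σ.shear k G u

theorem contDiff_f1 : ContDiff ℝ (⊤ : ℕ∞) (σ.f1 k) := (contDiff_const.mul σ.s11).add σ.s21
theorem contDiff_f2 : ContDiff ℝ (⊤ : ℕ∞) (σ.f2 k) := (contDiff_const.mul σ.s12).add σ.s22

theorem cross_f (t : ℝ) : σ.f1 k t * -σ.X12 t - σ.f2 k t * -σ.X11 t = 1 := by
  rw [← σ.cross t, f1, f2]; ring

theorem Q_pos (t : ℝ) : 0 < σ.Q k t := by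
  have := σ.cross_f k t
  unfold Q
  by_contra h
  have h1 : σ.f1 k t = 0 := by nlinarith [sq_nonneg (σ.f1 k t), sq_nonneg (σ.f2 k t)]
  have h2 : σ.f2 k t = 0 := by nlinarith [sq_nonneg (σ.f1 k t), sq_nonneg (σ.f2 k t)]
  simp [h1, h2] at this

theorem contDiff_Q : ContDiff ℝ (⊤ : ℕ∞) (σ.Q k) :=
  ((σ.contDiff_f1 k).pow 2).add ((σ.contDiff_f2 k).pow 2)

theorem contDiff_rate : ContDiff ℝ (⊤ : ℕ∞) (σ.rate k) :=
  (contDiff_const.mul (σ.contDiff_f1 k)).div (σ.contDiff_Q k) fun t => (σ.Q_pos k t).ne'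

theorem contDiff_amp : ContDiff ℝ (⊤ : ℕ∞) (σ.amp k G) :=
  contDiff_const.mul (contDiff_tint (σ.contDiff_rate k)).neg.exp

theorem contDiff_shear : ContDiff ℝ (⊤ : ℕ∞) (σ.shear k G) :=
  (((σ.contDiff_amp k G).mul (σ.contDiff_f1 k)).div (σ.contDiff_Q k)
    fun t => (σ.Q_pos k t).ne').neg

theorem contDiff_mu : ContDiff ℝ (⊤ : ℕ∞) (σ.mu k G) := (contDiff_tint (σ.contDiff_shear k G)).neg

theorem hasDerivAt_amp (t : ℝ) : HasDerivAt (σ.amp k G) (σ.rate k t * σ.amp k G t) t := by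
  refine (((hasDerivAt_tint (σ.contDiff_rate k).continuous t).neg.exp).const_mul G).congr_deriv ?_
  simp only [amp, Pi.neg_apply]; ring

theorem hasDerivAt_mu (t : ℝ) : HasDerivAt (σ.mu k G) (σ.shear k G t) t := by
  have := (hasDerivAt_tint (σ.contDiff_shear k G).continuous t).neg
  rwa [neg_neg] at this

theorem mu_one : σ.mu k G 1 = 0 := by simp [mu]

theorem amp_add (t : ℝ) : σ.amp k G t + σ.mu k G t * σ.W k = G := by
  have h : ∀ t, HasDerivAt (fun t => σ.amp k G t + σ.mu k G t * σ.W k) 0 t := fun t => by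
    refine ((σ.hasDerivAt_amp k G t).add
      ((σ.hasDerivAt_mu k G t).mul_const (σ.W k))).congr_deriv ?_
    simp only [shear, rate]; ring
  have := is_const_of_deriv_eq_zero (fun t => (h t).differentiableAt) (fun t => (h t).deriv) t 1
  rw [this, mu_one]; simp [amp]

theorem hd11 (t : ℝ) : HasDerivAt σ.X11 (-(σ.m11 t * σ.X11 t + σ.m21 t * σ.X12 t)) t := by
  rw [← σ.d11]; exact (σ.s11.differentiable (by simp) t).hasDerivAt
theorem hd12 (t : ℝ) : HasDerivAt σ.X12 (-(σ.m12 t * σ.X11 t - σ.m11 t * σ.X12 t)) t := by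
  rw [← σ.d12]; exact (σ.s12.differentiable (by simp) t).hasDerivAt
theorem hd21 (t : ℝ) : HasDerivAt σ.X21 (-(σ.m11 t * σ.X21 t + σ.m21 t * σ.X22 t)) t := by
  rw [← σ.d21]; exact (σ.s21.differentiable (by simp) t).hasDerivAt
theorem hd22 (t : ℝ) : HasDerivAt σ.X22 (-(σ.m12 t * σ.X21 t - σ.m11 t * σ.X22 t)) t := by
  rw [← σ.d22]; exact (σ.s22.differentiable (by simp) t).hasDerivAt

theorem hasDerivAt_f1 (t : ℝ) :
    HasDerivAt (σ.f1 k) (-(σ.m11 t * σ.f1 k t + σ.m21 t * σ.f2 k t)) t := by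
  refine (((σ.hd11 t).const_mul k).add (σ.hd21 t)).congr_deriv ?_
  simp only [f1, f2]; ring

theorem hasDerivAt_f2 (t : ℝ) :
    HasDerivAt (σ.f2 k) (-(σ.m12 t * σ.f1 k t - σ.m11 t * σ.f2 k t)) t := by
  refine (((σ.hd12 t).const_mul k).add (σ.hd22 t)).congr_deriv ?_
  simp only [f1, f2]; ring

/-- The state after superposing a new layer. -/
noncomputable def step : St where
  X11 := fun t => σ.X11 t + σ.mu k G t * σ.f1 k t
  X12 := fun t => σ.X12 t + σ.mu k G t * σ.f2 k t
  X21 := fun t => σ.X21 t - k * (σ.mu k G t * σ.f1 k t)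
  X22 := fun t => σ.X22 t - k * (σ.mu k G t * σ.f2 k t)
  m11 := fun t => σ.m11 t - σ.shear k G t * (σ.f1 k t * σ.f2 k t)
  m12 := fun t => σ.m12 t - σ.shear k G t * σ.f2 k t ^ 2
  m21 := fun t => σ.m21 t + σ.shear k G t * σ.f1 k t ^ 2
  P1 := σ.P1 + G * k
  P2 := σ.P2 + G
  s11 := σ.s11.add ((σ.contDiff_mu k G).mul (σ.contDiff_f1 k))
  s12 := σ.s12.add ((σ.contDiff_mu k G).mul (σ.contDiff_f2 k))
  s21 := σ.s21.sub (contDiff_const.mul ((σ.contDiff_mu k G).mul (σ.contDiff_f1 k)))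
  s22 := σ.s22.sub (contDiff_const.mul ((σ.contDiff_mu k G).mul (σ.contDiff_f2 k)))
  i11 := by simp [mu_one, σ.i11]
  i12 := by simp [mu_one, σ.i12]
  i21 := by simp [mu_one, σ.i21]
  i22 := by simp [mu_one, σ.i22]
  cross := fun t => by
    have := σ.cross t
    simp only [f1, f2]
    linear_combination this
  d11 := fun t => by
    refine ((σ.hd11 t).add ((σ.hasDerivAt_mu k G t).mul (σ.hasDerivAt_f1 k t))).deriv.trans ?_
    have := σ.cross_f k t
    linear_combination (σ.shear k G t * σ.f1 k t) * (-this)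
  d12 := fun t => by
    refine ((σ.hd12 t).add ((σ.hasDerivAt_mu k G t).mul (σ.hasDerivAt_f2 k t))).deriv.trans ?_
    have := σ.cross_f k t
    linear_combination (σ.shear k G t * σ.f2 k t) * (-this)
  d21 := fun t => by
    refine ((σ.hd21 t).sub (((σ.hasDerivAt_mu k G t).mul (σ.hasDerivAt_f1 k t)).const_mul k)).deriv.trans ?_
    have : σ.f1 k t * σ.X22 t - σ.f2 k t * σ.X21 t = k := by
      have := σ.cross t
      simp only [f1, f2]; linear_combination k * this
    linear_combination (σ.shear k G t * σ.f1 k t) * (this)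
  d22 := fun t => by
    refine ((σ.hd22 t).sub (((σ.hasDerivAt_mu k G t).mul (σ.hasDerivAt_f2 k t)).const_mul k)).deriv.trans ?_
    have : σ.f1 k t * σ.X22 t - σ.f2 k t * σ.X21 t = k := by
      have := σ.cross t
      simp only [f1, f2]; linear_combination k * this
    linear_combination (σ.shear k G t * σ.f2 k t) * (this)

/-- Components of the density gradient. -/
def p1 (t : ℝ) : ℝ := σ.P1 * σ.X11 t + σ.P2 * σ.X21 t
/-- Components of the density gradient. -/
def p2 (t : ℝ) : ℝ := σ.P1 * σ.X12 t + σ.P2 * σ.X22 t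

theorem step_p1 (t : ℝ) : (σ.step k G).p1 t = σ.p1 t + σ.amp k G t * σ.f1 k t := by
  have := σ.amp_add k G t
  simp only [p1, step, f1, W] at *
  linear_combination -(k * σ.X11 t + σ.X21 t) * this

theorem step_p2 (t : ℝ) : (σ.step k G).p2 t = σ.p2 t + σ.amp k G t * σ.f2 k t := by
  have := σ.amp_add k G t
  simp only [p2, step, f2, W] at *
  linear_combination -(k * σ.X12 t + σ.X22 t) * this

theorem p1_eq (t : ℝ) : σ.p1 t = σ.P2 * σ.f1 k t + σ.W k * -σ.X11 t := by
  simp only [p1, f1, W]; ring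

theorem p2_eq (t : ℝ) : σ.p2 t = σ.P2 * σ.f2 k t + σ.W k * -σ.X12 t := by
  simp only [p2, f2, W]; ring

end St

/-! ### Quantitative control of one step -/

namespace St

/-- Bounds for a state on `[1 - h, 1]`. -/
structure Inv (σ : St) (g h : ℝ) : Prop where
  b11 : ∀ t ∈ Icc (1 - h) 1, |deriv σ.X11 t| ≤ g
  b12 : ∀ t ∈ Icc (1 - h) 1, |deriv σ.X12 t| ≤ g
  b21 : ∀ t ∈ Icc (1 - h) 1, |deriv σ.X21 t| ≤ g
  b22 : ∀ t ∈ Icc (1 - h) 1, |deriv σ.X22 t| ≤ g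
  bP1 : |σ.P1| ≤ g
  bP2 : |σ.P2| ≤ g

/-- Compatibility of the parameters of one step. -/
structure Par (g h G τ β s : ℝ) : Prop where
  one_le : 1 ≤ g
  β_pos : 0 < β
  β_le : 2 * β ≤ h
  τ_pos : 0 < τ
  τ_le : τ ≤ 1 / 1000
  hG : G * (β * τ ^ 2) = 1
  gβ : g * β ≤ τ ^ 4
  gτ : g * τ ≤ 1 / 8
  hs : s = 1 ∨ s = -1

theorem abs_sub_le_of_deriv {f : ℝ → ℝ} (hf : ContDiff ℝ (⊤ : ℕ∞) f) {t C : ℝ} (ht : t ≤ 1)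
    (h : ∀ u ∈ Icc t 1, |deriv f u| ≤ C) : |f t - f 1| ≤ C * (1 - t) := by
  have := (convex_Icc t 1).norm_image_sub_le_of_norm_deriv_le (f := f) (C := C)
    (fun x _ => hf.differentiable (by simp) x) h (right_mem_Icc.2 ht) (left_mem_Icc.2 ht)
  rwa [norm_eq_abs, norm_eq_abs, abs_sub_comm t, abs_of_nonneg (by linarith : 0 ≤ 1 - t)] at this

variable {σ : St} {g h G τ β s t : ℝ}

section
variable (H : Par g h G τ β s)
include H

theorem Par.G_pos : 0 < G := by
  have := H.hG
  have h1 : 0 < β * τ ^ 2 := mul_pos H.β_pos (pow_pos H.τ_pos 2)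
  by_contra h
  nlinarith

theorem Par.abs_s : |s| = 1 := by rcases H.hs with h | h <;> simp [h]

theorem Par.sq_s : s * s = 1 := by rcases H.hs with h | h <;> simp [h]

theorem Par.β_le_τ : β ≤ τ ^ 4 := by nlinarith [H.gβ, H.one_le, H.β_pos]

theorem Par.τ4 : τ ^ 4 ≤ τ ^ 3 / 1000 := by
  have := pow_pos H.τ_pos 3
  nlinarith [H.τ_le]

theorem Par.τ3 : τ ^ 3 ≤ τ ^ 2 / 1000 := by
  have := pow_pos H.τ_pos 2
  nlinarith [H.τ_le]

theorem Par.τ2 : τ ^ 2 ≤ τ / 1000 := by nlinarith [H.τ_le, H.τ_pos]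

theorem Par.gb (ht : t ∈ Icc (1 - 2 * β) 1) : 0 ≤ g * (1 - t) ∧ g * (1 - t) ≤ 2 * τ ^ 4 := by
  have := H.gβ
  have := H.one_le
  constructor
  · exact mul_nonneg (by linarith) (by linarith [ht.2])
  · have : g * (1 - t) ≤ g * (2 * β) := by
      have := ht.1
      gcongr; linarith
    linarith
end

theorem Inv.X (hI : Inv σ g h) (H : Par g h G τ β s) (ht : t ∈ Icc (1 - 2 * β) 1) :
    |σ.X11 t - 1| ≤ g * (1 - t) ∧ |σ.X12 t| ≤ g * (1 - t) ∧ |σ.X21 t| ≤ g * (1 - t) ∧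
    |σ.X22 t - 1| ≤ g * (1 - t) := by
  have hs : ∀ u ∈ Icc t 1, u ∈ Icc (1 - h) 1 := fun u hu =>
    ⟨by linarith [hu.1, ht.1, H.β_le], hu.2⟩
  have h1 := abs_sub_le_of_deriv σ.s11 ht.2 fun u hu => hI.b11 u (hs u hu)
  have h2 := abs_sub_le_of_deriv σ.s12 ht.2 fun u hu => hI.b12 u (hs u hu)
  have h3 := abs_sub_le_of_deriv σ.s21 ht.2 fun u hu => hI.b21 u (hs u hu)
  have h4 := abs_sub_le_of_deriv σ.s22 ht.2 fun u hu => hI.b22 u (hs u hu)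
  rw [σ.i11] at h1
  rw [σ.i12, sub_zero] at h2
  rw [σ.i21, sub_zero] at h3
  rw [σ.i22] at h4
  exact ⟨h1, h2, h3, h4⟩

theorem Inv.f (hI : Inv σ g h) (H : Par g h G τ β s) (ht : t ∈ Icc (1 - 2 * β) 1) :
    |σ.f1 (s * τ) t - s * τ| ≤ 2 * (g * (1 - t)) ∧ |σ.f2 (s * τ) t - 1| ≤ 2 * (g * (1 - t)) := by
  obtain ⟨h1, h2, h3, h4⟩ := hI.X H ht
  have hk : |s * τ| ≤ 1 := by
    rw [abs_mul, H.abs_s, abs_of_pos H.τ_pos]; linarith [H.τ_le]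
  constructor
  · rw [show σ.f1 (s * τ) t - s * τ = s * τ * (σ.X11 t - 1) + σ.X21 t by simp only [f1]; ring]
    refine (abs_add_le _ _).trans ?_
    rw [abs_mul]
    nlinarith [abs_nonneg (s * τ), abs_nonneg (σ.X11 t - 1)]
  · rw [show σ.f2 (s * τ) t - 1 = s * τ * σ.X12 t + (σ.X22 t - 1) by simp only [f2]; ring]
    refine (abs_add_le _ _).trans ?_
    rw [abs_mul]
    nlinarith [abs_nonneg (s * τ), abs_nonneg (σ.X12 t)]

theorem Inv.f' (hI : Inv σ g h) (H : Par g h G τ β s) (ht : t ∈ Icc (1 - 2 * β) 1) :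
    |σ.f1 (s * τ) t - s * τ| ≤ 4 * τ ^ 4 ∧ |σ.f1 (s * τ) t| ≤ 2 * τ ∧
    |σ.f2 (s * τ) t - 1| ≤ 4 * τ ^ 4 ∧ |σ.Q (s * τ) t - 1| ≤ 5 * τ ^ 2 ∧ |σ.W (s * τ)| ≤ 2 * g := by
  obtain ⟨h1, h2⟩ := hI.f H ht
  have h3 := H.gb ht
  have h4 := H.τ4
  have h5 := H.τ3
  have h6 := H.τ2
  have h7 := H.τ_pos
  have h8 := H.τ_le
  have hk : |s * τ| = τ := by rw [abs_mul, H.abs_s, abs_of_pos H.τ_pos, one_mul]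
  have a1 : |σ.f1 (s * τ) t - s * τ| ≤ 4 * τ ^ 4 := by linarith
  have a2 : |σ.f1 (s * τ) t| ≤ 2 * τ := by
    have := abs_sub_abs_le_abs_sub (σ.f1 (s * τ) t) (s * τ)
    linarith
  have a3 : |σ.f2 (s * τ) t - 1| ≤ 4 * τ ^ 4 := by linarith
  refine ⟨a1, a2, a3, ?_, ?_⟩
  · rw [show σ.Q (s * τ) t - 1 = σ.f1 (s * τ) t ^ 2 + (σ.f2 (s * τ) t - 1) *
      ((σ.f2 (s * τ) t - 1) + 2) by simp only [Q]; ring]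
    refine (abs_add_le _ _).trans ?_
    rw [abs_pow, abs_mul]
    have b1 : |σ.f2 (s * τ) t - 1 + 2| ≤ 3 := by
      refine (abs_add_le _ _).trans ?_
      rw [abs_two]; linarith
    have b2 : |σ.f1 (s * τ) t| ^ 2 ≤ (2 * τ) ^ 2 := by gcongr
    nlinarith [abs_nonneg (σ.f2 (s * τ) t - 1)]
  · refine (abs_sub _ _).trans ?_
    rw [abs_mul, hk]
    nlinarith [hI.bP1, hI.bP2, abs_nonneg σ.P2]

theorem Inv.rate (hI : Inv σ g h) (H : Par g h G τ β s) (ht : t ∈ Icc (1 - 2 * β) 1) :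
    |σ.rate (s * τ) t| ≤ 1 := by
  obtain ⟨-, h1, -, h2, h3⟩ := hI.f' H ht
  have h6 := H.τ2
  have h7 := H.τ_pos
  have h8 := H.τ_le
  have h9 := H.gτ
  rw [St.rate, abs_div, abs_mul, abs_of_pos (σ.Q_pos _ t), div_le_one (σ.Q_pos _ t)]
  have := abs_le.1 h2
  have : |σ.W (s * τ)| * |σ.f1 (s * τ) t| ≤ 2 * g * (2 * τ) := by
    have := H.one_le
    gcongr
  nlinarith

theorem abs_tint_le {f : ℝ → ℝ} {C : ℝ} (ht : t ≤ 1) (h : ∀ u ∈ Icc t 1, |f u| ≤ C) :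
    |∫ u in t..1, f u| ≤ C * (1 - t) := by
  have := intervalIntegral.norm_integral_le_of_norm_le_const (a := t) (b := 1) (f := f)
    (C := C) fun u hu => by
      rw [uIoc_of_le ht] at hu
      exact h u ⟨hu.1.le, hu.2⟩
  rwa [norm_eq_abs, abs_of_nonneg (by linarith : 0 ≤ 1 - t)] at this

theorem Inv.amp (hI : Inv σ g h) (H : Par g h G τ β s) (ht : t ∈ Icc (1 - 2 * β) 1) :
    |σ.amp (s * τ) G t - G| ≤ 2 * (1 - t) * G := by
  have h1 := abs_tint_le ht.2 fun u (hu : u ∈ Icc t 1) => hI.rate H (t := u) ⟨ht.1.trans hu.1, hu.2⟩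
  have hb : β ≤ 1 / 1000 := by linarith [H.β_le_τ, H.τ4, H.τ3, H.τ2, H.τ_le, H.τ_pos]
  rw [one_mul, ← abs_neg] at h1
  have h2 := Real.abs_exp_sub_one_le (h1.trans (by linarith [ht.1]))
  rw [St.amp, show ∀ x : ℝ, G * x - G = (x - 1) * G from fun x => by ring, abs_mul,
    abs_of_pos H.G_pos]
  have := H.G_pos
  gcongr
  linarith

theorem Inv.shear (hI : Inv σ g h) (H : Par g h G τ β s) (ht : t ∈ Icc (1 - 2 * β) 1) :
    |σ.shear (s * τ) G t + s * τ * G| ≤ 11 * (G * τ ^ 3) := by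
  obtain ⟨h0, h1, -, h2, h3⟩ := hI.f' H ht
  have h4 := hI.amp H ht
  have hQ := σ.Q_pos (s * τ) t
  have hG := H.G_pos
  have h5 := H.τ_pos
  have h6 := H.τ2
  have h8 := H.τ_le
  have hk : |s * τ| = τ := by rw [abs_mul, H.abs_s, abs_of_pos H.τ_pos, one_mul]
  have hQ2 : 1 / 2 ≤ σ.Q (s * τ) t := by linarith [(abs_le.1 h2).1]
  have e : σ.shear (s * τ) G t + s * τ * G = -((σ.amp (s * τ) G t - G) * σ.f1 (s * τ) t +
      G * (σ.f1 (s * τ) t - s * τ) - G * (s * τ) * (σ.Q (s * τ) t - 1)) / σ.Q (s * τ) t := by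
    simp only [St.shear]; field_simp; ring
  rw [e, abs_div, abs_neg, abs_of_pos hQ, div_le_iff₀ hQ]
  have c1 : |(σ.amp (s * τ) G t - G) * σ.f1 (s * τ) t| ≤ 2 * (2 * τ ^ 4) * G * (2 * τ) := by
    rw [abs_mul]
    have : |σ.amp (s * τ) G t - G| ≤ 2 * (2 * τ ^ 4) * G := by
      refine h4.trans ?_
      have := ht.1
      have := H.β_le_τ
      gcongr; linarith
    gcongr
  have c2 : |G * (σ.f1 (s * τ) t - s * τ)| ≤ G * (4 * τ ^ 4) := by
    rw [abs_mul, abs_of_pos hG]; gcongr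
  have c3 : |G * (s * τ) * (σ.Q (s * τ) t - 1)| ≤ G * τ * (5 * τ ^ 2) := by
    rw [abs_mul, abs_mul, hk, abs_of_pos hG]; gcongr
  refine (abs_sub _ _).trans ((add_le_add (abs_add_le _ _) le_rfl).trans ?_)
  have d1 : G * τ ^ 4 ≤ G * τ ^ 3 / 1000 := by
    have := mul_le_mul_of_nonneg_left H.τ4 hG.le; linarith
  have d2 : G * τ ^ 5 ≤ G * τ ^ 3 / 1000 := by
    have : τ ^ 5 ≤ τ ^ 4 := pow_le_pow_of_le_one h5.le (by linarith) (by norm_num)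
    have := mul_le_mul_of_nonneg_left this hG.le; linarith
  have d3 : 0 < G * τ ^ 3 := by positivity
  nlinarith

theorem Inv.mu (hI : Inv σ g h) (H : Par g h G τ β s) (ht : t ∈ Icc (1 - 2 * β) 1) :
    |σ.mu (s * τ) G t - s * τ * G * (1 - t)| ≤ 11 * (G * τ ^ 3) * (1 - t) := by
  have h1 := abs_tint_le ht.2 fun u (hu : u ∈ Icc t 1) =>
    hI.shear H (t := u) ⟨ht.1.trans hu.1, hu.2⟩
  have hc := (σ.contDiff_shear (s * τ) G).continuous
  rw [intervalIntegral.integral_add (hc.intervalIntegrable _ _) (by simp),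
    intervalIntegral.integral_const, smul_eq_mul] at h1
  rw [← abs_neg] at h1
  convert h1 using 2
  simp only [St.mu]; ring

/-- Sizes of the quantities after one step. -/
theorem Inv.sizes (hI : Inv σ g h) (H : Par g h G τ β s) (ht : t ∈ Icc (1 - 2 * β) 1) :
    |σ.mu (s * τ) G t| ≤ 3 / τ ∧ |σ.mu (s * τ) G t * (s * τ)| ≤ 3 ∧
    σ.amp (s * τ) G t ∈ Icc (G / 2) (2 * G) ∧
    1 / 2 ≤ σ.f2 (s * τ) t ∧ σ.f2 (s * τ) t ≤ 2 ∧ |σ.shear (s * τ) G t| ≤ G := by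
  obtain ⟨h0, h1, h1', h2, h3⟩ := hI.f' H ht
  have h4 := hI.amp H ht
  have hs := hI.shear H ht
  have hm := hI.mu H ht
  have hG := H.G_pos
  have h5 := H.τ_pos
  have h6 := H.τ2
  have h7 := H.τ3
  have h7' := H.τ4
  have h8 := H.τ_le
  have hk : |s * τ| = τ := by rw [abs_mul, H.abs_s, abs_of_pos H.τ_pos, one_mul]
  have hb : 1 - t ≤ 2 * β := by linarith [ht.1]
  have hb0 : 0 ≤ 1 - t := by linarith [ht.2]
  have hbb := H.β_le_τ
  have m1 : |σ.mu (s * τ) G t| ≤ 3 / τ := by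
    have e1 : G * τ * (1 - t) ≤ 2 / τ := by
      rw [le_div_iff₀ h5]
      calc G * τ * (1 - t) * τ ≤ G * τ * (2 * β) * τ := by gcongr
        _ = 2 * (G * (β * τ ^ 2)) := by ring
        _ = 2 := by rw [H.hG]; norm_num
    have e2 : 11 * (G * τ ^ 3) * (1 - t) ≤ G * τ * (1 - t) / 2 := by
      have : 0 ≤ G * τ * (1 - t) := by positivity
      nlinarith
    have e3 : |s * τ * G * (1 - t)| = G * τ * (1 - t) := by
      rw [abs_mul, abs_mul, hk, abs_of_pos hG, abs_of_nonneg hb0]; ring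
    have := abs_sub_abs_le_abs_sub (σ.mu (s * τ) G t) (s * τ * G * (1 - t))
    rw [show (3 : ℝ) / τ = 2 / τ + 2 / τ / 2 by ring]
    linarith
  refine ⟨m1, ?_, ?_, ?_, ?_, ?_⟩
  · rw [abs_mul, hk]
    calc _ ≤ 3 / τ * τ := by gcongr
      _ = 3 := by field_simp
  · have := abs_le.1 h4
    constructor <;> nlinarith
  · linarith [(abs_le.1 h1').1]
  · linarith [(abs_le.1 h1').2]
  · have e3 : |s * τ * G| = τ * G := by rw [abs_mul, hk, abs_of_pos hG]
    have := abs_sub_abs_le_abs_sub (σ.shear (s * τ) G t) (-(s * τ * G))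
    rw [sub_neg_eq_add, abs_neg] at this
    nlinarith

end St

namespace St

variable {σ : St} {g h G τ β s t τ' : ℝ}

theorem Par.g_le (H : Par g h G τ β s) : g ≤ G * τ ^ 6 := by
  have h1 := H.hG
  have h2 := mul_le_mul_of_nonneg_left H.gβ (mul_nonneg H.G_pos.le (sq_nonneg τ))
  calc g = g * (G * (β * τ ^ 2)) := by rw [h1, mul_one]
    _ = G * τ ^ 2 * (g * β) := by ring
    _ ≤ _ := h2.trans (le_of_eq (by ring))

theorem Par.pow_le (H : Par g h G τ β s) {n m : ℕ} (hnm : n ≤ m) : G * τ ^ m ≤ G * τ ^ n := by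
  have := H.G_pos
  have := pow_le_pow_of_le_one H.τ_pos.le (by linarith [H.τ_le]) hnm
  gcongr

theorem Par.G_ge (H : Par g h G τ β s) : 1000 ≤ G := by
  have h1 := H.g_le
  have h2 := H.one_le
  have h3 : G * τ ^ 6 ≤ G * τ ^ 1 := H.pow_le (by norm_num)
  have := H.G_pos
  nlinarith [H.τ_le]

theorem Par.mul_le (H : Par g h G τ β s) : 3 / τ * (2 * g) ≤ G := by
  have h1 := H.g_le
  have h2 := H.τ_pos
  calc 3 / τ * (2 * g) ≤ 3 / τ * (2 * (G * τ ^ 6)) := by gcongr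
    _ = 6 * τ * (G * τ ^ 4) := by field_simp; ring
    _ ≤ 1 * (G * τ ^ 0) := by
      have := H.pow_le (show 0 ≤ 4 by norm_num)
      have := H.τ_le
      have := H.G_pos
      gcongr; linarith
    _ = G := by ring

theorem Inv.step (hI : Inv σ g h) (H : Par g h G τ β s) :
    Inv (σ.step (s * τ) G) (G ^ 2) (2 * β) := by
  have hk : |s * τ| = τ := by rw [abs_mul, H.abs_s, abs_of_pos H.τ_pos, one_mul]
  have hG := H.G_ge
  have hg : g ≤ G := H.g_le.trans ((H.pow_le (Nat.zero_le 6)).trans (by simp))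
  have h5 := H.τ_pos
  have h8 := H.τ_le
  have sub : ∀ t ∈ Icc (1 - 2 * β) 1, t ∈ Icc (1 - h) 1 := fun u hu =>
    ⟨by linarith [hu.1, H.β_le], hu.2⟩
  have df : ∀ {A B : ℝ → ℝ}, ContDiff ℝ (⊤ : ℕ∞) A → ContDiff ℝ (⊤ : ℕ∞) B →
      (∀ t ∈ Icc (1 - 2 * β) 1, |deriv A t| ≤ g) → (∀ t ∈ Icc (1 - 2 * β) 1, |deriv B t| ≤ g) →
      (∀ t ∈ Icc (1 - 2 * β) 1, |s * τ * A t + B t| ≤ 2) →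
      ∀ t ∈ Icc (1 - 2 * β) 1,
      |deriv (fun t => A t + σ.mu (s * τ) G t * (s * τ * A t + B t)) t| ≤ G ^ 2 ∧
      |deriv (fun t => B t - s * τ * (σ.mu (s * τ) G t * (s * τ * A t + B t))) t| ≤ G ^ 2 := by
    intro A B hA hB bA bB bf t ht
    have hA' := (hA.differentiable (by simp) t).hasDerivAt
    have hB' := (hB.differentiable (by simp) t).hasDerivAt
    have hf := (hA'.const_mul (s * τ)).add hB'
    have hm := (σ.hasDerivAt_mu (s * τ) G t).mul hf
    obtain ⟨m1, -, -, -, -, m2⟩ := hI.sizes H ht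
    have b1 := bA t ht
    have b2 := bB t ht
    have b3 := bf t ht
    have c1 : |s * τ * deriv A t + deriv B t| ≤ 2 * g := by
      refine (abs_add_le _ _).trans ?_
      rw [abs_mul, hk]
      nlinarith [abs_nonneg (deriv A t)]
    have c2 : |σ.shear (s * τ) G t * (s * τ * A t + B t) +
        σ.mu (s * τ) G t * (s * τ * deriv A t + deriv B t)| ≤ 3 * G := by
      refine (abs_add_le _ _).trans ?_
      rw [abs_mul, abs_mul]
      have e1 : |σ.shear (s * τ) G t| * |s * τ * A t + B t| ≤ G * 2 := by gcongr
      have e2 : |σ.mu (s * τ) G t| * |s * τ * deriv A t + deriv B t| ≤ 3 / τ * (2 * g) := by gcongr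
      linarith [H.mul_le]
    constructor
    · have := (hA'.add hm).deriv
      refine (congrArg abs this).trans_le ((abs_add_le _ _).trans ?_)
      have : |deriv A t| + 3 * G ≤ G ^ 2 := by nlinarith
      exact (add_le_add le_rfl c2).trans this
    · have := (hB'.sub (hm.const_mul (s * τ))).deriv
      refine (congrArg abs this).trans_le ((abs_sub _ _).trans ?_)
      rw [abs_mul, hk]
      have : |deriv B t| + τ * (3 * G) ≤ G ^ 2 := by nlinarith
      refine (add_le_add le_rfl (mul_le_mul_of_nonneg_left c2 h5.le)).trans this
  have hf1 : ∀ t ∈ Icc (1 - 2 * β) 1, |σ.f1 (s * τ) t| ≤ 2 := fun t ht => by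
    linarith [(hI.f' H ht).2.1]
  have hf2 : ∀ t ∈ Icc (1 - 2 * β) 1, |σ.f2 (s * τ) t| ≤ 2 := fun t ht => by
    obtain ⟨-, -, -, h1, h2, -⟩ := hI.sizes H ht
    rw [abs_of_nonneg] <;> linarith
  have D1 := df σ.s11 σ.s21 (fun t ht => hI.b11 t (sub t ht)) (fun t ht => hI.b21 t (sub t ht)) hf1
  have D2 := df σ.s12 σ.s22 (fun t ht => hI.b12 t (sub t ht)) (fun t ht => hI.b22 t (sub t ht)) hf2
  refine ⟨fun t ht => (D1 t ht).1, fun t ht => (D2 t ht).1, fun t ht => (D1 t ht).2,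
    fun t ht => (D2 t ht).2, ?_, ?_⟩
  · refine (abs_add_le _ _).trans ?_
    rw [abs_mul, hk, abs_of_pos H.G_pos]
    have := hI.bP1
    nlinarith
  · refine (abs_add_le _ _).trans ?_
    rw [abs_of_pos H.G_pos]
    have := hI.bP2
    nlinarith

theorem Inv.step_size (hI : Inv σ g h) (H : Par g h G τ β s) (ht : t ∈ Icc (1 - 2 * β) 1) :
    |(σ.step (s * τ) G).X11 t| ≤ 8 / τ ∧ |(σ.step (s * τ) G).X12 t| ≤ 8 / τ ∧
    |(σ.step (s * τ) G).X21 t| ≤ 8 / τ ∧ |(σ.step (s * τ) G).X22 t| ≤ 8 / τ ∧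
    G / 8 ≤ (σ.step (s * τ) G).p2 t := by
  obtain ⟨m1, m3, ⟨m4, m5⟩, f1, f2, m2⟩ := hI.sizes H ht
  obtain ⟨x1, x2, x3, x4⟩ := hI.X H ht
  have hf1 := (hI.f' H ht).2.1
  have hb := H.gb ht
  have h4 := H.τ4
  have h5 := H.τ3
  have h6 := H.τ2
  have h7 := H.τ_pos
  have h8 := H.τ_le
  have hτ : 1000 ≤ 1 / τ := by rw [le_div_iff₀ h7]; linarith
  have e : 8 / τ = 3 / τ * 2 + 2 * (1 / τ) := by ring
  have hf1' : |σ.f1 (s * τ) t| ≤ 2 := by linarith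
  have hf2' : |σ.f2 (s * τ) t| ≤ 2 := by rw [abs_of_nonneg] <;> linarith
  have y1 : |σ.mu (s * τ) G t * σ.f1 (s * τ) t| ≤ 3 / τ * 2 := by rw [abs_mul]; gcongr
  have y2 : |σ.mu (s * τ) G t * σ.f2 (s * τ) t| ≤ 3 / τ * 2 := by rw [abs_mul]; gcongr
  have z1 : |σ.X11 t| ≤ 2 := by
    have := abs_sub_abs_le_abs_sub (σ.X11 t) 1
    rw [abs_one] at this; linarith
  have z4 : |σ.X22 t| ≤ 2 := by
    have := abs_sub_abs_le_abs_sub (σ.X22 t) 1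
    rw [abs_one] at this; linarith
  have w1 : |s * τ * (σ.mu (s * τ) G t * σ.f1 (s * τ) t)| ≤ 3 * 2 := by
    rw [← mul_assoc, mul_comm (s * τ), abs_mul]; gcongr
  have w2 : |s * τ * (σ.mu (s * τ) G t * σ.f2 (s * τ) t)| ≤ 3 * 2 := by
    rw [← mul_assoc, mul_comm (s * τ), abs_mul]; gcongr
  refine ⟨(abs_add_le _ _).trans ?_, (abs_add_le _ _).trans ?_, (abs_sub _ _).trans ?_,
    (abs_sub _ _).trans ?_, ?_⟩
  · rw [e]; linarith
  · rw [e]; linarith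
  · have : 0 ≤ 3 / τ := by positivity
    rw [e]; linarith
  · have : 0 ≤ 3 / τ := by positivity
    rw [e]; linarith
  · rw [step_p2]
    have hg : g ≤ G * τ ^ 1 := H.g_le.trans (H.pow_le (by norm_num))
    have hG := H.G_ge
    have : |σ.p2 t| ≤ 4 * g := by
      refine (abs_add_le _ _).trans ?_
      rw [abs_mul, abs_mul]
      have : |σ.P1| * |σ.X12 t| ≤ g * 2 := by
        have := hI.bP1
        have : |σ.X12 t| ≤ 2 := by linarith
        have := H.one_le
        gcongr
      have : |σ.P2| * |σ.X22 t| ≤ g * 2 := by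
        have := hI.bP2
        have := H.one_le
        gcongr
      linarith
    have := (abs_le.1 this).1
    have : G / 2 * (1 / 2) ≤ σ.amp (s * τ) G t * σ.f2 (s * τ) t := by
      have := H.G_pos
      exact mul_le_mul m4 f1 (by norm_num) (by linarith)
    nlinarith

section next
variable (hI : Inv σ g h) (H : Par g h G τ β s) (hτ' : 0 < τ') (hττ : τ' ≤ τ ^ 2)
  (ht : t ∈ Icc (1 - 2 * β) 1)
include hI H hτ' hττ

theorem Inv.W_next : G * τ / 2 ≤ -(s * (σ.step (s * τ) G).W (-s * τ')) := by
  have e : -(s * (σ.step (s * τ) G).W (-s * τ')) = τ' * (σ.P2 + G) + s * σ.P1 + G * τ := by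
    simp only [W, St.step]
    linear_combination (τ' * (σ.P2 + G) + G * τ) * H.sq_s
  have hg : g ≤ G * τ ^ 2 := H.g_le.trans (H.pow_le (by norm_num))
  have h1 := abs_le.1 hI.bP2
  have h2 : |s * σ.P1| ≤ g := by rw [abs_mul, H.abs_s, one_mul]; exact hI.bP1
  have h2 := abs_le.1 h2
  have hG := H.G_pos
  have h6 := H.τ2
  have h7 := H.τ_pos
  have h8 := H.τ_le
  have h9 : G * τ ^ 2 ≤ G * τ / 1000 := by nlinarith
  have h10 : G * τ ≤ G := by nlinarith
  have : 0 ≤ τ' * (σ.P2 + G) := mul_nonneg hτ'.le (by nlinarith)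
  rw [e]; nlinarith

include ht

theorem Inv.f1_next : τ' / 2 + G * τ ^ 3 * (1 - t) / 8 ≤ -(s * (σ.step (s * τ) G).f1 (-s * τ') t) := by
  have e : -(s * (σ.step (s * τ) G).f1 (-s * τ') t) = -(s * σ.X21 t) + τ' * σ.X11 t +
      (s * σ.mu (s * τ) G t) * (τ + τ') * (s * σ.f1 (s * τ) t) := by
    simp only [St.step]
    rw [f1]
    linear_combination (τ' * σ.X11 t + τ' * σ.mu (s * τ) G t * σ.f1 (s * τ) t) * H.sq_s -
      σ.mu (s * τ) G t * σ.f1 (s * τ) t * τ' * H.sq_s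
  obtain ⟨x1, x2, x3, x4⟩ := hI.X H ht
  have hg : g ≤ G * τ ^ 4 := H.g_le.trans (H.pow_le (by norm_num))
  have hG := H.G_pos
  have h4 := H.τ4
  have h5 := H.τ3
  have h6 := H.τ2
  have h7 := H.τ_pos
  have h8 := H.τ_le
  have hb := H.gb ht
  have hb0 : 0 ≤ 1 - t := by linarith [ht.2]
  have a1 : |s * σ.X21 t| ≤ g * (1 - t) := by rwa [abs_mul, H.abs_s, one_mul]
  have a1' : g * (1 - t) ≤ G * τ ^ 3 * (1 - t) / 1000 := by
    have : G * τ ^ 4 ≤ G * (τ ^ 3 / 1000) := by gcongr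
    nlinarith
  have a2 : 1 / 2 ≤ σ.X11 t := by linarith [(abs_le.1 x1).1]
  have a3 : |s * σ.f1 (s * τ) t - τ| ≤ 4 * τ ^ 4 := by
    have := (hI.f' H ht).1
    have e : s * σ.f1 (s * τ) t - τ = s * (σ.f1 (s * τ) t - s * τ) := by
      linear_combination τ * H.sq_s
    rwa [e, abs_mul, H.abs_s, one_mul]
  have a4 : |s * σ.mu (s * τ) G t - τ * G * (1 - t)| ≤ 11 * (G * τ ^ 3) * (1 - t) := by
    have := hI.mu H ht
    have e : s * σ.mu (s * τ) G t - τ * G * (1 - t) =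
        s * (σ.mu (s * τ) G t - s * τ * G * (1 - t)) := by
      linear_combination τ * G * (1 - t) * H.sq_s
    rwa [e, abs_mul, H.abs_s, one_mul]
  have a5 : G * τ ^ 3 * (1 - t) ≤ τ * G * (1 - t) / 1000 := by
    have := mul_le_mul_of_nonneg_right h5 (mul_nonneg hG.le hb0)
    have := mul_le_mul_of_nonneg_right h6 (mul_nonneg hG.le hb0)
    have := mul_nonneg h7.le (mul_nonneg hG.le hb0)
    linarith
  have a6 : τ * G * (1 - t) / 2 ≤ s * σ.mu (s * τ) G t := by
    have : 0 ≤ τ * G * (1 - t) := by positivity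
    linarith [(abs_le.1 a4).1]
  have a7 : τ / 2 ≤ s * σ.f1 (s * τ) t := by linarith [(abs_le.1 a3).1]
  have a8 : τ * G * (1 - t) / 2 * τ * (τ / 2) ≤
      (s * σ.mu (s * τ) G t) * (τ + τ') * (s * σ.f1 (s * τ) t) := by
    have : 0 ≤ τ * G * (1 - t) / 2 := by positivity
    have : 0 ≤ s * σ.mu (s * τ) G t := this.trans a6
    gcongr
    linarith
  have a9 : τ' / 2 ≤ τ' * σ.X11 t := by nlinarith
  have a10 : 0 ≤ G * τ ^ 3 * (1 - t) := by positivity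
  rw [e]
  have e3 : τ * G * (1 - t) / 2 * τ * (τ / 2) = G * τ ^ 3 * (1 - t) / 4 := by ring
  rw [e3] at a8
  linarith [(abs_le.1 a1).2]

theorem Inv.rate_next_nonneg : 0 ≤ (σ.step (s * τ) G).rate (-s * τ') t := by
  have h1 := hI.W_next H hτ' hττ
  have h2 := hI.f1_next H hτ' hττ ht
  have hG := H.G_pos
  have h7 := H.τ_pos
  have hb0 : 0 ≤ 1 - t := by linarith [ht.2]
  refine div_nonneg ?_ (St.Q_pos _ _ _).le
  have e : (σ.step (s * τ) G).W (-s * τ') * (σ.step (s * τ) G).f1 (-s * τ') t =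
      -(s * (σ.step (s * τ) G).W (-s * τ')) * -(s * (σ.step (s * τ) G).f1 (-s * τ') t) := by
    linear_combination -((σ.step (s * τ) G).W (-s * τ') * (σ.step (s * τ) G).f1 (-s * τ') t) * H.sq_s
  rw [e]
  refine mul_nonneg (le_trans ?_ h1) (le_trans ?_ h2) <;> positivity

theorem Inv.rate_next (hb1 : β * (1 - τ) ≤ 1 - t) (hb2 : 1 - t ≤ β) :
    G / 2048 ≤ (σ.step (s * τ) G).rate (-s * τ') t := by
  have k1 := hI.W_next H hτ' hττ
  have k2 := hI.f1_next H hτ' hττ ht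
  obtain ⟨x1, x2, x3, x4⟩ := hI.X H ht
  have hmu := (hI.sizes H ht).1
  have hG := H.G_pos
  have h4 := H.τ4
  have h5 := H.τ3
  have h6 := H.τ2
  have h7 := H.τ_pos
  have h8 := H.τ_le
  have hb := H.gb ht
  have hb0 : 0 ≤ 1 - t := by linarith [ht.2]
  have B1 : 1 - τ ≤ G * τ ^ 2 * (1 - t) := by
    calc 1 - τ = G * (β * τ ^ 2) * (1 - τ) := by rw [H.hG]; ring
      _ = G * τ ^ 2 * (β * (1 - τ)) := by ring
      _ ≤ _ := by gcongr
  have B2 : G * τ ^ 2 * (1 - t) ≤ 1 := by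
    calc _ ≤ G * τ ^ 2 * β := by gcongr
      _ = 1 := by rw [← H.hG]; ring
  set q := σ.mu (s * τ) G t * (s * τ + s * τ') with hq
  have q1 : |q - 1| ≤ 5 * τ := by
    have e : q - 1 = s * τ * (σ.mu (s * τ) G t - s * τ * G * (1 - t)) + s * τ' * σ.mu (s * τ) G t +
        (G * τ ^ 2 * (1 - t) - 1) := by
      rw [hq]; linear_combination τ ^ 2 * G * (1 - t) * H.sq_s
    rw [e]
    have c1 : |s * τ * (σ.mu (s * τ) G t - s * τ * G * (1 - t))| ≤ 11 * τ ^ 2 := by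
      rw [abs_mul, abs_mul, H.abs_s, abs_of_pos h7, one_mul]
      calc _ ≤ τ * (11 * (G * τ ^ 3) * (1 - t)) := by gcongr; exact hI.mu H ht
        _ = 11 * τ ^ 2 * (G * τ ^ 2 * (1 - t)) := by ring
        _ ≤ 11 * τ ^ 2 * 1 := by gcongr
        _ = _ := mul_one _
    have c2 : |s * τ' * σ.mu (s * τ) G t| ≤ 3 * τ := by
      rw [abs_mul, abs_mul, H.abs_s, abs_of_pos hτ', one_mul]
      calc _ ≤ τ ^ 2 * (3 / τ) := by gcongr
        _ = 3 * τ := by field_simp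
    have c3 : |G * τ ^ 2 * (1 - t) - 1| ≤ τ := by rw [abs_le]; constructor <;> linarith
    refine (abs_add_le _ _).trans ((add_le_add (abs_add_le _ _) le_rfl).trans ?_)
    linarith
  have q2 : |q| ≤ 2 := by
    have := abs_sub_abs_le_abs_sub q 1
    rw [abs_one] at this; linarith
  have F1 : |(σ.step (s * τ) G).f1 (-s * τ') t| ≤ 5 * τ := by
    have e : (σ.step (s * τ) G).f1 (-s * τ') t =
        σ.X21 t - s * τ' * σ.X11 t - q * σ.f1 (s * τ) t := by
      rw [hq]; simp only [St.step]; rw [St.f1]; ring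
    rw [e]
    have c1 : |s * τ' * σ.X11 t| ≤ τ ^ 2 * 2 := by
      rw [abs_mul, abs_mul, H.abs_s, abs_of_pos hτ', one_mul]
      have : |σ.X11 t| ≤ 2 := by
        have := abs_sub_abs_le_abs_sub (σ.X11 t) 1
        rw [abs_one] at this; linarith
      gcongr
    have c2 : |q * σ.f1 (s * τ) t| ≤ 2 * (2 * τ) := by
      rw [abs_mul]
      have := (hI.f' H ht).2.1
      gcongr
    refine (abs_sub _ _).trans ((add_le_add (abs_sub _ _) le_rfl).trans ?_)
    linarith
  have F2 : |(σ.step (s * τ) G).f2 (-s * τ') t| ≤ 6 * τ := by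
    have e : (σ.step (s * τ) G).f2 (-s * τ') t =
        (σ.X22 t - 1) - s * τ' * σ.X12 t - q * (σ.f2 (s * τ) t - 1) - (q - 1) := by
      rw [hq]; simp only [St.step]; rw [St.f2]; ring
    rw [e]
    have c1 : |s * τ' * σ.X12 t| ≤ τ ^ 2 * 2 := by
      rw [abs_mul, abs_mul, H.abs_s, abs_of_pos hτ', one_mul]
      have : |σ.X12 t| ≤ 2 := by linarith
      gcongr
    have c2 : |q * (σ.f2 (s * τ) t - 1)| ≤ 2 * (4 * τ ^ 4) := by
      rw [abs_mul]
      have := (hI.f' H ht).2.2.1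
      gcongr
    refine (abs_sub _ _).trans ((add_le_add (abs_sub _ _) le_rfl).trans ?_)
    have := abs_sub (σ.X22 t - 1) (s * τ' * σ.X12 t)
    linarith
  have Q1 : (σ.step (s * τ) G).Q (-s * τ') t ≤ 64 * τ ^ 2 := by
    have a1 := sq_le_sq' (abs_le.1 F1).1 (abs_le.1 F1).2
    have a2 := sq_le_sq' (abs_le.1 F2).1 (abs_le.1 F2).2
    rw [St.Q]; nlinarith
  have e : (σ.step (s * τ) G).W (-s * τ') * (σ.step (s * τ) G).f1 (-s * τ') t =
      -(s * (σ.step (s * τ) G).W (-s * τ')) * -(s * (σ.step (s * τ) G).f1 (-s * τ') t) := by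
    linear_combination -((σ.step (s * τ) G).W (-s * τ') * (σ.step (s * τ) G).f1 (-s * τ') t) * H.sq_s
  rw [St.rate, e, le_div_iff₀ (St.Q_pos _ _ _)]
  have k3 : τ / 16 ≤ -(s * (σ.step (s * τ) G).f1 (-s * τ') t) := by
    have : G * τ ^ 3 * (1 - t) = τ * (G * τ ^ 2 * (1 - t)) := by ring
    rw [this] at k2
    nlinarith
  calc G / 2048 * (σ.step (s * τ) G).Q (-s * τ') t ≤ G / 2048 * (64 * τ ^ 2) := by gcongr
    _ = G * τ / 2 * (τ / 16) := by ring
    _ ≤ _ := mul_le_mul k1 k3 (by positivity) (le_trans (by positivity) k1)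

/-- The amplitude of the next layer. -/
theorem Inv.amp_next {G' : ℝ} (hG' : 0 ≤ G') :
    0 ≤ (σ.step (s * τ) G).amp (-s * τ') G' t ∧ (σ.step (s * τ) G).amp (-s * τ') G' t ≤ G' ∧
    (t ≤ 1 - β → (σ.step (s * τ) G).amp (-s * τ') G' t ≤ G' * exp (-(1 / (4096 * τ)))) := by
  have hc := ((σ.step (s * τ) G).contDiff_rate (-s * τ')).continuous
  have hint : ∀ a b, IntervalIntegrable ((σ.step (s * τ) G).rate (-s * τ')) volume a b :=
    fun a b => hc.intervalIntegrable a b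
  have h7 := H.τ_pos
  have h8 := H.τ_le
  have hβ := H.β_pos
  have nonneg : ∀ a b, 1 - 2 * β ≤ a → a ≤ b → b ≤ 1 →
      0 ≤ ∫ u in a..b, (σ.step (s * τ) G).rate (-s * τ') u := fun a b ha hab hb =>
    intervalIntegral.integral_nonneg hab fun u hu =>
      hI.rate_next_nonneg H hτ' hττ ⟨ha.trans hu.1, hu.2.trans hb⟩
  refine ⟨mul_nonneg hG' (exp_pos _).le, ?_, fun htβ => ?_⟩
  · refine mul_le_of_le_one_right hG' (exp_le_one_iff.2 ?_)
    linarith [nonneg t 1 ht.1 ht.2 le_rfl]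
  · refine mul_le_mul_of_nonneg_left (exp_le_exp.2 (neg_le_neg ?_)) hG'
    have e1 := intervalIntegral.integral_add_adjacent_intervals (hint t (1 - β)) (hint (1 - β) 1)
    have e2 := intervalIntegral.integral_add_adjacent_intervals (hint (1 - β) (1 - β * (1 - τ)))
      (hint (1 - β * (1 - τ)) 1)
    have hle : 1 - β ≤ 1 - β * (1 - τ) := by nlinarith
    have hle2 : 1 - β * (1 - τ) ≤ 1 := by nlinarith
    have n1 := nonneg t (1 - β) ht.1 htβ (by linarith)
    have n2 := nonneg (1 - β * (1 - τ)) 1 (by linarith) hle2 le_rfl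
    have n3 : (1 - β * (1 - τ) - (1 - β)) * (G / 2048) ≤
        ∫ u in (1 - β)..(1 - β * (1 - τ)), (σ.step (s * τ) G).rate (-s * τ') u := by
      have := intervalIntegral.integral_mono_on hle (by simp) (hint (1 - β) (1 - β * (1 - τ)))
        (f := fun _ => G / 2048) fun u hu => hI.rate_next H hτ' hττ (t := u)
          ⟨by linarith [hu.1], by linarith [hu.2]⟩ (by linarith [hu.2]) (by linarith [hu.1])
      rwa [intervalIntegral.integral_const, smul_eq_mul] at this
    have n4 : (1 - β * (1 - τ) - (1 - β)) * (G / 2048) = 1 / (2048 * τ) := by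
      have := H.hG
      field_simp
      linear_combination this
    have n5 : 1 / (4096 * τ) ≤ 1 / (2048 * τ) := by
      apply one_div_le_one_div_of_le <;> linarith
    linarith

end next

end St

/-! ### Passing to the limit in a sequence of potentials -/

/-- A sequence of space-time potentials whose limit generates the required solution. -/
structure Approx (Φ : ℕ → (ℝ × ℝ) × ℝ → ℝ) (T ρs c Lp g : ℕ → ℝ) (pt : ℕ → ℝ × ℝ) : Prop where
  smooth : ∀ n, ContDiff ℝ (⊤ : ℕ∞) (Φ n)
  Tlt : ∀ n, T n < 1
  Tmono : Monotone T
  Tlim : Tendsto T atTop (𝓝 1)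
  stat : ∀ n x t, t ≤ T n → Φ (n + 1) (x, t) = Φ n (x, t)
  base : ∀ x t, 1 / 2 ≤ ‖x‖ → Φ 0 (x, t) = 0
  supp : ∀ n x t, t ≤ 1 → ρs n ≤ ‖x‖ → Φ (n + 1) (x, t) = Φ n (x, t)
  rad : ∀ n, ρs n ≤ 1 / 2
  radlim : Tendsto ρs atTop (𝓝 0)
  src : ∀ K : ℕ, ∃ M : ℝ, ∀ n x t, t ∈ Icc (0 : ℝ) 1 → ∀ i j, i + j ≤ K →
    |ddMix i j (NN (Φ n)) (x, t)| ≤ M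
  dens : ∀ n x t, t ∈ Icc (0 : ℝ) 1 → |lap (Φ (n + 1)) (x, t) - lap (Φ n) (x, t)| ≤ c n
  csum : Summable c
  lip : ∀ n x y, |(lap (Φ (n + 1)) (x, 1) - lap (Φ n) (x, 1)) -
    (lap (Φ (n + 1)) (y, 1) - lap (Φ n) (y, 1))| ≤ Lp n * ‖x - y‖
  hsum : ∀ α ∈ Ioo (0 : ℝ) 1, Summable fun n => c n ^ (1 - α) * Lp n ^ α
  grow : ∀ n m, n ≤ m → ∀ t ∈ Ico (T n) 1, g n ≤ |dd e2 (lap (Φ m)) (pt n, t)|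
  glim : Tendsto g atTop atTop

open Classical in
/-- The potential obtained by gluing the sequence along the times `T`. -/
noncomputable def glue (Φ : ℕ → (ℝ × ℝ) × ℝ → ℝ) (T : ℕ → ℝ) : (ℝ × ℝ) × ℝ → ℝ := fun p =>
  if h : ∃ n, p.2 < T n then Φ (Nat.find h) p else 0

theorem lap_slice {φ ψ : (ℝ × ℝ) × ℝ → ℝ} (hφ : ContDiff ℝ (⊤ : ℕ∞) φ)
    (hψ : ContDiff ℝ (⊤ : ℕ∞) ψ) {x : ℝ × ℝ} {t : ℝ}
    (h : (fun y => φ (y, t)) =ᶠ[𝓝 x] fun y => ψ (y, t)) : lap φ (x, t) = lap ψ (x, t) := by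
  have key : ∀ {φ : (ℝ × ℝ) × ℝ → ℝ}, ContDiff ℝ (⊤ : ℕ∞) φ →
      lap φ (x, t) = pdMix 2 0 (fun y => φ (y, t)) x + pdMix 0 2 (fun y => φ (y, t)) x := by
    intro φ hφ
    rw [pdMix_slice hφ, pdMix_slice hφ]
    rfl
  rw [key hφ, key hψ]
  have e1 : ∀ {f g : ℝ × ℝ → ℝ}, f =ᶠ[𝓝 x] g → pd1 f =ᶠ[𝓝 x] pd1 g := by
    intro f g h
    filter_upwards [h.fderiv (𝕜 := ℝ)] with q hq
    simp [pd1, hq]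
  have e2 : ∀ {f g : ℝ × ℝ → ℝ}, f =ᶠ[𝓝 x] g → pd2 f =ᶠ[𝓝 x] pd2 g := by
    intro f g h
    filter_upwards [h.fderiv (𝕜 := ℝ)] with q hq
    simp [pd2, hq]
  congr 1
  · exact (e1 (e1 h)).eq_of_nhds
  · exact (e2 (e2 h)).eq_of_nhds

/-- Interpolation between a sup bound and a Lipschitz bound. -/
theorem abs_le_interp {d A B r α : ℝ} (hα : α ∈ Ioo (0 : ℝ) 1) (hd : 0 ≤ d) (hA : d ≤ 2 * A)
    (hr : 0 ≤ r) (hB : d ≤ B * r) (hB0 : 0 ≤ B) : d ≤ 2 * (A ^ (1 - α) * B ^ α) * r ^ α := by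
  have hA0 : 0 ≤ A := by linarith
  calc d = d ^ (1 - α) * d ^ α := by
        rw [← Real.rpow_add_of_nonneg hd (by linarith [hα.2]) hα.1.le]; simp
    _ ≤ (2 * A) ^ (1 - α) * (B * r) ^ α := by
        gcongr
        · linarith [hα.2]
        · exact hα.1.le
    _ = 2 ^ (1 - α) * (A ^ (1 - α) * B ^ α) * r ^ α := by
        rw [Real.mul_rpow (by norm_num) hA0, Real.mul_rpow hB0 hr]; ring
    _ ≤ 2 * (A ^ (1 - α) * B ^ α) * r ^ α := by
        gcongr
        calc (2 : ℝ) ^ (1 - α) ≤ 2 ^ (1 : ℝ) :=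
              Real.rpow_le_rpow_of_exponent_le (by norm_num) (by linarith [hα.1])
          _ = 2 := by simp

namespace Approx

variable {Φ : ℕ → (ℝ × ℝ) × ℝ → ℝ} {T ρs c Lp g : ℕ → ℝ} {pt : ℕ → ℝ × ℝ}
  (H : Approx Φ T ρs c Lp g pt)
include H

theorem eq_of_le {n m : ℕ} (hnm : n ≤ m) {x : ℝ × ℝ} {t : ℝ} (ht : t ≤ T n) :
    Φ m (x, t) = Φ n (x, t) := by
  induction m, hnm using Nat.le_induction with
  | base => rfl
  | succ m hm ih => rw [H.stat m x t (ht.trans (H.Tmono hm)), ih]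

theorem exists_T {t : ℝ} (ht : t < 1) (N : ℕ) : ∃ n, N ≤ n ∧ t < T n :=
  ((eventually_ge_atTop N).and (H.Tlim.eventually (lt_mem_nhds ht))).exists

theorem glue_eq {n : ℕ} {p : (ℝ × ℝ) × ℝ} (hp : p.2 < T n) : glue Φ T p = Φ n p := by
  classical
  have h : ∃ n, p.2 < T n := ⟨n, hp⟩
  rw [glue, dif_pos h]
  obtain ⟨x, t⟩ := p
  exact (H.eq_of_le (Nat.find_min' h hp) (Nat.find_spec h).le).symm

theorem glue_ev {n : ℕ} {p : (ℝ × ℝ) × ℝ} (hp : p.2 < T n) : glue Φ T =ᶠ[𝓝 p] Φ n := by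
  filter_upwards [(isOpen_lt continuous_snd continuous_const).mem_nhds hp] with q hq
  exact H.glue_eq hq

theorem zero_of_norm (n : ℕ) {x : ℝ × ℝ} {t : ℝ} (ht : t ≤ 1) (hx : 1 / 2 ≤ ‖x‖) :
    Φ n (x, t) = 0 := by
  induction n with
  | zero => exact H.base x t hx
  | succ n ih => rw [H.supp n x t ht ((H.rad n).trans hx), ih]

theorem glue_zero_ev {x : ℝ × ℝ} {t : ℝ} (ht : t < 1) (hx : 1 / 2 < ‖x‖) :
    glue Φ T =ᶠ[𝓝 (x, t)] fun _ => 0 := by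
  obtain ⟨n, -, hn⟩ := H.exists_T ht 0
  filter_upwards [H.glue_ev (p := (x, t)) hn,
    (isOpen_lt continuous_snd continuous_const).mem_nhds (show (x, t).2 < 1 from ht),
    (isOpen_lt continuous_const continuous_fst.norm).mem_nhds (show 1 / 2 < ‖(x, t).1‖ from hx)]
    with q h1 h2 h3
  rw [h1]
  exact H.zero_of_norm n (le_of_lt h2) (le_of_lt h3)

theorem lap_zero (n : ℕ) {x : ℝ × ℝ} {t : ℝ} (ht : t ≤ 1) (hx : 1 / 2 < ‖x‖) :
    lap (Φ n) (x, t) = 0 := by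
  rw [lap_slice (H.smooth n) (ψ := fun _ => 0) contDiff_const]
  · simp
  · filter_upwards [(isOpen_lt continuous_const continuous_norm).mem_nhds hx] with y hy
    exact H.zero_of_norm n ht (le_of_lt hy)

theorem lap_sub_le {n m : ℕ} (hnm : n ≤ m) {x : ℝ × ℝ} {t : ℝ} (ht : t ∈ Icc (0 : ℝ) 1) :
    |lap (Φ m) (x, t) - lap (Φ n) (x, t)| ≤ ∑ i ∈ Finset.Ico n m, c i := by
  induction m, hnm using Nat.le_induction with
  | base => simp
  | succ m hm ih =>
    rw [Finset.sum_Ico_succ_top hm]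
    calc _ = |(lap (Φ m) (x, t) - lap (Φ n) (x, t)) +
          (lap (Φ (m + 1)) (x, t) - lap (Φ m) (x, t))| := by ring_nf
      _ ≤ _ := (abs_add_le _ _).trans (add_le_add ih (H.dens m x t ht))

theorem c_nonneg (n : ℕ) : 0 ≤ c n :=
  (abs_nonneg _).trans (H.dens n 0 0 ⟨le_rfl, zero_le_one⟩)

theorem Lp_nonneg (n : ℕ) : 0 ≤ Lp n := by
  have := (abs_nonneg _).trans (H.lip n (1, 0) 0)
  simpa [Prod.norm_def] using this

/-- The final density. -/
theorem exists_limit : ∃ ρ₁ : ℝ × ℝ → ℝ, ∀ n x,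
    |(-lap (Φ n) (x, 1)) - ρ₁ x| ≤ ∑' i, c (i + n) := by
  have hs : ∀ x, Summable fun n => lap (Φ (n + 1)) (x, 1) - lap (Φ n) (x, 1) := fun x =>
    Summable.of_norm_bounded H.csum fun n => H.dens n x 1 ⟨zero_le_one, le_rfl⟩
  refine ⟨fun x => -(lap (Φ 0) (x, 1) + ∑' n, (lap (Φ (n + 1)) (x, 1) - lap (Φ n) (x, 1))), ?_⟩
  intro n x
  have h1 := (hs x).sum_add_tsum_nat_add n
  rw [Finset.sum_range_sub (fun n => lap (Φ n) (x, 1))] at h1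
  have h2 : -lap (Φ n) (x, 1) -
      -(lap (Φ 0) (x, 1) + ∑' n, (lap (Φ (n + 1)) (x, 1) - lap (Φ n) (x, 1))) =
      ∑' i, (lap (Φ (i + n + 1)) (x, 1) - lap (Φ (i + n)) (x, 1)) := by
    linarith
  rw [h2]
  exact tsum_of_norm_bounded (f := fun i => lap (Φ (i + n + 1)) (x, 1) - lap (Φ (i + n)) (x, 1))
    ((summable_nat_add_iff n).2 H.csum).hasSum fun i => H.dens (i + n) x 1 ⟨zero_le_one, le_rfl⟩

omit H in
theorem lap_tendsto {ρ₁ : ℝ × ℝ → ℝ}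
    (h : ∀ n x, |(-lap (Φ n) (x, 1)) - ρ₁ x| ≤ ∑' i, c (i + n)) (x : ℝ × ℝ) :
    Tendsto (fun n => -lap (Φ n) (x, 1)) atTop (𝓝 (ρ₁ x)) := by
  rw [tendsto_iff_norm_sub_tendsto_zero]
  exact squeeze_zero (fun _ => norm_nonneg _) (fun n => h n x) (tendsto_sum_nat_add c)

theorem limit_zero {ρ₁ : ℝ × ℝ → ℝ}
    (h : ∀ n x, |(-lap (Φ n) (x, 1)) - ρ₁ x| ≤ ∑' i, c (i + n)) {x : ℝ × ℝ}
    (hx : 1 / 2 < ‖x‖) : ρ₁ x = 0 := by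
  refine tendsto_nhds_unique (lap_tendsto h x) ?_
  simp [H.lap_zero _ le_rfl hx]

theorem limit_smooth {ρ₁ : ℝ × ℝ → ℝ}
    (h : ∀ n x, |(-lap (Φ n) (x, 1)) - ρ₁ x| ≤ ∑' i, c (i + n)) :
    ContDiffOn ℝ (⊤ : ℕ∞) ρ₁ {x : ℝ × ℝ | x ≠ 0} := by
  intro x hx
  have hx' : 0 < ‖x‖ / 2 := half_pos (norm_pos_iff.2 hx)
  obtain ⟨n, hn⟩ := eventually_atTop.1 (H.radlim.eventually (gt_mem_nhds hx'))
  have hU : ∀ᶠ y in 𝓝 x, ‖x‖ / 2 < ‖y‖ :=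
    (isOpen_lt continuous_const continuous_norm).mem_nhds
      (show ‖x‖ / 2 < ‖x‖ by linarith)
  have key : ∀ y, ‖x‖ / 2 < ‖y‖ → ∀ m, n ≤ m → lap (Φ m) (y, 1) = lap (Φ n) (y, 1) := by
    intro y hy m hm
    induction m, hm using Nat.le_induction with
    | base => rfl
    | succ m hm ih =>
      rw [← ih]
      refine lap_slice (H.smooth _) (H.smooth _) ?_
      filter_upwards [(isOpen_lt continuous_const continuous_norm).mem_nhds hy] with z hz
      exact H.supp m z 1 le_rfl (((hn m hm).trans hz).le)
  have hev : ρ₁ =ᶠ[𝓝 x] fun y => -lap (Φ n) (y, 1) := by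
    filter_upwards [hU] with y hy
    refine tendsto_nhds_unique (lap_tendsto h y) ?_
    refine tendsto_const_nhds.congr' ?_
    filter_upwards [eventually_ge_atTop n] with m hm
    rw [key y hy m hm]
  refine ContDiffAt.contDiffWithinAt ?_
  refine ContDiffAt.congr_of_eventuallyEq ?_ hev
  exact ((contDiff_lap (H.smooth n)).neg.comp (contDiff_prodMk_left (1 : ℝ))).contDiffAt

theorem unif {ρ₁ : ℝ × ℝ → ℝ}
    (h : ∀ n x, |(-lap (Φ n) (x, 1)) - ρ₁ x| ≤ ∑' i, c (i + n)) :
    TendstoUniformly (fun t (x : ℝ × ℝ) => -lap (glue Φ T) (x, t)) ρ₁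
      (nhdsWithin (1 : ℝ) (Iio 1)) := by
  rw [Metric.tendstoUniformly_iff]
  intro ε hε
  obtain ⟨N, hN⟩ := eventually_atTop.1 ((tendsto_sum_nat_add c).eventually (gt_mem_nhds (by positivity : 0 < ε / 3)))
  have hc : ContinuousOn (lap (Φ N)) (Metric.closedBall (0 : ℝ × ℝ) 1 ×ˢ Icc (0 : ℝ) 1) :=
    (contDiff_lap (H.smooth N)).continuous.continuousOn
  have hu := ((isCompact_closedBall (0 : ℝ × ℝ) 1).prod
    (isCompact_Icc (a := (0 : ℝ)) (b := 1))).uniformContinuousOn_of_continuous hc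
  rw [Metric.uniformContinuousOn_iff] at hu
  obtain ⟨d, hd, hu⟩ := hu (ε / 3) (by positivity)
  have hev : ∀ᶠ t in nhdsWithin (1 : ℝ) (Iio 1), t ∈ Ioo (max 0 (1 - d)) 1 :=
    Ioo_mem_nhdsLT (by simp [hd])
  filter_upwards [hev] with t ht x
  obtain ⟨m, hm, htm⟩ := H.exists_T ht.2 N
  have ht0 : 0 ≤ t := (le_max_left _ _).trans ht.1.le
  have ht1 : 1 - d < t := (le_max_right _ _).trans_lt ht.1
  have htI : t ∈ Icc (0 : ℝ) 1 := ⟨ht0, ht.2.le⟩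
  rw [dist_eq_norm, Real.norm_eq_abs]
  rw [(lap_congr (H.glue_ev (p := (x, t)) htm)).eq_of_nhds]
  have h1 := h N x
  have h2 : |lap (Φ m) (x, t) - lap (Φ N) (x, t)| < ε / 3 := by
    refine (H.lap_sub_le hm htI).trans_lt (lt_of_le_of_lt ?_ (hN N le_rfl))
    rw [Finset.sum_Ico_eq_sum_range]
    simp_rw [add_comm N]
    exact ((summable_nat_add_iff N).2 H.csum).sum_le_tsum _ fun i _ => H.c_nonneg _
  have h3 : |lap (Φ N) (x, t) - lap (Φ N) (x, 1)| < ε / 3 := by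
    by_cases hx : ‖x‖ ≤ 1
    · have := hu (x, t) ⟨by simpa using hx, htI⟩ (x, 1)
        ⟨by simpa using hx, zero_le_one, le_rfl⟩ ?_
      · simpa [Real.dist_eq] using this
      · rw [Prod.dist_eq]
        simp only [dist_self, Real.dist_eq, max_lt_iff, hd, true_and]
        rw [abs_lt]; constructor <;> linarith [ht.2]
    · push Not at hx
      rw [H.lap_zero N ht.2.le (by linarith), H.lap_zero N le_rfl (by linarith)]
      simpa using by positivity
  have hN' := hN N le_rfl
  rw [abs_lt] at h2 h3 ⊢
  rw [abs_le] at h1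
  constructor <;> linarith

theorem holder {ρ₁ : ℝ × ℝ → ℝ}
    (h : ∀ n x, |(-lap (Φ n) (x, 1)) - ρ₁ x| ≤ ∑' i, c (i + n)) {α : ℝ}
    (hα : α ∈ Ioo (0 : ℝ) 1) : ∃ C > 0, ∀ x y : ℝ × ℝ,
      |ρ₁ x - ρ₁ y| ≤ C * Real.sqrt ((x.1 - y.1) ^ 2 + (x.2 - y.2) ^ 2) ^ α := by
  have hsm : ContDiff ℝ (⊤ : ℕ∞) fun x => lap (Φ 0) (x, 1) :=
    (contDiff_lap (H.smooth 0)).comp (contDiff_prodMk_left (1 : ℝ))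
  have hcs : HasCompactSupport fun x => lap (Φ 0) (x, 1) := by
    refine HasCompactSupport.intro (isCompact_closedBall (0 : ℝ × ℝ) 1) fun x hx => ?_
    refine H.lap_zero 0 le_rfl ?_
    simp at hx; linarith
  obtain ⟨C0, hC0⟩ := (hsm.of_le (m := 1) (by exact_mod_cast le_top)).lipschitzWith_of_hasCompactSupport hcs (by simp)
  obtain ⟨B0, hB0⟩ := hcs.exists_bound_of_continuous hsm.continuous
  have hB0' : 0 ≤ B0 := (norm_nonneg _).trans (hB0 0)
  set b : ℕ → ℝ := fun n => 2 * (c n ^ (1 - α) * Lp n ^ α) with hb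
  have hbs : Summable b := (H.hsum α hα).mul_left 2
  have hbn : ∀ n, 0 ≤ b n := fun n => by
    have := H.c_nonneg n; have := H.Lp_nonneg n; simp only [hb]; positivity
  set B := 2 * (B0 ^ (1 - α) * (C0 : ℝ) ^ α)
  have step : ∀ n x y, |lap (Φ n) (x, 1) - lap (Φ n) (y, 1)| ≤
      (B + ∑ i ∈ Finset.range n, b i) * ‖x - y‖ ^ α := by
    intro n x y
    induction n with
    | zero =>
      simp only [Finset.range_zero, Finset.sum_empty, add_zero]
      refine abs_le_interp hα (abs_nonneg _) ?_ (norm_nonneg _) ?_ C0.2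
      · have := hB0 x; have := hB0 y; simp only [Real.norm_eq_abs] at *
        linarith [abs_sub (lap (Φ 0) (x, 1)) (lap (Φ 0) (y, 1))]
      · have := hC0.dist_le_mul x y
        rwa [Real.dist_eq, dist_eq_norm] at this
    | succ n ih =>
      rw [Finset.sum_range_succ]
      have h1 := H.lip n x y
      have h2 := H.dens n x 1 ⟨zero_le_one, le_rfl⟩
      have h3 := H.dens n y 1 ⟨zero_le_one, le_rfl⟩
      have := abs_le_interp hα (abs_nonneg _)
        ((abs_sub _ _).trans (by linarith : _ ≤ 2 * c n)) (norm_nonneg _) h1 (H.Lp_nonneg n)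
      calc _ = |(lap (Φ n) (x, 1) - lap (Φ n) (y, 1)) +
            ((lap (Φ (n + 1)) (x, 1) - lap (Φ n) (x, 1)) -
              (lap (Φ (n + 1)) (y, 1) - lap (Φ n) (y, 1)))| := by ring_nf
        _ ≤ _ := (abs_add_le _ _).trans (add_le_add ih this)
        _ = _ := by ring
  have hBn : 0 ≤ B := by positivity
  have hbt : 0 ≤ ∑' i, b i := tsum_nonneg hbn
  refine ⟨B + ∑' i, b i + 1, by positivity, fun x y => ?_⟩
  have hn : ‖x - y‖ ≤ Real.sqrt ((x.1 - y.1) ^ 2 + (x.2 - y.2) ^ 2) := by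
    rw [Prod.norm_def, max_le_iff]
    constructor
    · exact Real.le_sqrt_of_sq_le (by simp; positivity)
    · exact Real.le_sqrt_of_sq_le (by simp; positivity)
  have hlim := ((lap_tendsto h x).sub (lap_tendsto h y)).abs
  refine le_of_tendsto hlim (Eventually.of_forall fun n => ?_)
  have hs := hbs.sum_le_tsum (Finset.range n) fun i _ => hbn i
  calc |(-lap (Φ n) (x, 1)) - -lap (Φ n) (y, 1)| = |lap (Φ n) (x, 1) - lap (Φ n) (y, 1)| := by
        rw [← abs_neg]; ring_nf
    _ ≤ _ := step n x y
    _ ≤ (B + ∑' i, b i + 1) * Real.sqrt ((x.1 - y.1) ^ 2 + (x.2 - y.2) ^ 2) ^ α := by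
        refine mul_le_mul (by linarith) (Real.rpow_le_rpow (norm_nonneg _) hn hα.1.le) (by positivity)
          (by positivity)

theorem cont_glue {f : ((ℝ × ℝ) × ℝ → ℝ) → (ℝ × ℝ) × ℝ → ℝ}
    (hf : ∀ {φ}, ContDiff ℝ (⊤ : ℕ∞) φ → ContDiff ℝ (⊤ : ℕ∞) (f φ))
    (hc : ∀ {φ ψ p}, φ =ᶠ[𝓝 p] ψ → f φ =ᶠ[𝓝 p] f ψ) {x : ℝ × ℝ} {t : ℝ} (ht : t < 1) :
    ContDiffAt ℝ (⊤ : ℕ∞) (f (glue Φ T)) (x, t) := by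
  obtain ⟨n, -, hn⟩ := H.exists_T ht 0
  exact (hf (H.smooth n)).contDiffAt.congr_of_eventuallyEq (hc (H.glue_ev (p := (x, t)) hn))

theorem slice_glue {t : ℝ} (ht : t < 1) : ∃ n, ∀ f : ((ℝ × ℝ) × ℝ → ℝ) → (ℝ × ℝ) × ℝ → ℝ,
    (∀ {φ ψ p}, φ =ᶠ[𝓝 p] ψ → f φ =ᶠ[𝓝 p] f ψ) → ∀ x, f (glue Φ T) (x, t) = f (Φ n) (x, t) := by
  obtain ⟨n, -, hn⟩ := H.exists_T ht 0
  exact ⟨n, fun f hc x => (hc (H.glue_ev (p := (x, t)) hn)).eq_of_nhds⟩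

theorem slice_glue_ge {t : ℝ} (ht : t < 1) (N : ℕ) : ∃ n, N ≤ n ∧
    (fun x => -lap (glue Φ T) (x, t)) = fun x => -lap (Φ n) (x, t) := by
  obtain ⟨n, hN, hn⟩ := H.exists_T ht N
  exact ⟨n, hN, funext fun x => by rw [(lap_congr (H.glue_ev (p := (x, t)) hn)).eq_of_nhds]⟩

end Approx

theorem uniqueDiffOn_spaceTime : UniqueDiffOn ℝ spaceTime :=
  uniqueDiffOn_univ.prod (uniqueDiffOn_Ico 0 1)

theorem fderivWithin_spaceTime {E : Type*} [NormedAddCommGroup E] [NormedSpace ℝ E]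
    {f : (ℝ × ℝ) × ℝ → E} {p : (ℝ × ℝ) × ℝ}
    (hf : DifferentiableAt ℝ f p) (hp : p ∈ spaceTime) :
    fderivWithin ℝ f spaceTime p = fderiv ℝ f p :=
  hf.fderivWithin (uniqueDiffOn_spaceTime p hp)

theorem ckNorm_ge {f : ℝ × ℝ → ℝ} (hf : ContDiff ℝ (⊤ : ℕ∞) f) (hc : HasCompactSupport f)
    (x : ℝ × ℝ) : |pd2 f x| ≤ CkNorm 1 f := by
  have hfc : Continuous (fderiv ℝ f) := hf.continuous_fderiv (by simp)
  obtain ⟨B0, h0⟩ := hc.exists_bound_of_continuous hf.continuous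
  obtain ⟨B1, h1⟩ := (hc.fderiv_apply (𝕜 := ℝ) (1, 0)).exists_bound_of_continuous
    (hfc.clm_apply continuous_const)
  obtain ⟨B2, h2⟩ := (hc.fderiv_apply (𝕜 := ℝ) (0, 1)).exists_bound_of_continuous
    (hfc.clm_apply continuous_const)
  refine le_csSup ⟨max B0 (max B1 B2), ?_⟩ ⟨0, 1, x, le_rfl, rfl⟩
  rintro y ⟨i, j, z, hij, rfl⟩
  obtain ⟨rfl, rfl⟩ | ⟨rfl, rfl⟩ | ⟨rfl, rfl⟩ :
      (i = 0 ∧ j = 0) ∨ (i = 1 ∧ j = 0) ∨ (i = 0 ∧ j = 1) := by omega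
  · exact (h0 z).trans (le_max_left _ _)
  · exact (h1 z).trans ((le_max_left _ _).trans (le_max_right _ _))
  · exact (h2 z).trans ((le_max_right _ _).trans (le_max_right _ _))

theorem hasCompactSupport_of_norm {E : Type*} [Zero E] {f : ℝ × ℝ → E}
    (h : ∀ x, 1 / 2 < ‖x‖ → f x = 0) : HasCompactSupport f :=
  HasCompactSupport.intro (isCompact_closedBall (0 : ℝ × ℝ) (1 / 2)) fun x hx =>
    h x (by simpa using hx)

/-! ### Profiles -/

/-- A smooth cutoff. -/
noncomputable def cutoff (y : ℝ) : ℝ := smoothTransition (4 / 3 * (1 - y ^ 2))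

theorem contDiff_cutoff : ContDiff ℝ (⊤ : ℕ∞) cutoff :=
  smoothTransition.contDiff.comp (by fun_prop)

theorem cutoff_eq_zero {y : ℝ} (h : 1 ≤ |y|) : cutoff y = 0 := by
  refine smoothTransition.zero_of_nonpos ?_
  nlinarith [sq_abs y]

theorem cutoff_eq_one {y : ℝ} (h : |y| < 1 / 2) : cutoff y = 1 := by
  refine smoothTransition.one_of_one_le ?_
  nlinarith [sq_abs y, abs_nonneg y]

theorem cut_cutoff : Cut cutoff :=
  ⟨contDiff_cutoff, fun _ h => cutoff_eq_zero h.le, 1, fun _ h => cutoff_eq_one h⟩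

/-- A cubic profile as a function of the sine of the phase. -/
noncomputable def arcCube (y : ℝ) : ℝ := cutoff (2 * y) * (arcsin y ^ 3 / 6)

theorem contDiff_arcCube : ContDiff ℝ (⊤ : ℕ∞) arcCube := by
  rw [contDiff_iff_contDiffAt]
  intro y
  rcases lt_or_ge |y| 1 with h | h
  · have h' := abs_lt.1 h
    have h1 : ContDiffAt ℝ (⊤ : ℕ∞) arcsin y := contDiffAt_arcsin (by linarith) (by linarith)
    have h2 : ContDiffAt ℝ (⊤ : ℕ∞) (fun y => cutoff (2 * y)) y :=
      (contDiff_cutoff.comp (by fun_prop)).contDiffAt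
    exact h2.mul ((h1.pow 3).div_const 6)
  · refine (contDiffAt_const (c := (0 : ℝ))).congr_of_eventuallyEq ?_
    filter_upwards [(isOpen_lt_abs (1 / 2)).mem_nhds (show 1 / 2 < |y| by linarith)] with z hz
    rw [arcCube, cutoff_eq_zero, zero_mul]
    rw [abs_mul, abs_two]
    linarith [show 1 / 2 < |z| from hz]

/-- A periodic profile which is cubic near the origin. -/
noncomputable def wave (s : ℝ) : ℝ := arcCube (sin s)

theorem per_wave : Per wave :=
  ⟨contDiff_arcCube.comp contDiff_sin, fun s => by simp [wave]⟩

theorem wave_eq {s : ℝ} (h : |s| < 1 / 4) : wave s = s ^ 3 / 6 := by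
  have h1 := abs_sin_le_abs (x := s)
  have h2 := abs_lt.1 h
  have h3 := pi_gt_three
  rw [wave, arcCube, cutoff_eq_one, one_mul, arcsin_sin (by linarith) (by linarith)]
  rw [abs_mul, abs_two]; linarith

theorem exists_deriv_smoothTransition_le : ∃ C, ∀ x, |deriv smoothTransition x| ≤ C := by
  have h : HasCompactSupport (deriv smoothTransition) := by
    refine HasCompactSupport.intro (isCompact_Icc (a := (0 : ℝ)) (b := 1)) fun x hx => ?_
    rcases not_and_or.1 hx with h | h
    · exact Cut.deriv_eq isOpen_Iio (fun y (hy : y < 0) =>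
        smoothTransition.zero_of_nonpos hy.le) x (not_le.1 h)
    · exact Cut.deriv_eq isOpen_Ioi (fun y (hy : 1 < y) =>
        smoothTransition.one_of_one_le hy.le) x (not_le.1 h)
  exact h.exists_bound_of_continuous
    ((smoothTransition.contDiff (n := (⊤ : ℕ∞))).deriv_top).continuous

/-- Requirements on the large parameter. -/
def Big (C y : ℝ) : Prop :=
  1000 ≤ y ∧ C ≤ y ∧ y ^ 80 ≤ exp (y / 40) ∧ 8 * y ^ 7 * exp (3200 * log y ^ 2) ≤ exp y

theorem eventually_pow_le_exp (n : ℕ) {b : ℝ} (hb : 0 < b) :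
    ∀ᶠ y : ℝ in atTop, y ^ n ≤ exp (b * y) := by
  have := (isLittleO_pow_exp_pos_mul_atTop n hb).bound (one_pos)
  filter_upwards [this, eventually_ge_atTop 0] with y h1 h2
  rw [one_mul, norm_of_nonneg (by positivity), norm_of_nonneg (exp_pos _).le] at h1
  exact h1

theorem eventually_big (C : ℝ) : ∃ Y, ∀ y, Y ≤ y → Big C y := by
  rw [← eventually_atTop]
  have h1 := (isLittleO_pow_log_id_atTop (n := 2)).bound (show (0 : ℝ) < 1 / 6400 by norm_num)
  filter_upwards [eventually_ge_atTop 1000, eventually_ge_atTop C,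
    eventually_pow_le_exp 80 (show (0 : ℝ) < 1 / 40 by norm_num),
    eventually_pow_le_exp 8 (show (0 : ℝ) < 1 / 2 by norm_num), h1] with y h1 h2 h3 h4 h5
  refine ⟨h1, h2, by rwa [div_eq_inv_mul, ← one_div], ?_⟩
  rw [norm_of_nonneg (by positivity), id, norm_of_nonneg (by linarith)] at h5
  have e : exp y = exp (1 / 2 * y) * exp (1 / 2 * y) := by rw [← exp_add]; congr 1; ring
  rw [e]
  refine mul_le_mul (le_trans ?_ h4) (exp_le_exp.2 (by linarith)) (exp_pos _).le (exp_pos _).le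
  have : 0 ≤ y ^ 7 := by positivity
  nlinarith

theorem exists_slow_index {P : ℕ → ℕ → Prop} (h0 : ∀ n, P 0 n) (h : ∀ j, ∀ᶠ n in atTop, P j n) :
    ∃ J : ℕ → ℕ, (∀ n, P (J n) n) ∧ Tendsto J atTop atTop := by
  classical
  refine ⟨fun n => Nat.findGreatest (P · n) n, fun n =>
    Nat.findGreatest_spec (P := (P · n)) (Nat.zero_le n) (h0 n), tendsto_atTop.2 fun j => ?_⟩
  filter_upwards [h j, eventually_ge_atTop j] with n h1 h2
  exact Nat.le_findGreatest h2 h1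

/-- The final estimate of the errors. -/
theorem error_le {N J : ℕ} {y : ℝ} (hy : 4096 * (N + J + 5) ≤ y) :
    exp y ^ N * (exp (-y ^ 2) + (exp (-y ^ 2))⁻¹ ^ J * (exp y * exp (-(y ^ 3 / 4096)) * exp y)) ≤
      exp (-y) := by
  have hN : (0 : ℝ) ≤ N := Nat.cast_nonneg _
  have hJ : (0 : ℝ) ≤ J := Nat.cast_nonneg _
  have e1 : exp y ^ N * exp (-y ^ 2) = exp (N * y - y ^ 2) := by
    rw [← exp_nat_mul, ← exp_add]; congr 1
  have e2 : exp y ^ N * ((exp (-y ^ 2))⁻¹ ^ J * (exp y * exp (-(y ^ 3 / 4096)) * exp y)) =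
      exp (N * y + J * y ^ 2 + 2 * y - y ^ 3 / 4096) := by
    rw [← exp_neg, ← exp_nat_mul, ← exp_nat_mul, ← exp_add, ← exp_add, ← exp_add, ← exp_add]
    congr 1; ring
  have y1 : 1 ≤ y := by nlinarith
  have y2 : y ≤ y ^ 2 := by nlinarith
  have f1 : exp (N * y - y ^ 2) ≤ exp (-y - 1) := by
    rw [exp_le_exp]
    nlinarith
  have f2 : exp (N * y + J * y ^ 2 + 2 * y - y ^ 3 / 4096) ≤ exp (-y - 1) := by
    rw [exp_le_exp]
    have : (N + J + 5 : ℝ) * y ^ 2 ≤ y ^ 3 / 4096 := by nlinarith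
    nlinarith
  have f3 : exp (-y - 1) ≤ exp (-y) / 2 := by
    have : (2 : ℝ) ≤ exp 1 := by linarith [add_one_le_exp (1 : ℝ)]
    have e : exp (-y) = exp (-y - 1) * exp 1 := by rw [← exp_add]; congr 1; ring
    rw [e]
    nlinarith [exp_pos (-y - 1)]
  rw [mul_add, e1, e2]
  linarith

/-! ### The stages of the construction -/

/-- A state together with the parameter `y` and the sign `s` of the layer to be added. -/
structure Stage (C : ℝ) where
  (y s g h : ℝ)
  σ : St
  big : ∀ z, y ≤ z → Big C z
  one_le : 1 ≤ g
  g_le : g ≤ y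
  h_ge : 2 * (y ^ 34)⁻¹ ≤ h
  hs : s = 1 ∨ s = -1
  inv : σ.Inv g h

namespace Stage

variable {C : ℝ} (S : Stage C)

theorem y_ge : 1000 ≤ S.y := (S.big S.y le_rfl).1

theorem y_pos : 0 < S.y := by linarith [S.y_ge]

theorem C_le : C ≤ S.y := (S.big S.y le_rfl).2.1

theorem pow_le_exp_div : S.y ^ 80 ≤ exp (S.y / 40) := (S.big S.y le_rfl).2.2.1

theorem pow_mul_le_exp {n : ℕ} (hn : n ≤ 80) {c : ℝ} (hc : c ≤ 1000) : c * S.y ^ n ≤ exp S.y := by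
  have h1 : S.y ^ n ≤ exp (S.y / 40) :=
    (pow_le_pow_right₀ (by linarith [S.y_ge]) hn).trans S.pow_le_exp_div
  have h2 : c ≤ exp (S.y * (39 / 40)) := by
    have := add_one_le_exp (S.y * (39 / 40))
    have h3 : S.y ≤ S.y ^ 80 := le_self_pow₀ (by linarith [S.y_ge]) (by norm_num)
    have h4 : exp (S.y / 40) ≤ exp (S.y * (39 / 40)) := by
      rw [exp_le_exp]; linarith [S.y_pos]
    linarith [S.pow_le_exp_div, S.y_ge]
  have h5 : exp S.y = exp (S.y * (39 / 40)) * exp (S.y / 40) := by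
    rw [← exp_add]; congr 1; ring
  rw [h5]
  have := pow_pos S.y_pos n
  gcongr

/-- Amplitude of the layer. -/
def G : ℝ := S.y ^ 40
/-- Slope of the layer. -/
noncomputable def τ : ℝ := (S.y ^ 3)⁻¹
/-- Time scale of the layer. -/
noncomputable def β : ℝ := (S.y ^ 34)⁻¹
/-- Frequency vector of the layer. -/
noncomputable def k : ℝ := S.s * S.τ

theorem τ_pos : 0 < S.τ := inv_pos.2 (pow_pos S.y_pos 3)

theorem β_pos : 0 < S.β := inv_pos.2 (pow_pos S.y_pos 34)

theorem par : St.Par S.g S.h S.G S.τ S.β S.s where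
  one_le := S.one_le
  β_pos := S.β_pos
  β_le := S.h_ge
  τ_pos := S.τ_pos
  τ_le := by
    have := S.y_ge
    rw [τ, ← one_div]
    refine one_div_le_one_div_of_le (by norm_num) (this.trans ?_)
    exact le_self_pow₀ (by linarith) (by norm_num)
  hG := by
    have := S.y_pos
    rw [G, β, τ]; field_simp
  gβ := by
    have h0 := S.y_pos
    have h1 := S.y_ge
    calc S.g * S.β ≤ S.y * S.β := by have := S.β_pos; gcongr; exact S.g_le
      _ = (S.y ^ 33)⁻¹ := by rw [β]; field_simp
      _ ≤ (S.y ^ 12)⁻¹ := by gcongr <;> linarith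
      _ = _ := by rw [τ]; field_simp
  gτ := by
    have h0 := S.y_pos
    have h1 := S.y_ge
    calc S.g * S.τ ≤ S.y * S.τ := by have := S.τ_pos; gcongr; exact S.g_le
      _ = 1 / S.y ^ 2 := by rw [τ]; field_simp
      _ ≤ 1 / 8 := by
        refine one_div_le_one_div_of_le (by norm_num) ?_
        nlinarith
  hs := S.hs

theorem le_exp_div : S.y ≤ exp (S.y / 40) :=
  (le_self_pow₀ (by linarith [S.y_ge]) (by norm_num)).trans S.pow_le_exp_div

/-- The stage after adding the layer. -/
noncomputable def next : Stage C where
  y := exp (S.y / 40)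
  s := -S.s
  g := S.G ^ 2
  h := 2 * S.β
  σ := S.σ.step S.k S.G
  big := fun z hz => S.big z (S.le_exp_div.trans hz)
  one_le := one_le_pow₀ (one_le_pow₀ (by linarith [S.y_ge]))
  g_le := by rw [G, ← pow_mul]; exact S.pow_le_exp_div
  h_ge := by
    have := S.le_exp_div
    have := S.y_pos
    rw [β]
    gcongr
  hs := by rcases S.hs with h | h <;> simp [h]
  inv := S.inv.step S.par

theorem next_G : S.next.G = exp S.y := by
  rw [G, next, ← exp_nat_mul]; congr 1; push_cast; ring

theorem next_y_ge : S.y ^ 80 ≤ S.next.y := S.pow_le_exp_div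

theorem next_τ_le : S.next.τ ≤ S.τ ^ 2 := by
  have h0 := S.y_pos
  have h1 := S.next_y_ge
  have h2 := S.next.y_ge
  rw [τ, τ, inv_pow]
  gcongr
  calc (S.y ^ 3) ^ 2 = S.y ^ 6 := by ring
    _ ≤ S.y ^ 80 := by gcongr <;> linarith [S.y_ge]
    _ ≤ S.next.y := h1
    _ ≤ _ := le_self_pow₀ (by linarith) (by norm_num)

theorem next_β_le : S.next.β ≤ S.β / 1000 := by
  have h0 := S.y_pos
  have h1 := S.next_y_ge
  have h2 := S.next.y_ge
  rw [β, β, div_eq_mul_inv, ← mul_inv]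
  gcongr
  calc S.y ^ 34 * 1000 ≤ S.y ^ 34 * S.y := by gcongr; exact S.y_ge
    _ = S.y ^ 35 := by ring
    _ ≤ S.y ^ 80 := by gcongr <;> linarith [S.y_ge]
    _ ≤ S.next.y := h1
    _ ≤ _ := le_self_pow₀ (by linarith) (by norm_num)

theorem β_le : S.β ≤ 1 / 1000 := by
  rw [β, ← one_div]
  refine one_div_le_one_div_of_le (by norm_num) (S.y_ge.trans ?_)
  exact le_self_pow₀ (by linarith [S.y_ge]) (by norm_num)

theorem abs_k_le : |S.k| ≤ 1 := by
  rw [k, abs_mul, S.par.abs_s, one_mul, abs_of_pos S.τ_pos]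
  linarith [S.par.τ_le]

theorem amp_bounds {t : ℝ} (ht : t ∈ Icc (1 - 2 * S.β) 1) :
    0 ≤ S.next.σ.amp S.next.k S.next.G t ∧ S.next.σ.amp S.next.k S.next.G t ≤ exp S.y ∧
    (t ≤ 1 - S.β → S.next.σ.amp S.next.k S.next.G t ≤ exp S.y * exp (-(S.y ^ 3 / 4096))) := by
  have h0 : 0 ≤ S.next.G := by rw [next_G]; positivity
  obtain ⟨h1, h2, h3⟩ := S.inv.amp_next S.par S.next.τ_pos S.next_τ_le ht h0
  refine ⟨h1, h2.trans_eq S.next_G, fun h => (h3 h).trans_eq ?_⟩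
  have := S.y_pos
  rw [next_G, τ]
  congr 3
  field_simp

theorem size {t : ℝ} (ht : t ∈ Icc (1 - 2 * S.β) 1) :
    |S.next.σ.X11 t| ≤ 8 * S.y ^ 3 ∧ |S.next.σ.X12 t| ≤ 8 * S.y ^ 3 ∧
    |S.next.σ.X21 t| ≤ 8 * S.y ^ 3 ∧ |S.next.σ.X22 t| ≤ 8 * S.y ^ 3 ∧
    S.G / 8 ≤ S.next.σ.p2 t := by
  have := S.inv.step_size S.par ht
  simp only [τ, div_inv_eq_mul] at this
  exact this

theorem size_f {t : ℝ} (ht : t ∈ Icc (1 - 2 * S.β) 1) :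
    |S.next.σ.f1 S.next.k t| ≤ 16 * S.y ^ 3 ∧ |S.next.σ.f2 S.next.k t| ≤ 16 * S.y ^ 3 := by
  obtain ⟨h1, h2, h3, h4, -⟩ := S.size ht
  have hk := S.next.abs_k_le
  constructor
  · refine (abs_add_le _ _).trans ?_
    rw [abs_mul]
    nlinarith [abs_nonneg (S.next.σ.X11 t)]
  · refine (abs_add_le _ _).trans ?_
    rw [abs_mul]
    nlinarith [abs_nonneg (S.next.σ.X12 t)]

theorem size_f' {t : ℝ} (ht : t ∈ Icc (1 - 2 * S.β) 1) :
    |deriv (S.next.σ.f1 S.next.k) t| ≤ 2 * S.y ^ 80 ∧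
    |deriv (S.next.σ.f2 S.next.k) t| ≤ 2 * S.y ^ 80 := by
  have hg : S.next.g = S.y ^ 80 := by simp only [next, G]; rw [← pow_mul]
  have hk := S.next.abs_k_le
  have h11 := S.next.inv.b11 t ht
  have h12 := S.next.inv.b12 t ht
  have h21 := S.next.inv.b21 t ht
  have h22 := S.next.inv.b22 t ht
  rw [hg] at h11 h12 h21 h22
  have e1 : deriv (S.next.σ.f1 S.next.k) t =
      S.next.k * deriv S.next.σ.X11 t + deriv S.next.σ.X21 t := by
    rw [(S.next.σ.hasDerivAt_f1 S.next.k t).deriv, (S.next.σ.hd11 t).deriv, (S.next.σ.hd21 t).deriv]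
    simp only [St.f1, St.f2]; ring
  have e2 : deriv (S.next.σ.f2 S.next.k) t =
      S.next.k * deriv S.next.σ.X12 t + deriv S.next.σ.X22 t := by
    rw [(S.next.σ.hasDerivAt_f2 S.next.k t).deriv, (S.next.σ.hd12 t).deriv, (S.next.σ.hd22 t).deriv]
    simp only [St.f1, St.f2]; ring
  rw [e1, e2]
  constructor
  · refine (abs_add_le _ _).trans ?_
    rw [abs_mul]
    nlinarith [abs_nonneg (deriv S.next.σ.X11 t)]
  · refine (abs_add_le _ _).trans ?_
    rw [abs_mul]
    nlinarith [abs_nonneg (deriv S.next.σ.X12 t)]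

/-- Radius of the region where the stage is described by its state. -/
noncomputable def r : ℝ := exp (-(3200 * log S.y ^ 2))

theorem r_pos : 0 < S.r := exp_pos _

theorem next_r : S.next.r = exp (-(2 * S.y ^ 2)) := by
  rw [r, next, log_exp]; congr 1; ring

theorem r_le : S.r ≤ S.y⁻¹ := by
  have h1 : 1 ≤ log S.y := by
    rw [le_log_iff_exp_le S.y_pos]
    linarith [exp_one_lt_d9, S.y_ge]
  rw [r, exp_neg]
  gcongr
  · exact S.y_pos
  · calc S.y = exp (log S.y) := (exp_log S.y_pos).symm
      _ ≤ _ := exp_le_exp.2 (by nlinarith)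

/-- Radius of the next layer. -/
noncomputable def R : ℝ := S.r / (8 * S.y ^ 7)

theorem R_pos : 0 < S.R := div_pos S.r_pos (by have := S.y_pos; positivity)

theorem R_inv_le : S.R⁻¹ ≤ exp S.y := by
  rw [R, inv_div, div_eq_mul_inv, r, exp_neg, inv_inv]
  exact (S.big S.y le_rfl).2.2.2

theorem exp_neg_sq_le : exp (-S.y ^ 2) ≤ S.R := by
  have h1 : exp (-S.y) ≤ S.R := by
    rw [exp_neg]
    exact inv_le_of_inv_le₀ S.R_pos S.R_inv_le
  refine (exp_le_exp.2 ?_).trans h1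
  nlinarith [S.y_ge]

/-- The data of the next layer. -/
noncomputable def dat : Dat where
  D := exp S.y
  ℓ := exp (-S.y ^ 2)
  R := S.R
  t0 := 1 - 2 * S.β
  η1 := S.next.σ.f1 S.next.k
  η2 := S.next.σ.f2 S.next.k
  ζ1 := fun t => -S.next.σ.X11 t
  ζ2 := fun t => -S.next.σ.X12 t
  a := S.next.σ.amp S.next.k S.next.G
  α := S.next.σ.P2
  γ := S.next.σ.W S.next.k
  two_le := by linarith [add_one_le_exp S.y, S.y_ge]
  ℓ_pos := exp_pos _
  ℓ_le := S.exp_neg_sq_le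
  R_le := by
    have h1 : S.y⁻¹ ≤ 1 := inv_le_one_of_one_le₀ (by linarith [S.y_ge])
    have h2 : 1 ≤ S.y ^ 7 := one_le_pow₀ (by linarith [S.y_ge])
    exact div_le_one_of_le₀ (by linarith [S.r_le]) (by positivity)
  R_inv := S.R_inv_le
  t0_lt := by linarith [S.β_pos]
  t0_ge := by linarith [S.β_le]
  smη1 := S.next.σ.contDiff_f1 _
  smη2 := S.next.σ.contDiff_f2 _
  smζ1 := S.next.σ.s11.neg
  smζ2 := S.next.σ.s12.neg
  sma := S.next.σ.contDiff_amp _ _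
  bη1 := fun t ht => (S.size_f ht).1.trans (S.pow_mul_le_exp (by norm_num) (by norm_num))
  bη2 := fun t ht => (S.size_f ht).2.trans (S.pow_mul_le_exp (by norm_num) (by norm_num))
  bζ1 := fun t ht => by
    rw [abs_neg]
    exact (S.size ht).1.trans (S.pow_mul_le_exp (by norm_num) (by norm_num))
  bζ2 := fun t ht => by
    rw [abs_neg]
    exact (S.size ht).2.1.trans (S.pow_mul_le_exp (by norm_num) (by norm_num))
  bη1' := fun t ht => (S.size_f' ht).1.trans (S.pow_mul_le_exp (by norm_num) (by norm_num))
  bη2' := fun t ht => (S.size_f' ht).2.trans (S.pow_mul_le_exp (by norm_num) (by norm_num))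
  bζ1' := fun t ht => by
    rw [deriv.fun_neg, abs_neg]
    exact (S.next.inv.b11 t ht).trans (S.next.g_le.trans (exp_le_exp.2 (by linarith [S.y_pos])))
  bζ2' := fun t ht => by
    rw [deriv.fun_neg, abs_neg]
    exact (S.next.inv.b12 t ht).trans (S.next.g_le.trans (exp_le_exp.2 (by linarith [S.y_pos])))
  ba := fun t ht => by
    obtain ⟨h1, h2, -⟩ := S.amp_bounds ht
    rwa [abs_of_nonneg h1]
  bα := S.next.inv.bP2.trans (S.next.g_le.trans (exp_le_exp.2 (by linarith [S.y_pos])))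
  bγ := by
    have hg : S.next.g = S.y ^ 80 := by simp only [next, G]; rw [← pow_mul]
    have h1 := S.next.inv.bP1
    have h2 := S.next.inv.bP2
    have hk := S.next.abs_k_le
    refine le_trans ?_ (S.pow_mul_le_exp (n := 80) (c := 2) le_rfl (by norm_num))
    refine (abs_sub _ _).trans ?_
    rw [abs_mul]
    nlinarith [abs_nonneg S.next.σ.P2]
  bN := fun t ht => by
    obtain ⟨h1, h2, -⟩ := S.size ht
    refine le_trans ?_ (S.pow_mul_le_exp (n := 6) (c := 128) (by norm_num) (by norm_num))
    have hc := S.next.σ.cross_f S.next.k t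
    have hQ : 0 < S.next.σ.f1 S.next.k t ^ 2 + S.next.σ.f2 S.next.k t ^ 2 :=
      S.next.σ.Q_pos S.next.k t
    rw [inv_le_iff_one_le_mul₀ hQ]
    have h3 := sq_le_sq' (by linarith [neg_abs_le (S.next.σ.X11 t)]) ((le_abs_self _).trans h1)
    have h4 := sq_le_sq' (by linarith [neg_abs_le (S.next.σ.X12 t)]) ((le_abs_self _).trans h2)
    have h5 : S.next.σ.X11 t ^ 2 + S.next.σ.X12 t ^ 2 ≤ 128 * S.y ^ 6 := by
      calc _ ≤ (8 * S.y ^ 3) ^ 2 + (8 * S.y ^ 3) ^ 2 := add_le_add h3 h4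
        _ = _ := by ring
    refine le_trans ?_ (mul_le_mul_of_nonneg_right h5 hQ.le)
    nlinarith [sq_nonneg (S.next.σ.X11 t * S.next.σ.f1 S.next.k t +
      S.next.σ.X12 t * S.next.σ.f2 S.next.k t)]
  cross := S.next.σ.cross_f _
  a_deriv := fun t => (S.next.σ.hasDerivAt_amp _ _ t).deriv

/-- Switching function of the next layer. -/
noncomputable def θ (t : ℝ) : ℝ := smoothTransition ((t - (1 - 2 * S.β)) / S.β)

theorem contDiff_θ : ContDiff ℝ (⊤ : ℕ∞) S.θ :=
  smoothTransition.contDiff.comp (by fun_prop)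

theorem θ_eq_zero {t : ℝ} (ht : t ≤ 1 - 2 * S.β) : S.θ t = 0 :=
  smoothTransition.zero_of_nonpos (div_nonpos_of_nonpos_of_nonneg (by linarith) S.β_pos.le)

theorem θ_eq_one {t : ℝ} (ht : 1 - S.β ≤ t) : S.θ t = 1 :=
  smoothTransition.one_of_one_le ((one_le_div S.β_pos).2 (by linarith))

theorem abs_θ_le (t : ℝ) : |S.θ t| ≤ 1 := by
  exact (abs_of_nonneg (smoothTransition.nonneg _)).le.trans (smoothTransition.le_one _)

theorem abs_deriv_θ_le (hC : ∀ x, |deriv smoothTransition x| ≤ C) (t : ℝ) :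
    |deriv S.θ t| ≤ S.y ^ 35 := by
  have h1 : HasDerivAt (fun t => (t - (1 - 2 * S.β)) / S.β) (1 / S.β) t :=
    ((hasDerivAt_id t).sub_const _).div_const _
  have h2 : HasDerivAt S.θ (deriv smoothTransition ((t - (1 - 2 * S.β)) / S.β) * (1 / S.β)) t :=
    HasDerivAt.comp t (((smoothTransition.contDiff (n := (⊤ : ℕ∞))).differentiable
      (by simp) _).hasDerivAt) h1
  rw [h2.deriv, abs_mul, abs_of_pos (one_div_pos.2 S.β_pos), β, one_div, inv_inv]
  have := S.y_pos
  calc _ ≤ S.y * S.y ^ 34 := mul_le_mul_of_nonneg_right ((hC _).trans S.C_le) (by positivity)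
    _ = _ := by ring

theorem switch_le (hC : ∀ x, |deriv smoothTransition x| ≤ C) {t : ℝ}
    (ht : t ∈ Icc (1 - 2 * S.β) 1) :
    |S.dat.a t| * (|deriv S.θ t| + |S.θ t ^ 2 - S.θ t|) ≤
      exp S.y * exp (-(S.y ^ 3 / 4096)) * exp S.y := by
  obtain ⟨h1, -, h3⟩ := S.amp_bounds ht
  rcases le_or_gt t (1 - S.β) with h | h
  · have h4 : |S.θ t ^ 2 - S.θ t| ≤ 1 := by
      have a1 : 0 ≤ S.θ t := smoothTransition.nonneg _
      have a2 : S.θ t ≤ 1 := smoothTransition.le_one _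
      rw [abs_le]; constructor <;> nlinarith
    have h5 : |deriv S.θ t| + |S.θ t ^ 2 - S.θ t| ≤ exp S.y := by
      have a1 := S.abs_deriv_θ_le hC t
      have a2 := S.pow_mul_le_exp (n := 35) (c := 2) (by norm_num) (by norm_num)
      have a3 : 1 ≤ S.y ^ 35 := one_le_pow₀ (by linarith [S.y_ge])
      linarith
    refine mul_le_mul ?_ h5 (by positivity) (by positivity)
    exact (abs_of_nonneg h1).le.trans (h3 h)
  · have h4 : deriv S.θ t = 0 := by
      have : S.θ =ᶠ[𝓝 t] fun _ => 1 := by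
        filter_upwards [Ioi_mem_nhds h] with u hu
        exact S.θ_eq_one (le_of_lt hu)
      rw [this.deriv_eq, deriv_const]
    rw [h4, S.θ_eq_one h.le]
    simp only [abs_zero, one_pow, sub_self, add_zero, mul_zero]
    positivity

end Stage

/-! ### The core of the solution -/

/-- The function `Φ` has the second order behaviour at `p` prescribed by the state `σ`. -/
def Core (σ : St) (Φ : (ℝ × ℝ) × ℝ → ℝ) (p : (ℝ × ℝ) × ℝ) : Prop :=
  dd e1 (dd e1 Φ) p = σ.m21 p.2 * p.1.1 - σ.m11 p.2 * p.1.2 ∧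
  dd e1 (dd e2 Φ) p = -(σ.m11 p.2 * p.1.1 + σ.m12 p.2 * p.1.2) ∧
  dd e1 (lap Φ) p = -σ.p1 p.2 ∧ dd e2 (lap Φ) p = -σ.p2 p.2

theorem Core.congr {σ : St} {Φ Ψ : (ℝ × ℝ) × ℝ → ℝ} {p : (ℝ × ℝ) × ℝ} (h : Core σ Φ p)
    (e : Φ =ᶠ[𝓝 p] Ψ) : Core σ Ψ p := by
  obtain ⟨h1, h2, h3, h4⟩ := h
  exact ⟨(dd_congr (dd_congr e)).eq_of_nhds.symm.trans h1,
    (dd_congr (dd_congr e)).eq_of_nhds.symm.trans h2,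
    (dd_congr (lap_congr e)).eq_of_nhds.symm.trans h3,
    (dd_congr (lap_congr e)).eq_of_nhds.symm.trans h4⟩

theorem dd_lin_pow {κ A B : ℝ → ℝ} (hκ : ContDiff ℝ (⊤ : ℕ∞) κ) (hA : ContDiff ℝ (⊤ : ℕ∞) A)
    (hB : ContDiff ℝ (⊤ : ℕ∞) B) (n : ℕ) :
    dd e1 (fun p => κ p.2 * (A p.2 * p.1.1 + B p.2 * p.1.2) ^ (n + 1)) =
      (fun p => ((n + 1) * κ p.2 * A p.2) * (A p.2 * p.1.1 + B p.2 * p.1.2) ^ n) ∧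
    dd e2 (fun p => κ p.2 * (A p.2 * p.1.1 + B p.2 * p.1.2) ^ (n + 1)) =
      fun p => ((n + 1) * κ p.2 * B p.2) * (A p.2 * p.1.1 + B p.2 * p.1.2) ^ n := by
  have hs : ContDiff ℝ (⊤ : ℕ∞) fun p : (ℝ × ℝ) × ℝ =>
      κ p.2 * (A p.2 * p.1.1 + B p.2 * p.1.2) ^ (n + 1) := by fun_prop
  constructor <;> funext p <;> refine dd_eq_of_hasDerivAt hs.dat ?_
  · have h := ((((((hasDerivAt_id (0 : ℝ)).const_add p.1.1).const_mul (A p.2)).add_const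
      (B p.2 * p.1.2)).pow (n + 1)).const_mul (κ p.2))
    simp only [Prod.fst_add, Prod.snd_add, Prod.smul_fst, Prod.smul_snd, smul_eq_mul, mul_zero,
      mul_one, add_zero, id] at h ⊢
    refine h.congr_deriv ?_
    push_cast [Nat.add_sub_cancel]
    ring
  · have h := ((((((hasDerivAt_id (0 : ℝ)).const_add p.1.2).const_mul (B p.2)).const_add
      (A p.2 * p.1.1)).pow (n + 1)).const_mul (κ p.2))
    simp only [Prod.fst_add, Prod.snd_add, Prod.smul_fst, Prod.smul_snd, smul_eq_mul, mul_zero,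
      mul_one, add_zero, id] at h ⊢
    refine h.congr_deriv ?_
    push_cast [Nat.add_sub_cancel]
    ring

/-- The leading cubic term of a layer. -/
noncomputable def cubic (σ : St) (k G : ℝ) (p : (ℝ × ℝ) × ℝ) : ℝ :=
  -(σ.amp k G p.2 / (6 * σ.Q k p.2)) * (σ.f1 k p.2 * p.1.1 + σ.f2 k p.2 * p.1.2) ^ 3

theorem contDiff_cubic_coeff (σ : St) (k G : ℝ) :
    ContDiff ℝ (⊤ : ℕ∞) fun t => -(σ.amp k G t / (6 * σ.Q k t)) :=
  ((σ.contDiff_amp k G).div (contDiff_const.mul (σ.contDiff_Q k))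
    fun t => (mul_pos (by norm_num) (σ.Q_pos k t)).ne').neg

theorem contDiff_cubic (σ : St) (k G : ℝ) : ContDiff ℝ (⊤ : ℕ∞) (cubic σ k G) := by
  have h1 := contDiff_cubic_coeff σ k G
  have h2 := σ.contDiff_f1 k
  have h3 := σ.contDiff_f2 k
  exact (h1.comp contDiff_snd).mul ((((h2.comp contDiff_snd).mul (by fun_prop)).add
    ((h3.comp contDiff_snd).mul (by fun_prop))).pow 3)

theorem Core.add_cubic {σ : St} {Φ : (ℝ × ℝ) × ℝ → ℝ} {p : (ℝ × ℝ) × ℝ} {k G : ℝ}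
    (h : Core σ Φ p) (hΦ : ContDiff ℝ (⊤ : ℕ∞) Φ) :
    Core (σ.step k G) (fun p => Φ p + cubic σ k G p) p := by
  have h1 := contDiff_cubic_coeff σ k G
  have h2 := σ.contDiff_f1 k
  have h3 := σ.contDiff_f2 k
  have hc := contDiff_cubic σ k G
  have hQ := σ.Q_pos k p.2
  obtain ⟨a1, a2⟩ := dd_lin_pow h1 h2 h3 2
  have s1 : ContDiff ℝ (⊤ : ℕ∞) fun t =>
    ((2 : ℕ) + 1) * -(σ.amp k G t / (6 * σ.Q k t)) * σ.f1 k t := (contDiff_const.mul h1).mul h2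
  have s2 : ContDiff ℝ (⊤ : ℕ∞) fun t =>
    ((2 : ℕ) + 1) * -(σ.amp k G t / (6 * σ.Q k t)) * σ.f2 k t := (contDiff_const.mul h1).mul h3
  obtain ⟨b11, -⟩ := dd_lin_pow s1 h2 h3 1
  obtain ⟨b12, b22⟩ := dd_lin_pow s2 h2 h3 1
  have el : lap (cubic σ k G) = fun p => (-σ.amp k G p.2) *
      (σ.f1 k p.2 * p.1.1 + σ.f2 k p.2 * p.1.2) ^ (0 + 1) := by
    funext q
    have hq := σ.Q_pos k q.2
    unfold lap cubic
    rw [a1, a2, b11, b22]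
    simp only [St.Q] at hq ⊢
    field_simp
    push_cast
    ring
  obtain ⟨l1, l2⟩ := dd_lin_pow (σ.contDiff_amp k G).neg h2 h3 0
  obtain ⟨c1, c2, c3, c4⟩ := h
  unfold Core
  rw [lap_add hΦ hc, dd_add hΦ hc, dd_add hΦ hc, dd_add (contDiff_dd _ hΦ) (contDiff_dd _ hc),
    dd_add (contDiff_dd _ hΦ) (contDiff_dd _ hc), dd_add (contDiff_lap hΦ) (contDiff_lap hc),
    dd_add (contDiff_lap hΦ) (contDiff_lap hc), el, l1, l2]
  dsimp only
  rw [c1, c2, c3, c4, St.step_p1, St.step_p2]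
  unfold cubic
  rw [a1, a2, b11, b12]
  simp only [St.step, St.shear]
  refine ⟨?_, ?_, ?_, ?_⟩
  · field_simp; push_cast; ring
  · field_simp; push_cast; ring
  · simp; ring
  · simp; ring

namespace Stage

variable {C : ℝ} (S : Stage C) {V : Symb} {p : (ℝ × ℝ) × ℝ}

/-- The layer added at a stage. -/
noncomputable def lay (V : Symb) : (ℝ × ℝ) × ℝ → ℝ :=
  layer S.dat S.θ (lead0 wave cutoff cutoff + V)

theorem good_lead (hV : Good TB1 V) : Good TB1 (lead0 wave cutoff cutoff + V) :=
  (good_lead0 per_wave cut_cutoff cut_cutoff).add hV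

theorem contDiff_lay (hV : Good TB1 V) : ContDiff ℝ (⊤ : ℕ∞) (S.lay V) :=
  contDiff_layer S.contDiff_θ (good_lead hV).mono

theorem lay_eq_zero_of_time (hp : p.2 ≤ 1 - 2 * S.β) : S.lay V p = 0 := by
  simp [lay, layer, S.θ_eq_zero hp]

theorem lay_eq_zero (hV : Good TB1 V) (ht : p.2 ≤ 1) (hp : S.r / 2 ≤ ‖p.1‖) : S.lay V p = 0 := by
  rcases le_or_gt p.2 (1 - 2 * S.β) with h | h
  · exact S.lay_eq_zero_of_time h
  have hr := S.R_pos
  have hy := S.y_pos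
  rw [lay, layer, Ev, val_outside (good_lead hV), mul_zero]
  by_contra! hc
  obtain ⟨h1, h2⟩ := hc
  have hm : p.2 ∈ Icc (1 - 2 * S.β) 1 := ⟨h.le, ht⟩
  obtain ⟨x1, x2, -⟩ := S.size hm
  obtain ⟨f1, f2⟩ := S.size_f hm
  have hcr := S.dat.cross p.2
  rw [abs_div, abs_of_pos S.dat.R_pos, div_le_one S.dat.R_pos] at h1 h2
  change _ ≤ S.R at h1
  change _ ≤ S.R at h2
  rw [← abs_neg] at x1 x2
  have key : 24 * S.y ^ 3 * S.R < S.r / 2 := by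
    have : S.r = 8 * S.y ^ 7 * S.R := by rw [R]; field_simp
    rw [this]
    have : S.y ^ 3 * S.R * 1000 ≤ S.y ^ 3 * S.R * S.y ^ 4 := by
      gcongr
      exact S.y_ge.trans (le_self_pow₀ (by linarith [S.y_ge]) (by norm_num))
    have : 0 < S.y ^ 3 * S.R := by positivity
    nlinarith
  have n1 : |p.1.1| ≤ 24 * S.y ^ 3 * S.R := by
    have e : p.1.1 = S.dat.ζ2 p.2 * ph S.dat p - S.dat.η2 p.2 * ps S.dat p := by
      simp only [ph, ps]; linear_combination -p.1.1 * hcr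
    rw [e]
    refine (abs_sub _ _).trans ?_
    rw [abs_mul, abs_mul]
    calc _ ≤ 8 * S.y ^ 3 * S.R + 16 * S.y ^ 3 * S.R := by
          gcongr
          · exact x2
          · exact f2
      _ = _ := by ring
  have n2 : |p.1.2| ≤ 24 * S.y ^ 3 * S.R := by
    have e : p.1.2 = S.dat.η1 p.2 * ps S.dat p - S.dat.ζ1 p.2 * ph S.dat p := by
      simp only [ph, ps]; linear_combination -p.1.2 * hcr
    rw [e]
    refine (abs_sub _ _).trans ?_
    rw [abs_mul, abs_mul]
    calc _ ≤ 16 * S.y ^ 3 * S.R + 8 * S.y ^ 3 * S.R := by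
          gcongr
          · exact f1
          · exact x1
      _ = _ := by ring
  have : ‖p.1‖ ≤ 24 * S.y ^ 3 * S.R := max_le n1 n2
  linarith

theorem lay_core (hV : Van V) (ht : p.2 ∈ Icc (1 - S.β) 1) (hp : ‖p.1‖ < S.next.r) :
    S.lay V p = cubic S.next.σ S.next.k S.next.G p := by
  have hy := S.y_pos
  have hβ := S.β_pos
  have hm : p.2 ∈ Icc (1 - 2 * S.β) 1 := ⟨by linarith [ht.1], ht.2⟩
  obtain ⟨x1, x2, -⟩ := S.size hm
  obtain ⟨f1, f2⟩ := S.size_f hm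
  rw [← abs_neg] at x1 x2
  have hx1 : |p.1.1| ≤ S.next.r := (norm_fst_le p.1).trans hp.le
  have hx2 : |p.1.2| ≤ S.next.r := (norm_snd_le p.1).trans hp.le
  have hn := S.next.r_pos
  have n1 : |ph S.dat p| ≤ 32 * S.y ^ 3 * S.next.r := by
    refine (abs_add_le _ _).trans ?_
    rw [abs_mul, abs_mul]
    calc _ ≤ 16 * S.y ^ 3 * S.next.r + 16 * S.y ^ 3 * S.next.r := by
          gcongr
          · exact f1
          · exact f2
      _ = _ := by ring
  have n2 : |ps S.dat p| ≤ 32 * S.y ^ 3 * S.next.r := by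
    refine (abs_add_le _ _).trans ?_
    rw [abs_mul, abs_mul]
    calc _ ≤ 8 * S.y ^ 3 * S.next.r + 8 * S.y ^ 3 * S.next.r := by
          gcongr
          · exact x1
          · exact x2
      _ ≤ _ := by nlinarith [mul_pos (pow_pos hy 3) hn]
  have key : 32 * S.y ^ 3 * S.next.r < 1 / 4 * exp (-S.y ^ 2) := by
    have e : S.next.r = exp (-S.y ^ 2) * exp (-S.y ^ 2) := by
      rw [next_r, ← exp_add]; congr 1; ring
    have h1 : 129 * S.y ^ 3 ≤ exp (S.y ^ 2) :=
      (S.pow_mul_le_exp (by norm_num) (by norm_num)).trans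
        (exp_le_exp.2 (by nlinarith [S.y_ge]))
    have h2 : 129 * S.y ^ 3 * exp (-S.y ^ 2) ≤ 1 := by
      rw [exp_neg]
      exact mul_inv_le_one_of_le₀ h1 (by positivity)
    rw [e]
    have h3 := exp_pos (-S.y ^ 2)
    have h4 : 128 * S.y ^ 3 * exp (-S.y ^ 2) < 1 := by
      have : 0 < S.y ^ 3 * exp (-S.y ^ 2) := by positivity
      nlinarith
    nlinarith
  have l1 : |ph S.dat p / S.dat.ℓ| < 1 / 4 := by
    rw [abs_div, abs_of_pos S.dat.ℓ_pos, div_lt_iff₀ S.dat.ℓ_pos]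
    exact n1.trans_lt key
  have hR : exp (-S.y ^ 2) ≤ S.dat.R := S.exp_neg_sq_le
  have l2 : |ph S.dat p / S.dat.R| < 1 / 2 := by
    rw [abs_div, abs_of_pos S.dat.R_pos, div_lt_iff₀ S.dat.R_pos]
    linarith [S.dat.R_pos]
  have l3 : |ps S.dat p / S.dat.R| < 1 / 2 := by
    rw [abs_div, abs_of_pos S.dat.R_pos, div_lt_iff₀ S.dat.R_pos]
    linarith [S.dat.R_pos]
  have hl := S.dat.ℓ_pos.ne'
  rw [lay, layer, Ev, val_add, val_core hV l2 l3, S.θ_eq_one ht.1, lead0]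
  simp only [val, Multiset.map_singleton, Multiset.sum_singleton, Gen.val, wave_eq l1,
    cutoff_eq_one l2, cutoff_eq_one l3]
  have hQ := S.dat.N_pos p.2
  rw [Dat.N2]
  unfold cubic St.Q
  change _ = -(S.dat.a p.2 / (6 * (S.dat.η1 p.2 ^ 2 + S.dat.η2 p.2 ^ 2))) * ph S.dat p ^ 3
  field_simp
  ring

end Stage

/-! ### The approximating sequence -/

variable {C : ℝ}

/-- The sequence of stages. -/
noncomputable def stg (S0 : Stage C) : ℕ → Stage C
  | 0 => S0
  | n + 1 => (stg S0 n).next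

/-- The initial function. -/
noncomputable def phiZero (S0 : Stage C) (p : (ℝ × ℝ) × ℝ) : ℝ :=
  cutoff (2 * p.1.1) * cutoff (2 * p.1.2) * cubic S0.σ S0.k S0.G p

/-- The approximations, with `V n` the correction of the layer at stage `n`. -/
noncomputable def phi (S0 : Stage C) (V : ℕ → Symb) : ℕ → (ℝ × ℝ) × ℝ → ℝ
  | 0 => phiZero S0
  | n + 1 => fun p => phi S0 V n p + (stg S0 n).lay (V n) p

theorem phi_succ (S0 : Stage C) (V : ℕ → Symb) (n : ℕ) (p : (ℝ × ℝ) × ℝ) :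
    phi S0 V (n + 1) p = phi S0 V n p + (stg S0 n).lay (V n) p := rfl

section stages

variable (S0 : Stage C)

theorem stg_y_ge (n : ℕ) : (1000 : ℝ) + n ≤ (stg S0 n).y := by
  induction n with
  | zero => simpa using (stg S0 0).y_ge
  | succ n ih =>
    have h0 := (stg S0 n).y_ge
    have h1 := (stg S0 n).next_y_ge
    have h2 : (stg S0 n).y ^ 2 ≤ (stg S0 n).y ^ 80 :=
      pow_le_pow_right₀ (by linarith) (by norm_num)
    change _ ≤ (stg S0 n).next.y
    push_cast
    nlinarith

theorem Stage.le_next_y (S : Stage C) : S.y ≤ S.next.y := S.le_exp_div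

theorem stg_y_mono : Monotone fun n => (stg S0 n).y :=
  monotone_nat_of_le_succ fun n => (stg S0 n).le_next_y

theorem tendsto_stg_y : Tendsto (fun n => (stg S0 n).y) atTop atTop :=
  tendsto_atTop_mono (fun n => by linarith [stg_y_ge S0 n]) tendsto_natCast_atTop_atTop

theorem Stage.next_r_le (S : Stage C) : S.next.r ≤ S.r / 2 := by
  have h0 := S.y_ge
  have h1 := S.exp_neg_sq_le
  have h2 : S.R ≤ S.r / 2 := by
    rw [Stage.R]
    have : 1 ≤ S.y ^ 7 := one_le_pow₀ (by linarith)
    exact div_le_div_of_nonneg_left S.r_pos.le (by norm_num) (by linarith)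
  refine (le_trans ?_ h1).trans h2
  rw [S.next_r, exp_le_exp]
  nlinarith

theorem Stage.r_le_one (S : Stage C) : S.r ≤ 1 / 1000 := by
  refine S.r_le.trans ?_
  rw [← one_div]
  exact one_div_le_one_div_of_le (by norm_num) S.y_ge

theorem stg_r_anti : Antitone fun n => (stg S0 n).r :=
  antitone_nat_of_succ_le fun n => ((stg S0 n).next_r_le).trans (by linarith [(stg S0 n).r_pos])

theorem stg_β_anti : Antitone fun n => (stg S0 n).β :=
  antitone_nat_of_succ_le fun n => ((stg S0 n).next_β_le).trans (by linarith [(stg S0 n).β_pos])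

theorem tendsto_stg_r : Tendsto (fun n => (stg S0 n).r) atTop (𝓝 0) :=
  squeeze_zero (fun n => (stg S0 n).r_pos.le) (fun n => (stg S0 n).r_le)
    (tendsto_inv_atTop_zero.comp (tendsto_stg_y S0))

theorem tendsto_stg_β : Tendsto (fun n => (stg S0 n).β) atTop (𝓝 0) :=
  tendsto_inv_atTop_zero.comp ((tendsto_pow_atTop (by norm_num)).comp (tendsto_stg_y S0))

theorem tendsto_stg_G : Tendsto (fun n => (stg S0 n).G) atTop atTop :=
  (tendsto_pow_atTop (by norm_num)).comp (tendsto_stg_y S0)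

end stages

section phi

variable {S0 : Stage C} {V : ℕ → Symb}

theorem contDiff_phiZero (S0 : Stage C) : ContDiff ℝ (⊤ : ℕ∞) (phiZero S0) :=
  ((contDiff_cutoff.comp (by fun_prop)).mul (contDiff_cutoff.comp (by fun_prop))).mul
    (contDiff_cubic _ _ _)

theorem contDiff_phi (hV : ∀ n, Good TB1 (V n)) (n : ℕ) : ContDiff ℝ (⊤ : ℕ∞) (phi S0 V n) := by
  induction n with
  | zero => exact contDiff_phiZero S0
  | succ n ih => exact ih.add ((stg S0 n).contDiff_lay (hV n))

theorem phiZero_eq_zero {p : (ℝ × ℝ) × ℝ} (h : 1 / 2 ≤ ‖p.1‖) : phiZero S0 p = 0 := by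
  rw [phiZero]
  have h' : 1 / 2 ≤ |p.1.1| ∨ 1 / 2 ≤ |p.1.2| := le_max_iff.1 h
  rcases h' with h | h
  · rw [cutoff_eq_zero (by rw [abs_mul, abs_two]; linarith)]; ring
  · rw [cutoff_eq_zero (y := 2 * p.1.2) (by rw [abs_mul, abs_two]; linarith)]; ring

theorem phi_eq_zero (hV : ∀ n, Good TB1 (V n)) (n : ℕ) {p : (ℝ × ℝ) × ℝ} (ht : p.2 ≤ 1)
    (h : 1 / 2 ≤ ‖p.1‖) : phi S0 V n p = 0 := by
  induction n with
  | zero => exact phiZero_eq_zero h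
  | succ n ih =>
    rw [phi_succ, ih, (stg S0 n).lay_eq_zero (hV n) ht, add_zero]
    linarith [(stg S0 n).r_le_one]

theorem core_phi (h0 : S0.σ = St.rest) (hV : ∀ n, Good TB1 (V n)) (hV' : ∀ n, Van (V n)) (n : ℕ)
    {p : (ℝ × ℝ) × ℝ} (ht : p.2 ∈ Ioo (1 - 2 * (stg S0 n).β) 1) (hp : ‖p.1‖ < (stg S0 n).r) :
    Core (stg S0 n).next.σ (phi S0 V n) p := by
  induction n with
  | zero =>
    have hc : Core S0.σ (fun _ => 0) p := by
      rw [h0]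
      simp [Core, St.rest, St.p1, St.p2]
    refine (hc.add_cubic (k := S0.k) (G := S0.G) contDiff_const).congr ?_
    have hr : (stg S0 0).r < 1 / 4 := by linarith [(stg S0 0).r_le_one]
    filter_upwards [(isOpen_lt (continuous_fst.norm) continuous_const).mem_nhds
      (hp.trans hr)] with q hq
    have hq : ‖q.1‖ < 1 / 4 := hq
    have a1 : |q.1.1| ≤ ‖q.1‖ := norm_fst_le q.1
    have a2 : |q.1.2| ≤ ‖q.1‖ := norm_snd_le q.1
    rw [phi, phiZero, cutoff_eq_one, cutoff_eq_one, one_mul, one_mul, zero_add]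
    all_goals
      rw [abs_mul, abs_two]; linarith
  | succ n ih =>
    have hβ : (stg S0 (n + 1)).β ≤ (stg S0 n).β / 1000 := (stg S0 n).next_β_le
    have hβ0 := (stg S0 n).β_pos
    have hr : (stg S0 (n + 1)).r ≤ (stg S0 n).r := stg_r_anti S0 n.le_succ
    have hi := ih ⟨by linarith [ht.1], ht.2⟩ (hp.trans_le hr)
    refine (hi.add_cubic (k := (stg S0 n).next.k) (G := (stg S0 n).next.G)
      (contDiff_phi hV n)).congr ?_
    have o1 : IsOpen {q : (ℝ × ℝ) × ℝ | ‖q.1‖ < (stg S0 n).next.r} :=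
      isOpen_lt (continuous_fst.norm) continuous_const
    have o2 : IsOpen {q : (ℝ × ℝ) × ℝ | q.2 ∈ Ioo (1 - (stg S0 n).β) 1} :=
      isOpen_Ioo.preimage continuous_snd
    filter_upwards [o1.mem_nhds hp, o2.mem_nhds (show p.2 ∈ Ioo _ _ from ⟨by linarith [ht.1], ht.2⟩)]
      with q h1 h2
    rw [phi_succ, (stg S0 n).lay_core (hV' n) ⟨h2.1.le, h2.2.le⟩ h1]

/-- The error made at stage `n`. -/
noncomputable def err (S0 : Stage C) (V : ℕ → Symb) (n : ℕ) (p : (ℝ × ℝ) × ℝ) : ℝ :=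
  NN (phi S0 V (n + 1)) p + -NN (phi S0 V n) p

theorem contDiff_err (hV : ∀ n, Good TB1 (V n)) (n : ℕ) : ContDiff ℝ (⊤ : ℕ∞) (err S0 V n) :=
  (contDiff_NN (contDiff_phi hV _)).add (contDiff_NN (contDiff_phi hV _)).neg

theorem ddMix_NN_succ (hV : ∀ n, Good TB1 (V n)) (n i j : ℕ) (p : (ℝ × ℝ) × ℝ) :
    ddMix i j (NN (phi S0 V (n + 1))) p =
      ddMix i j (NN (phi S0 V n)) p + ddMix i j (err S0 V n) p := by
  have e : NN (phi S0 V (n + 1)) = fun p => NN (phi S0 V n) p + err S0 V n p := by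
    funext p; simp only [err]; ring
  rw [e, ddMix_add (contDiff_NN (contDiff_phi hV _)) (contDiff_err hV n)]

theorem ddMix_zero (i j : ℕ) (p : (ℝ × ℝ) × ℝ) : ddMix i j (fun _ => 0) p = 0 := by
  have h : ∀ (v : (ℝ × ℝ) × ℝ) j, (dd v)^[j] (fun _ => 0) = fun _ => 0 := fun v j => by
    induction j with
    | zero => rfl
    | succ j ih => rw [Function.iterate_succ_apply', ih, dd_zero]
  rw [ddMix, h, h]

theorem ddMix_err_of_lay {n : ℕ} {p : (ℝ × ℝ) × ℝ}
    (h : ∀ᶠ q in 𝓝 p, (stg S0 n).lay (V n) q = 0) (i j : ℕ) : ddMix i j (err S0 V n) p = 0 := by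
  have e : phi S0 V (n + 1) =ᶠ[𝓝 p] phi S0 V n := by
    filter_upwards [h] with q hq
    rw [phi_succ, hq, add_zero]
  have e' : err S0 V n =ᶠ[𝓝 p] fun _ => 0 := by
    filter_upwards [NN_congr e] with q hq
    rw [err, hq, add_neg_cancel]
  rw [(ddMix_congr e' i j).eq_of_nhds, ddMix_zero]

theorem ddMix_err_early {n : ℕ} {p : (ℝ × ℝ) × ℝ} (hp : p.2 < 1 - 2 * (stg S0 n).β) (i j : ℕ) :
    ddMix i j (err S0 V n) p = 0 := by
  refine ddMix_err_of_lay ?_ i j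
  filter_upwards [(isOpen_Iio.preimage continuous_snd).mem_nhds hp] with q hq
  exact (stg S0 n).lay_eq_zero_of_time (le_of_lt hq)

theorem ddMix_err_core (h0 : S0.σ = St.rest) (hV : ∀ n, Good TB1 (V n)) (hV' : ∀ n, Van (V n))
    {n : ℕ} {p : (ℝ × ℝ) × ℝ} (ht : p.2 ∈ Ioo (1 - 2 * (stg S0 n).β) 1)
    (hp : ‖p.1‖ < (stg S0 n).r) (i j : ℕ) :
    ddMix i j (err S0 V n) p = ddMix i j
      (layerErr (stg S0 n).dat (stg S0 n).θ (lead0 wave cutoff cutoff + V n)) p := by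
  refine (ddMix_congr ?_ i j).eq_of_nhds
  have o1 : IsOpen {q : (ℝ × ℝ) × ℝ | ‖q.1‖ < (stg S0 n).r} :=
    isOpen_lt (continuous_fst.norm) continuous_const
  have o2 : IsOpen {q : (ℝ × ℝ) × ℝ | q.2 ∈ Ioo (1 - 2 * (stg S0 n).β) 1} :=
    isOpen_Ioo.preimage continuous_snd
  filter_upwards [o1.mem_nhds hp, o2.mem_nhds ht] with q h1 h2
  obtain ⟨c1, c2, c3, c4⟩ := core_phi h0 hV hV' n h2 h1
  set S := stg S0 n
  have key := NN_layer (d := S.dat) (θ := S.θ) (v := lead0 wave cutoff cutoff + V n) (p := q)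
    (Φ := phi S0 V n) (m11 := S.next.σ.m11 q.2) (m12 := S.next.σ.m12 q.2)
    (m21 := S.next.σ.m21 q.2)
    (contDiff_phi hV n) S.contDiff_θ (Stage.good_lead (hV n))
    (S.next.σ.hasDerivAt_f1 _ _).deriv (S.next.σ.hasDerivAt_f2 _ _).deriv
    ((S.next.σ.hd11 q.2).neg.deriv.trans (by simp only [Stage.dat]; ring))
    ((S.next.σ.hd12 q.2).neg.deriv.trans (by simp only [Stage.dat]; ring)) c1 c2
    (c3.trans (by rw [S.next.σ.p1_eq S.next.k]; rfl))
    (c4.trans (by rw [S.next.σ.p2_eq S.next.k]; rfl))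
  have e : NN (phi S0 V (n + 1)) q = NN (fun p => phi S0 V n p +
    layer S.dat S.θ (lead0 wave cutoff cutoff + V n) p) q := rfl
  rw [err, e, key]
  ring

theorem bound_Icc_of_Ioo {f : (ℝ × ℝ) × ℝ → ℝ} (hf : Continuous f) {a b M : ℝ} (hab : a < b)
    {x : ℝ × ℝ} (h : ∀ t ∈ Ioo a b, |f (x, t)| ≤ M) : ∀ t ∈ Icc a b, |f (x, t)| ≤ M := by
  have hc : IsClosed {t | |f (x, t)| ≤ M} :=
    isClosed_le (hf.comp (by fun_prop)).abs continuous_const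
  rw [← closure_Ioo hab.ne]
  exact hc.closure_subset_iff.2 h

theorem ddMix_err_le (hC : ∀ x, |deriv smoothTransition x| ≤ C) (h0 : S0.σ = St.rest)
    (hV : ∀ n, Good TB1 (V n)) (hV' : ∀ n, Van (V n)) {n J N : ℕ}
    (hL : LayerBound (lead0 wave cutoff cutoff + V n) J N)
    (hN : 4096 * (N + J + 5) ≤ (stg S0 n).y) {i j : ℕ} (hij : i + j ≤ J) {p : (ℝ × ℝ) × ℝ}
    (hp : p.2 ≤ 1) : |ddMix i j (err S0 V n) p| ≤ exp (-(stg S0 n).y) := by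
  obtain ⟨x, t⟩ := p
  have hβ := (stg S0 n).β_pos
  rcases lt_or_ge t (1 - 2 * (stg S0 n).β) with h | h
  · rw [ddMix_err_early h, abs_zero]; positivity
  refine bound_Icc_of_Ioo (contDiff_ddMix (contDiff_err hV n) i j).continuous
    (a := 1 - 2 * (stg S0 n).β) (by linarith) (fun t ht => ?_) t ⟨h, hp⟩
  rcases lt_or_ge ‖x‖ (stg S0 n).r with hx | hx
  · rw [ddMix_err_core h0 hV hV' ht hx]
    have ht' : t ∈ Icc (1 - 2 * (stg S0 n).β) 1 := ⟨ht.1.le, ht.2.le⟩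
    refine ((hL (stg S0 n).dat (stg S0 n).θ (stg S0 n).contDiff_θ (x, t) ht'
      ((stg S0 n).abs_θ_le t)).2.2.2 i j hij).trans (le_trans ?_ (error_le hN))
    have := (stg S0 n).switch_le hC ht'
    simp only [Stage.dat] at this ⊢
    gcongr
  · rw [ddMix_err_of_lay ?_ i j, abs_zero]
    · positivity
    have hr := (stg S0 n).r_pos
    have o1 : IsOpen {q : (ℝ × ℝ) × ℝ | (stg S0 n).r / 2 < ‖q.1‖} :=
      isOpen_lt continuous_const (continuous_fst.norm)
    have o2 : IsOpen {q : (ℝ × ℝ) × ℝ | q.2 < 1} := isOpen_Iio.preimage continuous_snd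
    filter_upwards [o1.mem_nhds (show (stg S0 n).r / 2 < ‖x‖ by linarith),
      o2.mem_nhds ht.2] with q h1 h2
    exact (stg S0 n).lay_eq_zero (hV n) (le_of_lt h2) (le_of_lt h1)

theorem exists_bound_ddMix_NN (hV : ∀ n, Good TB1 (V n)) (n i j : ℕ) :
    ∃ M, ∀ x, ∀ t ∈ Icc (0 : ℝ) 1, |ddMix i j (NN (phi S0 V n)) (x, t)| ≤ M := by
  have hc := (contDiff_ddMix (contDiff_NN (contDiff_phi (S0 := S0) hV n)) i j).continuous
  obtain ⟨M, hM⟩ := ((isCompact_closedBall (0 : ℝ × ℝ) 1).prod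
    (isCompact_Icc (a := (0 : ℝ)) (b := 1))).exists_bound_of_continuousOn hc.continuousOn
  have hM0 : 0 ≤ M := (norm_nonneg _).trans (hM ((0, 0), 0) (by simp))
  refine ⟨M, fun x t ht => bound_Icc_of_Ioo hc one_pos (fun t ht => ?_) t ht⟩
  rcases le_or_gt ‖x‖ 1 with hx | hx
  · exact hM (x, t) ⟨by simpa using hx, ht.1.le, ht.2.le⟩
  have e : phi S0 V n =ᶠ[𝓝 (x, t)] fun _ => 0 := by
    have o1 : IsOpen {q : (ℝ × ℝ) × ℝ | 1 < ‖q.1‖} :=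
      isOpen_lt continuous_const (continuous_fst.norm)
    have o2 : IsOpen {q : (ℝ × ℝ) × ℝ | q.2 < 1} := isOpen_Iio.preimage continuous_snd
    filter_upwards [o1.mem_nhds hx, o2.mem_nhds ht.2] with q h1 h2
    exact phi_eq_zero hV n (le_of_lt h2) (by linarith [show 1 < ‖q.1‖ from h1])
  rw [(ddMix_congr (NN_congr e) i j).eq_of_nhds, NN_zero, ddMix_zero, abs_zero]
  exact hM0

end phi

/-! ### Convergence of the approximating sequence -/

theorem summable_exp_of_eventually_le {a : ℕ → ℝ} {b : ℝ} (hb : 0 < b)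
    (h : ∀ᶠ n : ℕ in atTop, a n ≤ -b * n) : Summable fun n => exp (a n) := by
  have h1 : Summable fun n : ℕ => exp (-b * n) := by
    simpa [mul_comm] using Real.summable_exp_nat_mul_iff.2 (neg_lt_zero.2 hb)
  refine h1.of_norm_bounded_eventually_nat ?_
  filter_upwards [h] with n hn
  simpa using hn

theorem abs_sub_le_of_dd {f : (ℝ × ℝ) × ℝ → ℝ} (hf : ContDiff ℝ (⊤ : ℕ∞) f) {B t : ℝ}
    (h1 : ∀ x, |dd e1 f (x, t)| ≤ B) (h2 : ∀ x, |dd e2 f (x, t)| ≤ B) (x y : ℝ × ℝ) :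
    |f (x, t) - f (y, t)| ≤ 2 * B * ‖x - y‖ := by
  have hd : ∀ z, HasFDerivAt (fun z : ℝ × ℝ => f (z, t))
      ((fderiv ℝ f (z, t)).comp (ContinuousLinearMap.inl ℝ (ℝ × ℝ) ℝ)) z := fun z =>
    (hf.differentiable (by simp) (z, t)).hasFDerivAt.comp z (hasFDerivAt_prodMk_left z t)
  have hB : 0 ≤ B := (abs_nonneg _).trans (h1 0)
  refine convex_univ.norm_image_sub_le_of_norm_hasFDerivWithin_le (f := fun z => f (z, t))
    (fun z _ => (hd z).hasFDerivWithinAt) (fun z _ => ?_) (mem_univ y) (mem_univ x)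
  refine ContinuousLinearMap.opNorm_le_bound _ (by positivity) fun w => ?_
  have e : ((w, (0 : ℝ)) : (ℝ × ℝ) × ℝ) = w.1 • e1 + w.2 • e2 := by
    ext <;> simp [e1, e2]
  have a1 := norm_fst_le w
  have a2 := norm_snd_le w
  have b1 := h1 z
  have b2 := h2 z
  rw [dd] at b1 b2
  rw [ContinuousLinearMap.comp_apply, ContinuousLinearMap.inl_apply, e, map_add, map_smul,
    map_smul]
  calc _ ≤ ‖w.1‖ * |fderiv ℝ f (z, t) e1| + ‖w.2‖ * |fderiv ℝ f (z, t) e2| := by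
        refine (norm_add_le _ _).trans ?_
        simp
    _ ≤ ‖w‖ * B + ‖w‖ * B := by gcongr
    _ = _ := by ring

section layer

variable {C : ℝ} (S : Stage C) {V : Symb} {J N : ℕ}

theorem Stage.lap_lay_of_time (hV : Good TB1 V) {p : (ℝ × ℝ) × ℝ} (hp : p.2 ≤ 1 - 2 * S.β) :
    lap (S.lay V) p = 0 := by
  rw [Stage.lay, lap_layer S.contDiff_θ (Stage.good_lead hV).mono]
  simp [S.θ_eq_zero hp]

theorem Stage.D_pow_le (hN : (N : ℝ) * (J + 1) ≤ S.y) : S.dat.D ^ N ≤ exp (S.y ^ 2 / (J + 1)) := by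
  change exp S.y ^ N ≤ _
  have := S.y_pos
  rw [← exp_nat_mul, exp_le_exp, le_div_iff₀ (by positivity)]
  nlinarith

theorem Stage.abs_lap_lay_le (hV : Good TB1 V)
    (hL : LayerBound (lead0 wave cutoff cutoff + V) J N) (hN : (N : ℝ) * (J + 1) ≤ S.y)
    {p : (ℝ × ℝ) × ℝ} (hp : p.2 ≤ 1) :
    |lap (S.lay V) p| ≤ exp (-S.y ^ 2 + S.y ^ 2 / (J + 1)) := by
  rcases le_or_gt p.2 (1 - 2 * S.β) with h | h
  · rw [S.lap_lay_of_time hV h, abs_zero]; positivity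
  · refine ((hL S.dat S.θ S.contDiff_θ p ⟨h.le, hp⟩ (S.abs_θ_le _)).1).trans ?_
    rw [exp_add]
    exact mul_le_mul_of_nonneg_left (S.D_pow_le hN) (exp_pos _).le

theorem Stage.abs_lap_lay_sub_le (hV : Good TB1 V)
    (hL : LayerBound (lead0 wave cutoff cutoff + V) J N) (hN : (N : ℝ) * (J + 1) ≤ S.y)
    (x y : ℝ × ℝ) :
    |lap (S.lay V) (x, 1) - lap (S.lay V) (y, 1)| ≤ 2 * exp (S.y ^ 2 / (J + 1)) * ‖x - y‖ := by
  have hβ := S.β_pos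
  have key := fun x : ℝ × ℝ => hL S.dat S.θ S.contDiff_θ (x, 1)
    ⟨show 1 - 2 * S.β ≤ 1 by linarith, le_rfl⟩ (S.abs_θ_le _)
  exact abs_sub_le_of_dd (contDiff_lap (S.contDiff_lay hV))
    (fun x => (key x).2.1.trans (S.D_pow_le hN)) (fun x => (key x).2.2.1.trans (S.D_pow_le hN)) x y

end layer

section sequence

variable {C : ℝ} {S0 : Stage C} {V : ℕ → Symb}

theorem lap_phi_succ (hV : ∀ n, Good TB1 (V n)) (n : ℕ) (p : (ℝ × ℝ) × ℝ) :
    lap (phi S0 V (n + 1)) p - lap (phi S0 V n) p = lap ((stg S0 n).lay (V n)) p := by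
  have := congr_fun (lap_add (contDiff_phi (S0 := S0) hV n) ((stg S0 n).contDiff_lay (hV n))) p
  change lap (phi S0 V (n + 1)) p = _ at this
  rw [this]; ring

theorem phi_eventuallyEq (hV : ∀ n, Good TB1 (V n)) {n m : ℕ} (hnm : n ≤ m) {p : (ℝ × ℝ) × ℝ}
    (hp : (stg S0 n).r / 2 < ‖p.1‖) (ht : p.2 < 1) : phi S0 V m =ᶠ[𝓝 p] phi S0 V n := by
  induction m, hnm using Nat.le_induction with
  | base => rfl
  | succ m hm ih =>
    have o1 : IsOpen {q : (ℝ × ℝ) × ℝ | (stg S0 n).r / 2 < ‖q.1‖} :=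
      isOpen_lt continuous_const (continuous_fst.norm)
    have o2 : IsOpen {q : (ℝ × ℝ) × ℝ | q.2 < 1} := isOpen_Iio.preimage continuous_snd
    filter_upwards [ih, o1.mem_nhds hp, o2.mem_nhds ht] with q h h1 h2
    have hr : (stg S0 m).r ≤ (stg S0 n).r := stg_r_anti S0 hm
    have h1' : (stg S0 n).r / 2 < ‖q.1‖ := h1
    rw [phi_succ, h, (stg S0 m).lay_eq_zero (hV m) (le_of_lt h2) (by linarith), add_zero]

theorem le_dd_lap_phi (h0 : S0.σ = St.rest) (hV : ∀ n, Good TB1 (V n)) (hV' : ∀ n, Van (V n))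
    {n m : ℕ} (hnm : n ≤ m) {x : ℝ × ℝ} (hx : (stg S0 n).r / 2 < ‖x‖) (hx' : ‖x‖ < (stg S0 n).r)
    {t : ℝ} (ht : t ∈ Ico (1 - 2 * (stg S0 n).β) 1) :
    (stg S0 n).G / 8 ≤ |dd e2 (lap (phi S0 V m)) (x, t)| := by
  have hβ := (stg S0 n).β_pos
  have hc := (contDiff_dd e2 (contDiff_lap (contDiff_phi (S0 := S0) hV m))).continuous
  have hcl : IsClosed {t | (stg S0 n).G / 8 ≤ |dd e2 (lap (phi S0 V m)) (x, t)|} :=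
    isClosed_le continuous_const (hc.comp (by fun_prop)).abs
  have : Icc (1 - 2 * (stg S0 n).β) 1 ⊆
      {t | (stg S0 n).G / 8 ≤ |dd e2 (lap (phi S0 V m)) (x, t)|} := by
    rw [← closure_Ioo (by linarith), hcl.closure_subset_iff]
    intro t ht
    have e := phi_eventuallyEq (S0 := S0) hV hnm (p := (x, t)) hx ht.2
    have k := (core_phi h0 hV hV' n (p := (x, t)) ht hx').2.2.2
    have s := ((stg S0 n).size ⟨ht.1.le, ht.2.le⟩).2.2.2.2
    rw [mem_ofPred_eq, (dd_congr (lap_congr e)).eq_of_nhds, k, abs_neg]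
    exact s.trans (le_abs_self _)
  exact this (Ico_subset_Icc_self ht)

theorem exists_bound_src (hC : ∀ x, |deriv smoothTransition x| ≤ C) (h0 : S0.σ = St.rest)
    (hV : ∀ n, Good TB1 (V n)) (hV' : ∀ n, Van (V n)) {J N : ℕ → ℕ}
    (hJ : Tendsto J atTop atTop)
    (hL : ∀ n, LayerBound (lead0 wave cutoff cutoff + V n) (J n) (N n))
    (hN : ∀ n, 4096 * ((N n : ℝ) + J n + 5) ≤ (stg S0 n).y) (K : ℕ) :
    ∃ M : ℝ, ∀ n x t, t ∈ Icc (0 : ℝ) 1 → ∀ i j, i + j ≤ K →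
      |ddMix i j (NN (phi S0 V n)) (x, t)| ≤ M := by
  obtain ⟨n0, hn0⟩ := eventually_atTop.1 (hJ.eventually_ge_atTop K)
  choose M hM using fun n i j => exists_bound_ddMix_NN (S0 := S0) hV n i j
  have hM0 : ∀ n i j, 0 ≤ M n i j := fun n i j =>
    (abs_nonneg _).trans (hM n i j 0 0 (by simp))
  set B : ℝ := ∑ n ∈ Finset.range (n0 + 1), ∑ i ∈ Finset.range (K + 1),
    ∑ j ∈ Finset.range (K + 1), M n i j with hB
  have hBle : ∀ n i j, n ≤ n0 → i + j ≤ K → M n i j ≤ B := by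
    intro n i j hn hij
    calc M n i j ≤ ∑ j ∈ Finset.range (K + 1), M n i j :=
          Finset.single_le_sum (f := fun j => M n i j) (fun j _ => hM0 n i j)
            (Finset.mem_range.2 (by omega))
      _ ≤ ∑ i ∈ Finset.range (K + 1), ∑ j ∈ Finset.range (K + 1), M n i j :=
          Finset.single_le_sum (f := fun i => ∑ j ∈ Finset.range (K + 1), M n i j)
            (fun i _ => Finset.sum_nonneg fun j _ => hM0 n i j) (Finset.mem_range.2 (by omega))
      _ ≤ B := Finset.single_le_sum (f := fun n => ∑ i ∈ Finset.range (K + 1),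
            ∑ j ∈ Finset.range (K + 1), M n i j)
            (fun n _ => Finset.sum_nonneg fun i _ => Finset.sum_nonneg fun j _ => hM0 n i j)
            (Finset.mem_range.2 (by omega))
  have hs : Summable fun n : ℕ => exp (-(n : ℝ)) := Real.summable_exp_neg_nat
  have key : ∀ k x t, t ∈ Icc (0 : ℝ) 1 → ∀ i j, i + j ≤ K →
      |ddMix i j (NN (phi S0 V (n0 + k))) (x, t)|
        ≤ B + ∑ m ∈ Finset.range (n0 + k), exp (-(m : ℝ)) := by
    intro k x t ht i j hij
    induction k with
    | zero =>
      have : 0 ≤ ∑ m ∈ Finset.range (n0 + 0), exp (-(m : ℝ)) :=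
        Finset.sum_nonneg fun _ _ => (exp_pos _).le
      have := (hM n0 i j x t ht).trans (hBle n0 i j le_rfl hij)
      rw [add_zero] at *; linarith
    | succ k ih =>
      rw [← add_assoc, Finset.sum_range_succ, ddMix_NN_succ hV]
      have h1 := ddMix_err_le hC h0 hV hV' (hL (n0 + k)) (hN (n0 + k))
        (hij.trans (hn0 (n0 + k) (by omega))) (p := (x, t)) ht.2
      have h2 : exp (-(stg S0 (n0 + k)).y) ≤ exp (-((n0 + k : ℕ) : ℝ)) := by
        rw [exp_le_exp]; linarith [stg_y_ge S0 (n0 + k)]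
      linarith [abs_add_le (ddMix i j (NN (phi S0 V (n0 + k))) (x, t))
        (ddMix i j (err S0 V (n0 + k)) (x, t))]
  refine ⟨B + ∑' m : ℕ, exp (-(m : ℝ)), fun n x t ht i j hij => ?_⟩
  rcases le_total n n0 with h | h
  · have : 0 ≤ ∑' m : ℕ, exp (-(m : ℝ)) := tsum_nonneg fun _ => (exp_pos _).le
    linarith [(hM n i j x t ht).trans (hBle n i j h hij)]
  · obtain ⟨k, rfl⟩ := Nat.exists_eq_add_of_le h
    exact (key k x t ht i j hij).trans (by
      gcongr; exact hs.sum_le_tsum _ fun _ _ => (exp_pos _).le)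

theorem eventually_exponent_le {J : ℕ → ℕ} (hJ : Tendsto J atTop atTop) {b : ℝ} (hb : 0 < b) :
    ∀ᶠ n : ℕ in atTop, -b * (stg S0 n).y ^ 2 + (stg S0 n).y ^ 2 / (J n + 1) ≤ -(b / 2) * n := by
  have h1 : Tendsto (fun n => (1 : ℝ) / (J n + 1)) atTop (𝓝 0) :=
    tendsto_one_div_add_atTop_nhds_zero_nat.comp hJ
  filter_upwards [h1.eventually (eventually_le_nhds (half_pos hb))] with n hn
  have h2 := stg_y_ge S0 n
  have h3 : (n : ℝ) ≤ (stg S0 n).y ^ 2 := by nlinarith [Nat.cast_nonneg (α := ℝ) n]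
  have h4 : (stg S0 n).y ^ 2 / (J n + 1) ≤ (stg S0 n).y ^ 2 * (b / 2) := by
    rw [div_eq_mul_one_div]; gcongr
  nlinarith

end sequence

theorem exists_approx : ∃ (Φ : ℕ → (ℝ × ℝ) × ℝ → ℝ) (T ρs c Lp g : ℕ → ℝ) (pt : ℕ → ℝ × ℝ),
    Approx Φ T ρs c Lp g pt := by
  obtain ⟨C, hC⟩ := exists_deriv_smoothTransition_le
  obtain ⟨Y, hY⟩ := eventually_big C
  choose Vf hV hV' Nf hL using exists_layer per_wave cut_cutoff cut_cutoff
  set Λ : ℝ := max (max Y 1000) (4096 * ((Nf 0 : ℝ) + 5)) with hΛ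
  have hΛY : Y ≤ Λ := (le_max_left _ _).trans (le_max_left _ _)
  have hΛ1 : 1000 ≤ Λ := (le_max_right _ _).trans (le_max_left _ _)
  let S0 : Stage C :=
    { y := Λ, s := 1, g := 1, h := 1, σ := St.rest
      big := fun z hz => hY z (hΛY.trans hz)
      one_le := le_rfl
      g_le := by linarith
      h_ge := by
        have : Λ ≤ Λ ^ 34 := le_self_pow₀ (by linarith) (by norm_num)
        rw [← div_eq_mul_inv, div_le_one (by positivity)]
        linarith
      hs := Or.inl rfl
      inv := by constructor <;> simp [St.rest] }
  obtain ⟨J, hJ, hJ'⟩ := exists_slow_index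
    (P := fun j n => 4096 * ((Nf j : ℝ) + j + 5) * (j + 1) ≤ (stg S0 n).y)
    (fun n => by
      have h1 : S0.y ≤ (stg S0 n).y := stg_y_mono S0 (Nat.zero_le n)
      have h2 : 4096 * ((Nf 0 : ℝ) + 5) ≤ S0.y := le_max_right _ _
      simpa using h2.trans h1)
    (fun j => (tendsto_stg_y S0).eventually_ge_atTop _)
  have hN1 : ∀ n, 4096 * ((Nf (J n) : ℝ) + J n + 5) ≤ (stg S0 n).y := fun n =>
    le_trans (le_mul_of_one_le_right (by positivity) (by simp)) (hJ n)
  have hN2 : ∀ n, (Nf (J n) : ℝ) * (J n + 1) ≤ (stg S0 n).y := fun n => by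
    refine le_trans ?_ (hJ n)
    gcongr
    have : (0 : ℝ) ≤ Nf (J n) := by positivity
    have : (0 : ℝ) ≤ J n := by positivity
    linarith
  have gV : ∀ n, Good TB1 (Vf (J n)) := fun n => hV _
  have gV' : ∀ n, Van (Vf (J n)) := fun n => hV' _
  refine ⟨phi S0 fun n => Vf (J n), fun n => 1 - 2 * (stg S0 n).β, fun n => (stg S0 n).r / 2,
    fun n => exp (-(stg S0 n).y ^ 2 + (stg S0 n).y ^ 2 / (J n + 1)),
    fun n => 2 * exp ((stg S0 n).y ^ 2 / (J n + 1)), fun n => (stg S0 n).G / 8,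
    fun n => (3 / 4 * (stg S0 n).r, 0), ?_⟩
  constructor
  case smooth => exact fun n => contDiff_phi gV n
  case Tlt => exact fun n => by linarith [(stg S0 n).β_pos]
  case Tmono =>
    exact fun n m h => by
      have : (stg S0 m).β ≤ (stg S0 n).β := stg_β_anti S0 h
      linarith
  case Tlim => simpa using ((tendsto_stg_β S0).const_mul 2).const_sub 1
  case stat =>
    exact fun n x t ht => by
      rw [phi_succ, (stg S0 n).lay_eq_zero_of_time ht, add_zero]
  case base => exact fun x t hx => phiZero_eq_zero hx
  case supp =>
    exact fun n x t ht hx => by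
      rw [phi_succ, (stg S0 n).lay_eq_zero (gV n) ht hx, add_zero]
  case rad => exact fun n => by linarith [(stg S0 n).r_le_one]
  case radlim => simpa using (tendsto_stg_r S0).div_const 2
  case src => exact exists_bound_src hC rfl gV gV' hJ' (fun n => hL _) hN1
  case dens =>
    exact fun n x t ht => by
      rw [lap_phi_succ gV]
      exact (stg S0 n).abs_lap_lay_le (gV n) (hL _) (hN2 n) ht.2
  case csum =>
    exact summable_exp_of_eventually_le (b := 1 / 2) (by norm_num)
      (by simpa using eventually_exponent_le (S0 := S0) hJ' one_pos)
  case lip =>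
    exact fun n x y => by
      rw [lap_phi_succ gV, lap_phi_succ gV]
      exact (stg S0 n).abs_lap_lay_sub_le (gV n) (hL _) (hN2 n) x y
  case hsum =>
    intro α hα
    have hb : 0 < 1 - α := by linarith [hα.2]
    have := (summable_exp_of_eventually_le (half_pos hb)
      (eventually_exponent_le (S0 := S0) hJ' hb)).mul_left ((2 : ℝ) ^ α)
    refine this.congr fun n => ?_
    rw [mul_rpow (by norm_num) (exp_pos _).le, ← exp_mul, ← exp_mul, mul_left_comm, ← exp_add]
    congr 2; ring
  case grow =>
    intro n m hnm t ht
    have hr := (stg S0 n).r_pos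
    have e : ‖((3 / 4 * (stg S0 n).r, 0) : ℝ × ℝ)‖ = 3 / 4 * (stg S0 n).r := by
      rw [Prod.norm_mk, norm_zero, norm_of_nonneg (by positivity), max_eq_left (by positivity)]
    exact le_dd_lap_phi rfl gV gV' hnm (by rw [e]; linarith) (by rw [e]; linarith) ht
  case glim => exact (tendsto_stg_G S0).atTop_div_const (by norm_num)

/-- Regularity at the blowup time for IPM with a smooth source. -/
theorem ipm_blowup_regularity_at_final_time :
    ∃ (ρ₀ : ℝ × ℝ → ℝ) (ρ P F : (ℝ × ℝ) × ℝ → ℝ) (u : (ℝ × ℝ) × ℝ → ℝ × ℝ),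
      -- `ρ₀ ∈ C_c^∞(ℝ²)`
      ContDiff ℝ (⊤ : ℕ∞) ρ₀ ∧ HasCompactSupport ρ₀ ∧
      -- each `F(·,t)` is `C^∞`, supported in the closed unit ball
      (∀ t ∈ Set.Ico (0 : ℝ) 1, ContDiff ℝ (⊤ : ℕ∞) (fun x => F (x, t))) ∧
      (∀ t ∈ Set.Ico (0 : ℝ) 1, ∀ x : ℝ × ℝ, F (x, t) ≠ 0 → x.1 ^ 2 + x.2 ^ 2 ≤ 1) ∧
      -- uniform-in-time bound on every `C^k` norm of the source
      (∀ k : ℕ, ∃ M : ℝ, ∀ t ∈ Set.Ico (0 : ℝ) 1, CkNorm k (fun x => F (x, t)) ≤ M) ∧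
      -- `ρ, u, P` are smooth on `ℝ² × [0,1)`
      ContDiffOn ℝ (⊤ : ℕ∞) ρ spaceTime ∧ ContDiffOn ℝ (⊤ : ℕ∞) u spaceTime ∧ ContDiffOn ℝ (⊤ : ℕ∞) P spaceTime ∧
      -- initial datum
      (∀ x : ℝ × ℝ, ρ (x, 0) = ρ₀ x) ∧
      -- each `ρ(·,t)` is compactly supported and `u(·,t)` is square integrable
      (∀ t ∈ Set.Ico (0 : ℝ) 1, HasCompactSupport (fun x => ρ (x, t))) ∧
      (∀ t ∈ Set.Ico (0 : ℝ) 1, Integrable (fun x : ℝ × ℝ => ‖u (x, t)‖ ^ 2)) ∧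
      -- the IPM system: transport equation, Darcy's law, incompressibility
      (∀ x : ℝ × ℝ, ∀ t ∈ Set.Ico (0 : ℝ) 1,
        fderivWithin ℝ ρ spaceTime (x, t) ((0, 0), 1)
            + (u (x, t)).1 * fderivWithin ℝ ρ spaceTime (x, t) ((1, 0), 0)
            + (u (x, t)).2 * fderivWithin ℝ ρ spaceTime (x, t) ((0, 1), 0) = F (x, t) ∧
        (u (x, t)).1 = -fderivWithin ℝ P spaceTime (x, t) ((1, 0), 0) ∧
        (u (x, t)).2 = -fderivWithin ℝ P spaceTime (x, t) ((0, 1), 0) - ρ (x, t) ∧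
        (fderivWithin ℝ u spaceTime (x, t) ((1, 0), 0)).1
            + (fderivWithin ℝ u spaceTime (x, t) ((0, 1), 0)).2 = 0) ∧
      -- blow-up of the `C¹` norm as `t → 1⁻`
      Tendsto (fun t => CkNorm 1 (fun x => ρ (x, t)))
        (nhdsWithin (1 : ℝ) (Set.Iio 1)) atTop ∧
      -- uniform convergence, as `t → 1⁻`, to a compactly supported limit which is
      -- smooth away from the origin and `α`-Hölder for every `α ∈ (0,1)`
      (∃ ρ₁ : ℝ × ℝ → ℝ,
        TendstoUniformly (fun t (x : ℝ × ℝ) => ρ (x, t)) ρ₁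
          (nhdsWithin (1 : ℝ) (Set.Iio 1)) ∧
        HasCompactSupport ρ₁ ∧
        ContDiffOn ℝ (⊤ : ℕ∞) ρ₁ {x : ℝ × ℝ | x ≠ 0} ∧
        (∀ α : ℝ, α ∈ Set.Ioo (0 : ℝ) 1 → ∃ C > 0, ∀ x y : ℝ × ℝ,
          |ρ₁ x - ρ₁ y| ≤ C * Real.sqrt ((x.1 - y.1) ^ 2 + (x.2 - y.2) ^ 2) ^ α)) := by
  obtain ⟨Φ, T, ρs, c, Lp, g, pt, H⟩ := exists_approx
  obtain ⟨ρ₁, hρ₁⟩ := H.exists_limit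
  have hU : ∀ p ∈ spaceTime, p.2 < 1 := fun p hp => hp.2.2
  set φ := glue Φ T with hφ
  have hsm : ∀ {f : ((ℝ × ℝ) × ℝ → ℝ) → (ℝ × ℝ) × ℝ → ℝ},
      (∀ {φ}, ContDiff ℝ (⊤ : ℕ∞) φ → ContDiff ℝ (⊤ : ℕ∞) (f φ)) →
      (∀ {φ ψ p}, φ =ᶠ[𝓝 p] ψ → f φ =ᶠ[𝓝 p] f ψ) → ∀ p ∈ spaceTime,
      ContDiffAt ℝ (⊤ : ℕ∞) (f φ) p := fun hf hc p hp => H.cont_glue hf hc (hU p hp)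
  have hlap := hsm (f := lap) contDiff_lap lap_congr
  have h12 := hsm (f := fun φ => dd e1 (dd e2 φ)) (fun h => contDiff_dd _ (contDiff_dd _ h))
    fun h => dd_congr (dd_congr h)
  have h11 := hsm (f := fun φ => dd e1 (dd e1 φ)) (fun h => contDiff_dd _ (contDiff_dd _ h))
    fun h => dd_congr (dd_congr h)
  have h2 := hsm (f := fun φ => dd e2 φ) (fun h => contDiff_dd _ h) fun h => dd_congr h
  have hslice : ∀ t < 1, ∀ {f : ((ℝ × ℝ) × ℝ → ℝ) → (ℝ × ℝ) × ℝ → ℝ},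
      (∀ {φ}, ContDiff ℝ (⊤ : ℕ∞) φ → ContDiff ℝ (⊤ : ℕ∞) (f φ)) →
      (∀ {φ ψ p}, φ =ᶠ[𝓝 p] ψ → f φ =ᶠ[𝓝 p] f ψ) →
      ContDiff ℝ (⊤ : ℕ∞) fun x => f φ (x, t) := by
    intro t ht f hf hc
    obtain ⟨n, hn⟩ := H.slice_glue ht
    simp_rw [hφ, hn f hc]
    exact (hf (H.smooth n)).comp (contDiff_prodMk_left t)
  have hz : ∀ t < 1, ∀ {f : ((ℝ × ℝ) × ℝ → ℝ) → (ℝ × ℝ) × ℝ → ℝ},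
      (∀ {φ ψ p}, φ =ᶠ[𝓝 p] ψ → f φ =ᶠ[𝓝 p] f ψ) → (f (fun _ => 0) = fun _ => 0) →
      ∀ x, 1 / 2 < ‖x‖ → f φ (x, t) = 0 := by
    intro t ht f hc h0 x hx
    rw [(hc (H.glue_zero_ev ht hx)).eq_of_nhds, h0]
  have hρsm : ∀ t < 1, ContDiff ℝ (⊤ : ℕ∞) fun x => -lap φ (x, t) := fun t ht =>
    (hslice t ht (f := lap) contDiff_lap lap_congr).neg
  have hρcs : ∀ t < 1, HasCompactSupport fun x => -lap φ (x, t) := fun t ht =>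
    hasCompactSupport_of_norm fun x hx => by
      rw [hz t ht (f := lap) lap_congr lap_zero x hx, neg_zero]
  refine ⟨fun x => -lap φ (x, 0), fun p => -lap φ p, dd e2 φ, fun p => -NN φ p,
    fun p => (-dd e1 (dd e2 φ) p, dd e1 (dd e1 φ) p), hρsm 0 one_pos, hρcs 0 one_pos,
    fun t ht => (hslice t ht.2 (f := NN) contDiff_NN NN_congr).neg, ?_, ?_, ?_, ?_, ?_,
    fun x => rfl, fun t ht => hρcs t ht.2, ?_, ?_, ?_, ?_⟩
  · intro t ht x hx
    by_contra hcon
    refine hx ?_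
    change -NN φ (x, t) = 0
    rw [hz t ht.2 (f := NN) NN_congr NN_zero x, neg_zero]
    by_contra hle
    push Not at hle
    rw [Prod.norm_def, max_le_iff, Real.norm_eq_abs, Real.norm_eq_abs, abs_le, abs_le] at hle
    nlinarith [hle.1.1, hle.1.2, hle.2.1, hle.2.2]
  · intro k
    obtain ⟨M, hM⟩ := H.src k
    refine ⟨max M 0, fun t ht => ?_⟩
    obtain ⟨n, hn⟩ := H.slice_glue ht.2
    refine Real.sSup_le ?_ (le_max_right _ _)
    rintro y ⟨i, j, x, hij, rfl⟩
    have : (fun x => -NN φ (x, t)) = fun x => (fun p => -NN (Φ n) p) (x, t) := by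
      funext x; rw [hφ, hn NN NN_congr]
    rw [this, pdMix_slice (contDiff_NN (H.smooth n)).neg]
    have hneg : ddMix i j (fun p => -NN (Φ n) p) = fun p => -ddMix i j (NN (Φ n)) p := by
      have : ∀ (v : (ℝ × ℝ) × ℝ) (j : ℕ) (ψ : (ℝ × ℝ) × ℝ → ℝ),
          (dd v)^[j] (fun p => -ψ p) = fun p => -(dd v)^[j] ψ p := by
        intro v j ψ
        induction j with
        | zero => rfl
        | succ j ih => simp only [Function.iterate_succ_apply', ih, dd_neg]
      simp only [ddMix, this]
    rw [hneg, abs_neg]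
    exact (hM n x t ⟨ht.1, ht.2.le⟩ i j hij).trans (le_max_left _ _)
  · exact fun p hp => (hlap p hp).neg.contDiffWithinAt
  · exact fun p hp => ((h12 p hp).neg.prodMk (h11 p hp)).contDiffWithinAt
  · exact fun p hp => (h2 p hp).contDiffWithinAt
  · intro t ht
    have hc : Continuous fun x : ℝ × ℝ => ‖((-dd e1 (dd e2 φ) (x, t), dd e1 (dd e1 φ) (x, t)) : ℝ × ℝ)‖ ^ 2 := by
      have a := (hslice t ht.2 (f := fun φ => dd e1 (dd e2 φ))
        (fun h => contDiff_dd _ (contDiff_dd _ h)) fun h => dd_congr (dd_congr h)).continuous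
      have b := (hslice t ht.2 (f := fun φ => dd e1 (dd e1 φ))
        (fun h => contDiff_dd _ (contDiff_dd _ h)) fun h => dd_congr (dd_congr h)).continuous
      exact (a.neg.prodMk b).norm.pow 2
    refine hc.integrable_of_hasCompactSupport (hasCompactSupport_of_norm fun x hx => ?_)
    rw [hz t ht.2 (f := fun φ => dd e1 (dd e2 φ)) (fun h => dd_congr (dd_congr h)) (by simp) x hx,
      hz t ht.2 (f := fun φ => dd e1 (dd e1 φ)) (fun h => dd_congr (dd_congr h)) (by simp) x hx]
    simp
  · intro x t ht
    have hp : ((x, t) : (ℝ × ℝ) × ℝ) ∈ spaceTime := ⟨mem_univ _, ht⟩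
    have da : ∀ {E : Type} [NormedAddCommGroup E] [NormedSpace ℝ E] {f : (ℝ × ℝ) × ℝ → E},
        ContDiffAt ℝ (⊤ : ℕ∞) f (x, t) → DifferentiableAt ℝ f (x, t) :=
      fun h => h.differentiableAt (by simp)
    rw [fderivWithin_spaceTime (da (hlap _ hp).neg) hp, fderivWithin_spaceTime (da (h2 _ hp)) hp,
      fderivWithin_spaceTime (da ((h12 _ hp).neg.prodMk (h11 _ hp))) hp, fderiv_fun_neg,
      DifferentiableAt.fderiv_prodMk (da (h12 _ hp).neg) (da (h11 _ hp)), fderiv_fun_neg]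
    refine ⟨?_, rfl, ?_, ?_⟩
    · simp only [NN, dd, neg_apply]
      ring
    · simp only [lap, dd]
      ring
    · obtain ⟨n, -, hn⟩ := H.exists_T ht.2 0
      have hev := H.glue_ev (p := (x, t)) hn
      have e1' := (dd_congr (v := e2) (dd_congr (v := e1) (dd_congr (v := e1) hev))).eq_of_nhds
      have e2' := (dd_congr (v := e1) (dd_congr (v := e1) (dd_congr (v := e2) hev))).eq_of_nhds
      have e3 : dd e2 (dd e1 (dd e1 (Φ n))) = dd e1 (dd e1 (dd e2 (Φ n))) := by
        rw [dd_comm (contDiff_dd _ (H.smooth n)), dd_comm (v := e2) (w := e1) (H.smooth n)]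
      have e4 : dd e2 (dd e1 (dd e1 φ)) (x, t) = dd e1 (dd e1 (dd e2 φ)) (x, t) := by
        rw [hφ, e1', e2', e3]
      simp only [dd] at e4 ⊢
      simp [e4]
  · rw [tendsto_atTop]
    intro A
    obtain ⟨n, hn⟩ := (H.glim.eventually_ge_atTop A).exists
    filter_upwards [Ioo_mem_nhdsLT (H.Tlt n)] with t ht
    obtain ⟨m, hm, hmt⟩ := H.slice_glue_ge ht.2 n
    refine hn.trans ((H.grow n m hm t ⟨ht.1.le, ht.2⟩).trans
      (le_trans (le_of_eq ?_) (ckNorm_ge (hρsm t ht.2) (hρcs t ht.2) (pt n))))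
    rw [hφ, hmt, pd2_slice (φ := fun p => -lap (Φ m) p) fun x => (contDiff_lap (H.smooth m)).neg.dat,
      dd_neg, abs_neg]
  · exact ⟨ρ₁, H.unif hρ₁, hasCompactSupport_of_norm fun x hx => H.limit_zero hρ₁ hx,
      H.limit_smooth hρ₁, fun α hα => H.holder hρ₁ hα⟩
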